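/- arXiv:1106.4457 — 16 statements merged into one kernel-verified Lean document; each statement's English description precedes it below -/
import Mathlib

section
/- Let E be a compact topological space equipped with a preorder ≤ whose graph is closed in E × E. If F ⊆ E is an increasing set, V ⊆ E is open, and F ⊆ V, then there exists an open increasing set W with F ⊆ W ⊆ V. The analogous statement holds with 'increasing' replaced by 'decreasing'. -/
/-- Let `E` be a compact topological space with a preorder whose graph is closed in
`E × E`.  If `F` is an increasing (upper) set, `V` is open and `F ⊆ V`, then there is
an open increasing set `W` with `F ⊆ W ⊆ V`; analogously in the decreasing case. -/
theorem exists_open_monotone_between_of_compact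
    {E : Type*} [TopologicalSpace E] [Preorder E] [CompactSpace E]
    (hG : IsClosed {p : E × E | p.1 ≤ p.2}) :
    (∀ F V : Set E, IsUpperSet F → IsOpen V → F ⊆ V →
      ∃ W : Set E, IsOpen W ∧ IsUpperSet W ∧ F ⊆ W ∧ W ⊆ V) ∧
    (∀ F V : Set E, IsLowerSet F → IsOpen V → F ⊆ V →
      ∃ W : Set E, IsOpen W ∧ IsLowerSet W ∧ F ⊆ W ∧ W ⊆ V) := by
  constructor
  · intro F V hF hV hFV
    have hc : IsClosed (Prod.fst '' ({p : E × E | p.1 ≤ p.2} ∩ Prod.snd ⁻¹' Vᶜ)) :=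
      isClosedMap_fst_of_compactSpace _ (hG.inter (hV.isClosed_compl.preimage continuous_snd))
    refine ⟨_, hc.isOpen_compl, ?_, ?_, ?_⟩
    · rintro a b hab ha ⟨⟨x, y⟩, ⟨hxy, hy⟩, rfl⟩
      exact ha ⟨(a, y), ⟨le_trans hab hxy, hy⟩, rfl⟩
    · rintro a ha ⟨⟨x, y⟩, ⟨hxy, hy⟩, rfl⟩
      exact hy (hFV (hF hxy ha))
    · intro a ha
      by_contra h
      exact ha ⟨(a, a), ⟨le_refl a, h⟩, rfl⟩
  · intro F V hF hV hFV
    have hc : IsClosed (Prod.snd '' ({p : E × E | p.1 ≤ p.2} ∩ Prod.fst ⁻¹' Vᶜ)) :=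
      isClosedMap_snd_of_compactSpace _ (hG.inter (hV.isClosed_compl.preimage continuous_fst))
    refine ⟨_, hc.isOpen_compl, ?_, ?_, ?_⟩
    · rintro a b hab ha ⟨⟨x, y⟩, ⟨hxy, hx⟩, rfl⟩
      exact ha ⟨(x, a), ⟨le_trans hxy hab, hx⟩, rfl⟩
    · rintro a ha ⟨⟨x, y⟩, ⟨hxy, hx⟩, rfl⟩
      exact hx (hFV (hF hxy ha))
    · intro a ha
      by_contra h
      exact ha ⟨(a, a), ⟨le_refl a, h⟩, rfl⟩
end

section
/- Every compact topological space E equipped with a preorder ≤ whose graph is closed in E × E is a normally preordered space: for every closed decreasing set A and closed increasing set B with A ∩ B = ∅ there exist an open decreasing set U ⊇ A and an open increasing set V ⊇ B with U ∩ V = ∅ (and moreover i(x), d(x) are closed for every x). -/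
/-- A topological preordered space is *normally preordered* if `i(x) = Ici x` and
`d(x) = Iic x` are closed for every `x` (semiclosedness) and every disjoint pair of a
closed decreasing set `A` and a closed increasing set `B` can be separated by disjoint
open sets `U ⊇ A` (decreasing) and `V ⊇ B` (increasing). -/
def NormallyPreordered (E : Type*) [TopologicalSpace E] [Preorder E] : Prop :=
  (∀ x : E, IsClosed (Set.Ici x) ∧ IsClosed (Set.Iic x)) ∧
  ∀ A B : Set E, IsClosed A → IsLowerSet A → IsClosed B → IsUpperSet B →
    A ∩ B = ∅ →
    ∃ U V : Set E, IsOpen U ∧ IsLowerSet U ∧ IsOpen V ∧ IsUpperSet V ∧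
      A ⊆ U ∧ B ⊆ V ∧ U ∩ V = ∅

/-- Every compact topological space equipped with a preorder whose graph is closed in
`E × E` is a normally preordered space. -/
theorem compact_closedPreorder_normallyPreordered
    (E : Type*) [TopologicalSpace E] [Preorder E] [CompactSpace E]
    (hG : IsClosed {p : E × E | p.1 ≤ p.2}) :
    NormallyPreordered E := by
  refine ⟨fun x => ⟨?_, ?_⟩, ?_⟩
  · exact hG.preimage (f := fun y : E => (x, y)) (by fun_prop)
  · exact hG.preimage (f := fun y : E => (y, x)) (by fun_prop)
  intro A B hA hAl hB hBu hAB
  have hsub : B ×ˢ A ⊆ {p : E × E | p.1 ≤ p.2}ᶜ := by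
    rintro ⟨b, a⟩ ⟨hb, ha⟩ hle
    have h : a ∈ A ∩ B := ⟨ha, hBu hle hb⟩
    rw [hAB] at h
    exact h
  obtain ⟨V₀, U₀, hV₀, hU₀, hBV, hAU, hVU⟩ :=
    generalized_tube_lemma hB.isCompact hA.isCompact hG.isOpen_compl hsub
  have hUc : IsClosed (Prod.snd '' ({p : E × E | p.1 ≤ p.2} ∩ Prod.fst ⁻¹' U₀ᶜ)) :=
    isClosedMap_snd_of_compactSpace _ (hG.inter (hU₀.isClosed_compl.preimage continuous_fst))
  have hVc : IsClosed (Prod.fst '' ({p : E × E | p.1 ≤ p.2} ∩ Prod.snd ⁻¹' V₀ᶜ)) :=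
    isClosedMap_fst_of_compactSpace _ (hG.inter (hV₀.isClosed_compl.preimage continuous_snd))
  refine ⟨_, _, hUc.isOpen_compl, ?_, hVc.isOpen_compl, ?_, ?_, ?_, ?_⟩
  · rintro x y hyx hx ⟨⟨z, w⟩, ⟨hzw, hz⟩, rfl⟩
    exact hx ⟨(z, x), ⟨le_trans hzw hyx, hz⟩, rfl⟩
  · rintro x y hxy hx ⟨⟨z, w⟩, ⟨hzw, hw⟩, rfl⟩
    exact hx ⟨(x, w), ⟨le_trans hxy hzw, hw⟩, rfl⟩
  · rintro x hx ⟨⟨z, w⟩, ⟨hzw, hz⟩, rfl⟩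
    exact hz (hAU (hAl hzw hx))
  · rintro x hx ⟨⟨z, w⟩, ⟨hzw, hw⟩, rfl⟩
    exact hw (hBV (hBu hzw hx))
  · rw [Set.eq_empty_iff_forall_notMem]
    rintro x ⟨hxU, hxV⟩
    have h1 : x ∈ U₀ := by
      by_contra h
      exact hxU ⟨(x, x), ⟨le_refl x, h⟩, rfl⟩
    have h2 : x ∈ V₀ := by
      by_contra h
      exact hxV ⟨(x, x), ⟨le_refl x, h⟩, rfl⟩
    exact hVU (Set.mk_mem_prod h2 h1) (le_refl x)
end

section
/- Let E be a topological space equipped with a preorder ≤ whose graph is closed in E × E, and let S ⊆ E be a compact subspace (with the subspace topology and induced preorder). Then S is a preordered subspace of E: every open increasing subset of S is the intersection with S of an open increasing subset of E, and every open decreasing subset of S is the intersection with S of an open decreasing subset of E. -/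
/-- In a topological space `E` with a preorder whose graph is closed in `E × E`, every
compact subspace `S` (subspace topology, induced preorder) is a *preordered subspace*:
every open increasing subset of `S` is the intersection with `S` of an open increasing
subset of `E`, and likewise in the decreasing case.  (For `W : Set S`, "intersection
with `S`" is expressed as the preimage `Subtype.val ⁻¹' V`.) -/
theorem compact_subspace_is_preordered_subspace
    {E : Type*} [TopologicalSpace E] [Preorder E]
    (hG : IsClosed {p : E × E | p.1 ≤ p.2})
    (S : Set E) (hS : IsCompact S) :
    (∀ W : Set S, IsOpen W → IsUpperSet W →
      ∃ V : Set E, IsOpen V ∧ IsUpperSet V ∧ W = Subtype.val ⁻¹' V) ∧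
    (∀ W : Set S, IsOpen W → IsLowerSet W →
      ∃ U : Set E, IsOpen U ∧ IsLowerSet U ∧ W = Subtype.val ⁻¹' U) := by
  haveI : CompactSpace S := isCompact_iff_compactSpace.mp hS
  -- projecting a closed subset of `S × E` along the compact factor gives a closed set
  have key : ∀ (W : Set S) (A : Set (S × E)), IsOpen W → IsClosed A →
      IsClosed (Prod.snd '' ((Prod.fst ⁻¹' Wᶜ) ∩ A)) := fun W A hW hA =>
    isClosedMap_snd_of_compactSpace _ ((hW.isClosed_compl.preimage continuous_fst).inter hA)
  constructor
  · intro W hW hup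
    have hA : IsClosed {p : S × E | p.2 ≤ p.1.val} :=
      hG.preimage (f := fun p : S × E => (p.2, p.1.val)) (by fun_prop)
    refine ⟨_, (key W _ hW hA).isOpen_compl, ?_, ?_⟩
    · rintro x y hxy hx ⟨⟨s, z⟩, ⟨hs, hz⟩, rfl⟩
      exact hx ⟨(s, x), ⟨hs, le_trans hxy hz⟩, rfl⟩
    · ext w
      constructor
      · rintro hw ⟨⟨s, z⟩, ⟨hs, hz⟩, rfl⟩
        exact hs (hup hz hw)
      · intro h
        by_contra hw
        exact h ⟨(w, w.val), ⟨hw, le_refl w.val⟩, rfl⟩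
  · intro W hW hlo
    have hA : IsClosed {p : S × E | p.1.val ≤ p.2} :=
      hG.preimage (f := fun p : S × E => (p.1.val, p.2)) (by fun_prop)
    refine ⟨_, (key W _ hW hA).isOpen_compl, ?_, ?_⟩
    · rintro x y hyx hx ⟨⟨s, z⟩, ⟨hs, hz⟩, rfl⟩
      exact hx ⟨(s, x), ⟨hs, le_trans hz hyx⟩, rfl⟩
    · ext w
      constructor
      · rintro hw ⟨⟨s, z⟩, ⟨hs, hz⟩, h⟩
        subst h
        exact hs (hlo hz hw)
      · intro h
        by_contra hw
        exact h ⟨(w, w.val), ⟨hw, le_refl w.val⟩, rfl⟩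
end

section
/- Let E be a k_ω-space equipped with a preorder ≤ whose graph is closed in E × E. Then E is a normally preordered space: i(x) and d(x) are closed for every x, and for every closed decreasing set A and closed increasing set B with A ∩ B = ∅ there exist an open decreasing set U ⊇ A and an open increasing set V ⊇ B with U ∩ V = ∅. -/
/-- A sequence of compact sets is *admissible* for `E` if it covers `E` and a set
`O ⊆ E` is open iff `O ∩ K n` is open in the subspace topology of `K n` for every `n`. -/
def IsAdmissibleSeq {E : Type*} [TopologicalSpace E] (K : ℕ → Set E) : Prop :=
  (∀ n, IsCompact (K n)) ∧ (⋃ n, K n) = Set.univ ∧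
    ∀ O : Set E, IsOpen O ↔ ∀ n, IsOpen ((Subtype.val ⁻¹' O : Set (K n)))

/-- A space is a `k_ω`-space if it admits an admissible sequence of compact sets. -/
def IsKOmegaSpace (E : Type*) [TopologicalSpace E] : Prop :=
  ∃ K : ℕ → Set E, IsAdmissibleSeq K

theorem kOm_isClosed_upper {E : Type*} [TopologicalSpace E] [Preorder E]
    (hG : IsClosed {p : E × E | p.1 ≤ p.2}) {K : Set E} (hK : IsCompact K) :
    IsClosed {y : E | ∃ x ∈ K, x ≤ y} := by
  rw [← isOpen_compl_iff, isOpen_iff_mem_nhds]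
  intro y hy
  obtain ⟨u, v, hu, hv, hKu, hyv, huv⟩ := generalized_tube_lemma hK (isCompact_singleton (x := y))
    hG.isOpen_compl (by
      rintro ⟨a, b⟩ ⟨ha, hb⟩ hab
      simp only [Set.mem_singleton_iff] at hb
      subst hb
      exact hy ⟨a, ha, hab⟩)
  refine Filter.mem_of_superset (hv.mem_nhds (hyv rfl)) ?_
  rintro z hz ⟨x, hx, hxz⟩
  exact huv (Set.mk_mem_prod (hKu hx) hz) hxz

theorem kOm_isClosed_lower {E : Type*} [TopologicalSpace E] [Preorder E]
    (hG : IsClosed {p : E × E | p.1 ≤ p.2}) {K : Set E} (hK : IsCompact K) :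
    IsClosed {y : E | ∃ x ∈ K, y ≤ x} := by
  have h : IsClosed {p : Eᵒᵈ × Eᵒᵈ | p.1 ≤ p.2} := hG.preimage continuous_swap
  exact kOm_isClosed_upper (E := Eᵒᵈ) h hK

theorem kOm_sep {E : Type*} [TopologicalSpace E] [Preorder E]
    (hG : IsClosed {p : E × E | p.1 ≤ p.2}) {K F G : Set E} (hK : IsCompact K)
    (hF : IsClosed F) (hFl : IsLowerSet F) (hGc : IsClosed G) (hGu : IsUpperSet G)
    (hFG : Disjoint F G) :
    ∃ U V : Set E, IsOpen U ∧ IsOpen V ∧ F ∩ K ⊆ U ∧ G ∩ K ⊆ V ∧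
      ∀ x ∈ K, x ∈ U → x ∉ V := by
  rw [Set.disjoint_left] at hFG
  obtain ⟨v, u, hv, hu, hGv, hFu, hvu⟩ := generalized_tube_lemma (hK.inter_left hGc)
    (hK.inter_left hF) hG.isOpen_compl (by
      rintro ⟨a, b⟩ ⟨ha, hb⟩ hab
      exact hFG (hFl hab hb.1) ha.1)
  refine ⟨u, v, hu, hv, hFu, hGv, fun x _ hxu hxv => hvu (Set.mk_mem_prod hxv hxu) (le_refl x)⟩

theorem kOm_half {E : Type*} [TopologicalSpace E] [Preorder E]
    (hG : IsClosed {p : E × E | p.1 ≤ p.2}) {K F G : Set E} (hK : IsCompact K)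
    (hF : IsClosed F) (hFl : IsLowerSet F) (hGc : IsClosed G) (hGu : IsUpperSet G)
    (hFG : Disjoint F G) :
    ∃ F' : Set E, IsClosed F' ∧ IsLowerSet F' ∧ F ⊆ F' ∧ Disjoint F' G ∧
      ∃ U, IsOpen U ∧ F ∩ K ⊆ U ∧ U ∩ K ⊆ F' := by
  obtain ⟨U, V, hU, hV, hFU, hGV, hUV⟩ := kOm_sep hG hK hF hFl hGc hGu hFG
  rw [Set.disjoint_left] at hFG
  refine ⟨F ∪ {y | ∃ x ∈ K \ V, y ≤ x}, hF.union (kOm_isClosed_lower hG (hK.diff hV)), ?_,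
    Set.subset_union_left, ?_, U, hU, hFU, ?_⟩
  · refine hFl.union ?_
    rintro a b hba ⟨x, hx, hax⟩
    exact ⟨x, hx, hba.trans hax⟩
  · rw [Set.disjoint_left]
    rintro a (ha | ⟨x, hx, hax⟩) haG
    · exact hFG ha haG
    · exact hx.2 (hGV ⟨hGu hax haG, hx.1⟩)
  · rintro x ⟨hxU, hxK⟩
    exact Or.inr ⟨x, ⟨hxK, hUV x hxK hxU⟩, le_refl x⟩

theorem kOm_step {E : Type*} [TopologicalSpace E] [Preorder E]
    (hG : IsClosed {p : E × E | p.1 ≤ p.2}) {K F G : Set E} (hK : IsCompact K)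
    (hF : IsClosed F) (hFl : IsLowerSet F) (hGc : IsClosed G) (hGu : IsUpperSet G)
    (hFG : Disjoint F G) :
    ∃ F' G' : Set E, (IsClosed F' ∧ IsLowerSet F' ∧ IsClosed G' ∧ IsUpperSet G' ∧
      Disjoint F' G') ∧ F ⊆ F' ∧ G ⊆ G' ∧
      (∃ U, IsOpen U ∧ F ∩ K ⊆ U ∧ U ∩ K ⊆ F') ∧
      (∃ U, IsOpen U ∧ G ∩ K ⊆ U ∧ U ∩ K ⊆ G') := by
  obtain ⟨F', h1, h2, h3, h4, h5⟩ := kOm_half hG hK hF hFl hGc hGu hFG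
  have h : IsClosed {p : Eᵒᵈ × Eᵒᵈ | p.1 ≤ p.2} := hG.preimage continuous_swap
  obtain ⟨G', k1, k2, k3, k4, k5⟩ := kOm_half (E := Eᵒᵈ) h (K := K) (F := G) (G := F') hK hGc
    (fun a b hab ha => hGu hab ha) h1 (fun a b hab ha => h2 hab ha) h4.symm
  exact ⟨F', G', ⟨h1, h2, k1, fun a b hab ha => k2 hab ha, k4.symm⟩, h3, k3, h5, k5⟩

theorem kOm_open {E : Type*} [TopologicalSpace E] {K : ℕ → Set E} (hK : IsAdmissibleSeq K)
    (F : ℕ → Set E) (hF : Monotone F)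
    (h : ∀ n, ∃ U, IsOpen U ∧ F n ∩ Set.accumulate K n ⊆ U ∧
      U ∩ Set.accumulate K n ⊆ F (n + 1)) :
    IsOpen (⋃ n, F n) := by
  rw [hK.2.2]
  intro m
  rw [isOpen_iff_mem_nhds]
  rintro ⟨x, hxm⟩ hx
  obtain ⟨n, hn⟩ := Set.mem_iUnion.1 hx
  obtain ⟨U, hU, h1, h2⟩ := h (max m n)
  have hsub : K m ⊆ Set.accumulate K (max m n) := fun y hy =>
    Set.mem_accumulate.2 ⟨m, le_max_left _ _, hy⟩
  refine Filter.mem_of_superset ((hU.preimage continuous_subtype_val).mem_nhds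
    (h1 ⟨hF (le_max_right m n) hn, hsub hxm⟩)) ?_
  rintro ⟨y, hym⟩ hy
  exact Set.mem_iUnion.2 ⟨_, h2 ⟨hy, hsub hym⟩⟩

/-- Every `k_ω`-space equipped with a preorder whose graph is closed in `E × E` is a
normally preordered space. -/
theorem kOmegaSpace_closedPreorder_normallyPreordered
    (E : Type*) [TopologicalSpace E] [Preorder E]
    (hkω : IsKOmegaSpace E)
    (hG : IsClosed {p : E × E | p.1 ≤ p.2}) :
    NormallyPreordered E := by
  obtain ⟨K, hK⟩ := hkω
  refine ⟨fun x => ⟨hG.preimage (f := fun y => (x, y)) (by fun_prop),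
    hG.preimage (f := fun y => (y, x)) (by fun_prop)⟩, ?_⟩
  intro A B hA hAl hB hBu hAB
  have hKc : ∀ n, IsCompact (Set.accumulate K n) := fun n => isCompact_accumulate hK.1 n
  let P : Type _ := {p : Set E × Set E // IsClosed p.1 ∧ IsLowerSet p.1 ∧ IsClosed p.2 ∧
    IsUpperSet p.2 ∧ Disjoint p.1 p.2}
  have step : ∀ (n : ℕ) (p : P), ∃ q : P, p.1.1 ⊆ q.1.1 ∧ p.1.2 ⊆ q.1.2 ∧
      (∃ U, IsOpen U ∧ p.1.1 ∩ Set.accumulate K n ⊆ U ∧ U ∩ Set.accumulate K n ⊆ q.1.1) ∧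
      (∃ U, IsOpen U ∧ p.1.2 ∩ Set.accumulate K n ⊆ U ∧ U ∩ Set.accumulate K n ⊆ q.1.2) := by
    rintro n ⟨⟨F, G⟩, h1, h2, h3, h4, h5⟩
    obtain ⟨F', G', h, h'⟩ := kOm_step hG (hKc n) h1 h2 h3 h4 h5
    exact ⟨⟨(F', G'), h⟩, h'⟩
  choose f hf using step
  let s : ℕ → P := fun n => Nat.rec
    ⟨(A, B), hA, hAl, hB, hBu, Set.disjoint_iff_inter_eq_empty.2 hAB⟩ (fun n p => f n p) n
  have hs : ∀ n, s (n + 1) = f n (s n) := fun n => rfl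
  have m1 : Monotone (fun n => (s n).1.1) := monotone_nat_of_le_succ fun n => (hf n (s n)).1
  have m2 : Monotone (fun n => (s n).1.2) := monotone_nat_of_le_succ fun n => (hf n (s n)).2.1
  refine ⟨⋃ n, (s n).1.1, ⋃ n, (s n).1.2,
    kOm_open hK _ m1 fun n => (hf n (s n)).2.2.1, isLowerSet_iUnion fun n => (s n).2.2.1,
    kOm_open hK _ m2 fun n => (hf n (s n)).2.2.2, isUpperSet_iUnion fun n => (s n).2.2.2.2.1,
    Set.subset_iUnion (fun n => (s n).1.1) 0, Set.subset_iUnion (fun n => (s n).1.2) 0, ?_⟩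
  rw [Set.eq_empty_iff_forall_notMem]
  rintro x ⟨hx1, hx2⟩
  obtain ⟨i, hi⟩ := Set.mem_iUnion.1 hx1
  obtain ⟨j, hj⟩ := Set.mem_iUnion.1 hx2
  exact Set.disjoint_left.1 (s (max i j)).2.2.2.2.2 (m1 (le_max_left i j) hi)
    (m2 (le_max_right i j) hj)
end

section
/- Every locally compact σ-compact topological space equipped with a preorder whose graph is closed in E × E is a normally preordered space. -/
open Set Topology in
theorem isClosed_down_of_compact {E : Type*} [TopologicalSpace E] [Preorder E]
    [OrderClosedTopology E] {P : Set E} (hP : IsCompact P) :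
    IsClosed {x : E | ∃ p ∈ P, x ≤ p} := by
  rw [← isOpen_compl_iff, isOpen_iff_forall_mem_open]
  intro x hx
  have hG : IsClosed {p : E × E | p.1 ≤ p.2} := OrderClosedTopology.isClosed_le'
  obtain ⟨u, v, hu, hv, hxu, hPv, huv⟩ := generalized_tube_lemma (s := {x}) (t := P)
    isCompact_singleton hP (n := {p : E × E | p.1 ≤ p.2}ᶜ) hG.isOpen_compl (by
      rintro ⟨a, b⟩ ⟨ha, hb⟩ hab
      simp only [mem_singleton_iff] at ha
      subst ha
      exact hx ⟨b, hb, hab⟩)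
  refine ⟨u, ?_, hu, hxu rfl⟩
  rintro y hy ⟨p, hp, hyp⟩
  exact huv (show (y, p) ∈ u ×ˢ v from ⟨hy, hPv hp⟩) hyp

open Set Topology in
theorem one_step {E : Type*} [TopologicalSpace E] [Preorder E]
    [OrderClosedTopology E] {A B K : Set E} (hK : IsCompact K)
    (hA : IsClosed A) (hA' : IsLowerSet A) (hB : IsClosed B) (hB' : IsUpperSet B)
    (hAB : Disjoint A B) :
    ∃ A₁ : Set E, IsClosed A₁ ∧ IsLowerSet A₁ ∧ Disjoint A₁ B ∧ A ⊆ A₁ ∧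
      ∀ x ∈ A, x ∈ interior K → A₁ ∈ 𝓝 x := by
  have hG : IsClosed {p : E × E | p.2 ≤ p.1} :=
    isClosed_le continuous_snd continuous_fst
  rw [Set.disjoint_left] at hAB
  obtain ⟨u, v, hu, hv, hAu, hBv, huv⟩ := generalized_tube_lemma
    (hK.inter_left hA) (hK.inter_left hB)
    (n := {p : E × E | p.2 ≤ p.1}ᶜ) hG.isOpen_compl (by
      rintro ⟨a, b⟩ ⟨ha, hb⟩ hab
      exact hAB (hA' hab ha.1) hb.1)
  refine ⟨A ∪ {x | ∃ p ∈ K \ v, x ≤ p}, hA.union (isClosed_down_of_compact (hK.diff hv)),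
    hA'.union ?_, ?_, subset_union_left, ?_⟩
  · rintro a b hba ⟨p, hp, hap⟩
    exact ⟨p, hp, hba.trans hap⟩
  · rw [Set.disjoint_left]
    rintro x (hx | ⟨p, hp, hxp⟩) hxB
    · exact hAB hx hxB
    · exact hp.2 (hBv ⟨hB' hxp hxB, hp.1⟩)
  · intro x hxA hxK
    filter_upwards [hu.mem_nhds (hAu ⟨hxA, interior_subset hxK⟩), mem_interior_iff_mem_nhds.1 hxK]
      with y hyu hyK
    exact Or.inr ⟨y, ⟨hyK, fun hyv => huv (show (y, y) ∈ u ×ˢ v from ⟨hyu, hyv⟩) le_rfl⟩, le_rfl⟩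

open Set Topology in
theorem one_step_dual {E : Type*} [TopologicalSpace E] [Preorder E]
    [OrderClosedTopology E] {A B K : Set E} (hK : IsCompact K)
    (hA : IsClosed A) (hA' : IsLowerSet A) (hB : IsClosed B) (hB' : IsUpperSet B)
    (hAB : Disjoint A B) :
    ∃ B₁ : Set E, IsClosed B₁ ∧ IsUpperSet B₁ ∧ Disjoint A B₁ ∧ B ⊆ B₁ ∧
      ∀ x ∈ B, x ∈ interior K → B₁ ∈ 𝓝 x := by
  obtain ⟨C, h1, h2, h3, h4, h5⟩ := one_step (E := Eᵒᵈ) (A := OrderDual.ofDual ⁻¹' B)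
    (B := OrderDual.ofDual ⁻¹' A) (K := OrderDual.ofDual ⁻¹' K) hK hB hB'.toDual hA hA'.toDual
    hAB.symm
  exact ⟨OrderDual.toDual ⁻¹' C, h1, h2.ofDual, Disjoint.symm h3, h4, h5⟩

open Set Topology in
theorem two_step {E : Type*} [TopologicalSpace E] [Preorder E]
    [OrderClosedTopology E] {K : Set E} (hK : IsCompact K) (s : Set E × Set E)
    (hs : IsClosed s.1 ∧ IsLowerSet s.1 ∧ IsClosed s.2 ∧ IsUpperSet s.2 ∧ Disjoint s.1 s.2) :
    ∃ t : Set E × Set E,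
      (IsClosed t.1 ∧ IsLowerSet t.1 ∧ IsClosed t.2 ∧ IsUpperSet t.2 ∧ Disjoint t.1 t.2) ∧
      s.1 ⊆ t.1 ∧ s.2 ⊆ t.2 ∧ (∀ x ∈ s.1, x ∈ interior K → t.1 ∈ 𝓝 x) ∧
      (∀ x ∈ s.2, x ∈ interior K → t.2 ∈ 𝓝 x) := by
  obtain ⟨a, b, c, d, e⟩ := hs
  obtain ⟨A, h1, h2, h3, h4, h5⟩ := one_step hK a b c d e
  obtain ⟨B, k1, k2, k3, k4, k5⟩ := one_step_dual hK h1 h2 c d h3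
  exact ⟨(A, B), ⟨h1, h2, k1, k2, k3⟩, h4, k4, h5, k5⟩

open Set Topology in
theorem isOpen_iUnion_step {E : Type*} [TopologicalSpace E] (K : CompactExhaustion E)
    (f : ℕ → Set E) (hf : Monotone f)
    (h : ∀ n, ∀ x ∈ f n, x ∈ interior (K n) → f (n + 1) ∈ 𝓝 x) : IsOpen (⋃ n, f n) := by
  rw [isOpen_iff_mem_nhds]
  intro x hx
  obtain ⟨n, hn⟩ := mem_iUnion.1 hx
  obtain ⟨m, hm⟩ := K.exists_mem x
  have hm' := K.subset_interior_succ m hm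
  refine Filter.mem_of_superset (h (max n (m + 1)) x (hf (le_max_left _ _) hn)
    (interior_mono (K.subset (le_max_right _ _)) hm')) (subset_iUnion _ _)

/-- Every locally compact (every point has a compact neighborhood), σ-compact
topological space equipped with a preorder whose graph is closed in `E × E` is a
normally preordered space. -/
theorem locallyCompact_sigmaCompact_closedPreorder_normallyPreordered
    (E : Type*) [TopologicalSpace E] [Preorder E]
    [WeaklyLocallyCompactSpace E] [SigmaCompactSpace E]
    (hG : IsClosed {p : E × E | p.1 ≤ p.2}) :
    NormallyPreordered E := by
  haveI : OrderClosedTopology E := ⟨hG⟩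
  refine ⟨fun x => ⟨isClosed_Ici, isClosed_Iic⟩, ?_⟩
  intro A B hA hA' hB hB' hAB
  let K : CompactExhaustion E := default
  choose! g hg using fun n => two_step (K.isCompact n)
  let F : ℕ → Set E × Set E := fun n => Nat.rec (A, B) (fun n s => g n s) n
  have hF : ∀ n, IsClosed (F n).1 ∧ IsLowerSet (F n).1 ∧ IsClosed (F n).2 ∧
      IsUpperSet (F n).2 ∧ Disjoint (F n).1 (F n).2 := by
    intro n
    induction n with
    | zero => exact ⟨hA, hA', hB, hB', Set.disjoint_iff_inter_eq_empty.2 hAB⟩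
    | succ n ih => exact (hg n _ ih).1
  have m1 : Monotone fun n => (F n).1 := monotone_nat_of_le_succ fun n => (hg n _ (hF n)).2.1
  have m2 : Monotone fun n => (F n).2 := monotone_nat_of_le_succ fun n => (hg n _ (hF n)).2.2.1
  refine ⟨⋃ n, (F n).1, ⋃ n, (F n).2,
    isOpen_iUnion_step K _ m1 fun n => (hg n _ (hF n)).2.2.2.1,
    isLowerSet_iUnion fun n => (hF n).2.1,
    isOpen_iUnion_step K _ m2 fun n => (hg n _ (hF n)).2.2.2.2,
    isUpperSet_iUnion fun n => (hF n).2.2.2.1,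
    Set.subset_iUnion (fun n => (F n).1) 0, Set.subset_iUnion (fun n => (F n).2) 0, ?_⟩
  rw [← Set.disjoint_iff_inter_eq_empty, Set.disjoint_left]
  intro x hx hy
  obtain ⟨n, hn⟩ := Set.mem_iUnion.1 hx
  obtain ⟨k, hk⟩ := Set.mem_iUnion.1 hy
  exact Set.disjoint_left.1 (hF (max n k)).2.2.2.2 (m1 (le_max_left _ _) hn)
    (m2 (le_max_right _ _) hk)
end

section
/- Let E be a normally preordered space and let S ⊆ E be a subspace (with the subspace topology and induced preorder). A continuous isotone function f : S → [0,1] can be extended to a continuous isotone function F : E → [0,1] if and only if for all ξ, ξ' ∈ [0,1] with ξ < ξ' one has D(f⁻¹([0,ξ])) ∩ I(f⁻¹([ξ',1])) = ∅, where D and I denote the smallest closed decreasing, respectively smallest closed increasing, subset of E containing the given set. -/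
/-- `DHull T` is the smallest closed decreasing set containing `T`. -/
def DHull {E : Type*} [TopologicalSpace E] [Preorder E] (T : Set E) : Set E :=
  ⋂₀ {C : Set E | IsClosed C ∧ IsLowerSet C ∧ T ⊆ C}

/-- `IHull T` is the smallest closed increasing set containing `T`. -/
def IHull {E : Type*} [TopologicalSpace E] [Preorder E] (T : Set E) : Set E :=
  ⋂₀ {C : Set E | IsClosed C ∧ IsUpperSet C ∧ T ⊆ C}

theorem npo_urysohn {E : Type*} [TopologicalSpace E] [Preorder E]
    (hE : NormallyPreordered E) (A B : Set E) (hA : IsClosed A) (hAl : IsLowerSet A)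
    (hB : IsClosed B) (hBu : IsUpperSet B) (hAB : A ∩ B = ∅) :
    ∃ u : E → ℝ, Continuous u ∧ Monotone u ∧ (∀ x, u x ∈ Set.Icc (0 : ℝ) 1) ∧
      (∀ x ∈ A, u x = 0) ∧ (∀ x ∈ B, u x = 1) := by
  let P : Set E → Set E → Prop := fun c u =>
    IsLowerSet u ∧ ∃ K, IsClosed K ∧ IsLowerSet K ∧ c ⊆ K ∧ K ⊆ u
  have hsub : A ⊆ Bᶜ := by
    intro x hx hxB
    have : x ∈ A ∩ B := ⟨hx, hxB⟩
    rw [hAB] at this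
    exact this
  let c : Urysohns.CU P :=
    { C := A
      U := Bᶜ
      P_C_U := ⟨hBu.compl, A, hA, hAl, le_rfl, hsub⟩
      closed_C := hA
      open_U := hB.isOpen_compl
      subset := hsub
      hP := by
        rintro c u hc ⟨hul, K, hK, hKl, hcK, hKu⟩ hu hcu
        obtain ⟨U, V, hU, hUl, hV, hVu, hKU, huV, hUV⟩ := hE.2 K uᶜ hK hKl hu.isClosed_compl hul.compl
          (by
            ext x
            simp only [Set.mem_inter_iff, Set.mem_compl_iff, Set.mem_empty_iff_false, iff_false]
            exact fun h => h.2 (hKu h.1))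
        have hUV1 : U ⊆ Vᶜ := by
          intro x hx hxV
          have : x ∈ U ∩ V := ⟨hx, hxV⟩
          rw [hUV] at this
          exact this
        have h1 : closure U ⊆ Vᶜ := closure_minimal hUV1 hV.isClosed_compl
        have h2 : Vᶜ ⊆ u := by
          intro x hx
          by_contra hxu
          exact hx (huV hxu)
        exact ⟨U, hU, hcK.trans hKU, h1.trans h2, ⟨hUl, K, hK, hKl, hcK, hKU⟩,
          ⟨hul, Vᶜ, hV.isClosed_compl, hVu.compl, h1, h2⟩⟩ }
  have hmono : ∀ (n : ℕ) (c : Urysohns.CU P), Monotone (c.approx n) := by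
    intro n
    induction n with
    | zero =>
      intro c x y hxy
      simp only [Urysohns.CU.approx]
      by_cases hx : x ∈ c.U
      · rw [Set.indicator_of_notMem (by simpa using hx)]
        exact Set.indicator_nonneg (fun _ _ => zero_le_one) _
      · have hy : y ∉ c.U := fun hy => hx (c.P_C_U.1 hxy hy)
        rw [Set.indicator_of_mem (by simpa using hx), Set.indicator_of_mem (by simpa using hy)]
        simp
    | succ n ih =>
      intro c x y hxy
      simp only [Urysohns.CU.approx, midpoint_eq_smul_add, smul_eq_mul]
      have h1 := ih c.left hxy
      have h2 := ih c.right hxy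
      exact mul_le_mul_of_nonneg_left (add_le_add h1 h2) (by norm_num)
  refine ⟨c.lim, c.continuous_lim, ?_, c.lim_mem_Icc, fun x hx => c.lim_of_mem_C x hx,
    fun x hx => c.lim_of_notMem_U x (fun h => h hx)⟩
  intro x y hxy
  exact le_of_tendsto_of_tendsto' (c.tendsto_approx_atTop x) (c.tendsto_approx_atTop y)
    (fun n => hmono n c hxy)

theorem npo_isClosed_DHull {E : Type*} [TopologicalSpace E] [Preorder E] (T : Set E) :
    IsClosed (DHull T) := isClosed_sInter fun _ h => h.1

theorem npo_isClosed_IHull {E : Type*} [TopologicalSpace E] [Preorder E] (T : Set E) :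
    IsClosed (IHull T) := isClosed_sInter fun _ h => h.1

theorem npo_isLowerSet_DHull {E : Type*} [TopologicalSpace E] [Preorder E] (T : Set E) :
    IsLowerSet (DHull T) := isLowerSet_sInter fun _ h => h.2.1

theorem npo_isUpperSet_IHull {E : Type*} [TopologicalSpace E] [Preorder E] (T : Set E) :
    IsUpperSet (IHull T) := isUpperSet_sInter fun _ h => h.2.1

theorem npo_approx {E : Type*} [TopologicalSpace E] [Preorder E]
    (hE : NormallyPreordered E) (S : Set E) (f : S → ℝ)
    (hf01 : ∀ s, f s ∈ Set.Icc (0 : ℝ) 1)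
    (h : ∀ ξ ξ' : ℝ, ξ ∈ Set.Icc (0 : ℝ) 1 → ξ' ∈ Set.Icc (0 : ℝ) 1 → ξ < ξ' →
        DHull (Subtype.val '' (f ⁻¹' Set.Icc 0 ξ)) ∩
          IHull (Subtype.val '' (f ⁻¹' Set.Icc ξ' 1)) = ∅)
    (ε : ℝ) (hε : 0 < ε) :
    ∃ F : E → ℝ, Continuous F ∧ Monotone F ∧ ∀ s : S, |F s - f s| ≤ ε := by
  obtain ⟨N, hN⟩ := exists_nat_one_div_lt hε
  have hNpos : (0 : ℝ) < (N : ℝ) + 1 := by positivity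
  obtain ⟨δ, hδ⟩ : ∃ δ : ℝ, δ = 1 / ((N : ℝ) + 1) := ⟨_, rfl⟩
  have hδ0 : 0 < δ := by rw [hδ]; positivity
  have hNδ : ((N : ℝ) + 1) * δ = 1 := by rw [hδ]; field_simp
  have key : ∀ n : ℕ, n ≤ N + 1 → ∃ F : E → ℝ, Continuous F ∧ Monotone F ∧
      ∀ s : S, |F s - min (f s) (n * δ)| ≤ δ ∧ (n * δ ≤ f s → F s = n * δ) := by
    intro n
    induction n with
    | zero =>
      intro _
      refine ⟨fun _ => 0, continuous_const, monotone_const, fun s => ?_⟩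
      have := (hf01 s).1
      simp [this, hδ0.le]
    | succ n ih =>
      intro hn
      obtain ⟨F, hFc, hFm, hF⟩ := ih (by omega)
      have hn' : ((n : ℝ) + 1) ≤ (N : ℝ) + 1 := by exact_mod_cast hn
      have hle : ((n : ℝ) + 1) * δ ≤ 1 := by
        exact (mul_le_mul_of_nonneg_right hn' hδ0.le).trans hNδ.le
      have hn0 : 0 ≤ (n : ℝ) * δ := by positivity
      have hadd : ((n : ℝ) + 1) * δ = n * δ + δ := by ring
      obtain ⟨u, huc, hum, hu01, hu0, hu1⟩ := npo_urysohn hE _ _ (npo_isClosed_DHull _)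
        (npo_isLowerSet_DHull _) (npo_isClosed_IHull _) (npo_isUpperSet_IHull _)
        (h (n * δ) ((n + 1) * δ) ⟨hn0, by linarith⟩ ⟨by linarith, hle⟩ (by linarith))
      refine ⟨fun x => F x + δ * u x, by fun_prop, ?_, fun s => ?_⟩
      · intro x y hxy
        exact add_le_add (hFm hxy) (mul_le_mul_of_nonneg_left (hum hxy) hδ0.le)
      · obtain ⟨h1, h2⟩ := hF s
        have hs := hf01 s
        have hus := hu01 (s : E)
        push_cast
        rw [hadd]
        rcases le_or_gt (f s) (n * δ) with hc | hc
        · have h0 : u s = 0 := hu0 s (Set.mem_sInter.2 fun C hC =>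
            hC.2.2 ⟨s, ⟨hs.1, hc⟩, rfl⟩)
          simp only [h0, mul_zero, add_zero]
          rw [min_eq_left hc] at h1
          rw [min_eq_left (by linarith)]
          exact ⟨h1, fun h => by linarith⟩
        · have hFs := h2 hc.le
          rcases lt_or_ge (f s) (n * δ + δ) with hd | hd
          · rw [min_eq_left hd.le]
            refine ⟨?_, fun h => by linarith⟩
            have e1 : 0 ≤ δ * u s := mul_nonneg hδ0.le hus.1
            have e2 : δ * u s ≤ δ := by nlinarith [hus.2]
            simp only [hFs]
            rw [abs_le]
            constructor <;> linarith
          · have h1' : u s = 1 := hu1 s (Set.mem_sInter.2 fun C hC =>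
              hC.2.2 ⟨s, ⟨by rw [hadd]; exact hd, hs.2⟩, rfl⟩)
            rw [min_eq_right hd]
            simp only [h1', hFs, mul_one]
            simp [hδ0.le]
  obtain ⟨F, hFc, hFm, hF⟩ := key (N + 1) le_rfl
  refine ⟨F, hFc, hFm, fun s => ?_⟩
  have h1 := (hF s).1
  push_cast at h1
  rw [hNδ, min_eq_left (hf01 s).2] at h1
  rw [← hδ] at hN
  linarith

/-- Nachbin's extension theorem for normally preordered spaces: a continuous isotone
function `f : S → [0,1]` on a subspace `S` of a normally preordered space `E` extends
to a continuous isotone `F : E → [0,1]` iff for all `ξ < ξ'` in `[0,1]` one has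
`D(f⁻¹([0,ξ])) ∩ I(f⁻¹([ξ',1])) = ∅` in `E`. -/
theorem extension_iff_hull_condition
    {E : Type*} [TopologicalSpace E] [Preorder E]
    (hE : NormallyPreordered E)
    (S : Set E) (f : S → ℝ)
    (hf01 : ∀ s, f s ∈ Set.Icc (0 : ℝ) 1)
    (hfc : Continuous f) (hfm : Monotone f) :
    (∃ F : E → ℝ, Continuous F ∧ Monotone F ∧ (∀ x, F x ∈ Set.Icc (0 : ℝ) 1) ∧
        ∀ s : S, F s = f s) ↔
      (∀ ξ ξ' : ℝ, ξ ∈ Set.Icc (0 : ℝ) 1 → ξ' ∈ Set.Icc (0 : ℝ) 1 → ξ < ξ' →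
        DHull (Subtype.val '' (f ⁻¹' Set.Icc 0 ξ)) ∩
          IHull (Subtype.val '' (f ⁻¹' Set.Icc ξ' 1)) = ∅) := by
  constructor
  · rintro ⟨F, hFc, hFm, -, hFf⟩ ξ ξ' - - hlt
    rw [Set.eq_empty_iff_forall_notMem]
    rintro x ⟨hxD, hxI⟩
    have h1 : x ∈ F ⁻¹' Set.Iic ξ := Set.mem_sInter.1 hxD _
      ⟨isClosed_Iic.preimage hFc, fun a b hab ha => (hFm hab).trans ha, by
        rintro _ ⟨s, hs, rfl⟩
        simpa [hFf] using hs.2⟩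
    have h2 : x ∈ F ⁻¹' Set.Ici ξ' := Set.mem_sInter.1 hxI _
      ⟨isClosed_Ici.preimage hFc, fun a b hab ha => le_trans ha (hFm hab), by
        rintro _ ⟨s, hs, rfl⟩
        simpa [hFf] using hs.1⟩
    exact absurd (le_trans (show ξ' ≤ F x from h2) h1) (not_le.2 hlt)
  · intro h
    choose H hHc hHm hH using fun n : ℕ =>
      npo_approx hE S f hf01 h ((1 / 2 : ℝ) ^ n) (by positivity)
    let G : ℕ → E → ℝ := fun n => Nat.rec (H 0)
      (fun n g x => max (g x - (1 / 2 : ℝ) ^ n) (min (H (n + 1) x) (g x + (1 / 2 : ℝ) ^ n))) n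
    have hGs : ∀ n x, G (n + 1) x =
      max (G n x - (1 / 2 : ℝ) ^ n) (min (H (n + 1) x) (G n x + (1 / 2 : ℝ) ^ n)) :=
      fun _ _ => rfl
    have hGc : ∀ n, Continuous (G n) := by
      intro n
      induction n with
      | zero => exact hHc 0
      | succ n ih =>
        have := hHc (n + 1)
        rw [funext (hGs n)]
        fun_prop
    have hGm : ∀ n, Monotone (G n) := by
      intro n
      induction n with
      | zero => exact hHm 0
      | succ n ih =>
        intro x y hxy
        rw [hGs, hGs]
        have h1 := hHm (n + 1) hxy
        have h2 := ih hxy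
        gcongr
    have hGf : ∀ n (s : S), |G n s - f s| ≤ (1 / 2 : ℝ) ^ n := by
      intro n
      induction n with
      | zero => exact hH 0
      | succ n ih =>
        intro s
        have h1 := abs_le.1 (hH (n + 1) s)
        have h2 := abs_le.1 (ih s)
        have h3 : (0 : ℝ) < (1 / 2 : ℝ) ^ (n + 1) := by positivity
        rw [hGs, abs_le]
        constructor
        · have : f s - (1 / 2 : ℝ) ^ (n + 1) ≤
              min (H (n + 1) s) (G n s + (1 / 2 : ℝ) ^ n) := le_min (by linarith) (by linarith)
          linarith [le_max_right (G n s - (1 / 2 : ℝ) ^ n)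
            (min (H (n + 1) s) (G n s + (1 / 2 : ℝ) ^ n))]
        · have : max (G n s - (1 / 2 : ℝ) ^ n) (min (H (n + 1) s) (G n s + (1 / 2 : ℝ) ^ n)) ≤
              f s + (1 / 2 : ℝ) ^ (n + 1) :=
            max_le (by linarith) ((min_le_left _ _).trans (by linarith))
          linarith
    have hGd : ∀ x n, dist (G n x) (G (n + 1) x) ≤ 1 * (1 / 2 : ℝ) ^ n := by
      intro x n
      have h3 : (0 : ℝ) < (1 / 2 : ℝ) ^ n := by positivity
      rw [dist_comm, Real.dist_eq, hGs, one_mul, abs_le]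
      constructor
      · linarith [le_max_left (G n x - (1 / 2 : ℝ) ^ n)
            (min (H (n + 1) x) (G n x + (1 / 2 : ℝ) ^ n))]
      · have : max (G n x - (1 / 2 : ℝ) ^ n) (min (H (n + 1) x) (G n x + (1 / 2 : ℝ) ^ n)) ≤
              G n x + (1 / 2 : ℝ) ^ n := max_le (by linarith) (min_le_right _ _)
        linarith
    have hlim : ∀ x, ∃ l, Filter.Tendsto (fun n => G n x) Filter.atTop (nhds l) := fun x =>
      cauchySeq_tendsto_of_complete
        (cauchySeq_of_le_geometric (1 / 2 : ℝ) 1 (by norm_num) (hGd x))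
    choose L hL using hlim
    have hpow : Filter.Tendsto (fun n : ℕ => (1 / 2 : ℝ) ^ n) Filter.atTop (nhds 0) :=
      tendsto_pow_atTop_nhds_zero_of_lt_one (by norm_num) (by norm_num)
    have hLc : Continuous L := by
      have hu : TendstoUniformly G L Filter.atTop := by
        rw [Metric.tendstoUniformly_iff]
        intro ε hε
        filter_upwards [hpow.eventually (gt_mem_nhds (show (0 : ℝ) < ε / 2 by positivity))] with n hn x
        have := dist_le_of_le_geometric_of_tendsto (1 / 2 : ℝ) 1 (by norm_num) (hGd x) (hL x) n
        rw [dist_comm]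
        have e : 1 * (1 / 2 : ℝ) ^ n / (1 - 1 / 2) = 2 * (1 / 2 : ℝ) ^ n := by ring
        rw [e] at this
        linarith
      exact hu.continuous (Filter.Frequently.of_forall hGc)
    have hLm : Monotone L := fun x y hxy =>
      le_of_tendsto_of_tendsto' (hL x) (hL y) (fun n => hGm n hxy)
    have hLf : ∀ s : S, L s = f s := by
      intro s
      refine tendsto_nhds_unique (hL s) ?_
      rw [tendsto_iff_dist_tendsto_zero]
      exact squeeze_zero (fun _ => dist_nonneg) (fun n => hGf n s) hpow
    refine ⟨fun x => max 0 (min (L x) 1), by fun_prop, ?_, ?_, ?_⟩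
    · intro x y hxy
      have := hLm hxy
      dsimp only
      gcongr
    · intro x
      exact ⟨le_max_left _ _, max_le zero_le_one (min_le_right _ _)⟩
    · intro s
      have := hf01 s
      simp only [hLf]
      rw [min_eq_left this.2, max_eq_right this.1]
end

section
/- Let E be a normally preordered space and let S ⊆ E be a subspace with the property that for all X, Y ⊆ S, if D_S(X) ∩ I_S(Y) = ∅ then D(X) ∩ I(Y) = ∅ (where D_S, I_S are the closed decreasing/increasing hull operators of the subspace S and D, I those of E). Then every continuous isotone function f : S → [0,1] can be extended to a continuous isotone function F : E → [0,1]. -/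
theorem isotone_urysohn {E : Type*} [TopologicalSpace E] [Preorder E]
    (hE : NormallyPreordered E) (A B : Set E) (hA : IsClosed A) (hA' : IsLowerSet A)
    (hB : IsClosed B) (hB' : IsUpperSet B) (hAB : A ∩ B = ∅) :
    ∃ u : E → ℝ, Continuous u ∧ Monotone u ∧ (∀ x, u x ∈ Set.Icc (0 : ℝ) 1) ∧
      (∀ x ∈ A, u x = 0) ∧ (∀ x ∈ B, u x = 1) := by
  let P : Set E → Set E → Prop := fun C U =>
    IsLowerSet U ∧ ∃ F, IsClosed F ∧ IsLowerSet F ∧ C ⊆ F ∧ F ⊆ U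
  let c : Urysohns.CU P :=
  { C := A
    U := Bᶜ
    P_C_U := ⟨hB'.compl, A, hA, hA', subset_rfl, fun x hx hxB => by
      have : x ∈ A ∩ B := ⟨hx, hxB⟩
      simp [hAB] at this⟩
    closed_C := hA
    open_U := hB.isOpen_compl
    subset := fun x hx hxB => by
      have : x ∈ A ∩ B := ⟨hx, hxB⟩
      simp [hAB] at this
    hP := by
      rintro C U hC ⟨hU', F, hF, hF', hCF, hFU⟩ hU hCU
      obtain ⟨V, W, hV, hV', hW, hW', hFV, hUW, hVW⟩ :=
        hE.2 F Uᶜ hF hF' hU.isClosed_compl hU'.compl (by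
          ext x
          simp only [Set.mem_inter_iff, Set.mem_compl_iff, Set.mem_empty_iff_false, iff_false]
          exact fun h => h.2 (hFU h.1))
      have hVWc : V ⊆ Wᶜ := fun x hx hxW => by
        have : x ∈ V ∩ W := ⟨hx, hxW⟩
        simp [hVW] at this
      have hcl : closure V ⊆ Wᶜ := closure_minimal hVWc hW.isClosed_compl
      have hWU : Wᶜ ⊆ U := Set.compl_subset_comm.1 hUW
      exact ⟨V, hV, hCF.trans hFV, hcl.trans hWU, ⟨hV', F, hF, hF', hCF, hFV⟩,
        ⟨hU', Wᶜ, hW.isClosed_compl, hW'.compl, hcl, hWU⟩⟩ }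
  have key : ∀ (n : ℕ) (c : Urysohns.CU P), Monotone (c.approx n) := by
    intro n
    induction n with
    | zero =>
      intro c x y hxy
      by_cases hy : y ∈ c.U
      · have hx : x ∈ c.U := c.P_C_U.1 hxy hy
        simp [Urysohns.CU.approx, hx, hy]
      · rw [c.approx_of_notMem_U 0 hy]
        exact c.approx_le_one 0 x
    | succ n ih =>
      intro c x y hxy
      simp only [Urysohns.CU.approx]
      exact midpoint_le_midpoint (ih _ hxy) (ih _ hxy)
  refine ⟨c.lim, c.continuous_lim, ?_, c.lim_mem_Icc, fun x hx => c.lim_of_mem_C x hx,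
    fun x hx => c.lim_of_notMem_U x (fun h => h hx)⟩
  intro x y hxy
  exact le_of_tendsto_of_tendsto' (c.tendsto_approx_atTop x) (c.tendsto_approx_atTop y)
    (fun n => key n c hxy)

theorem isotone_level_sep {E : Type*} [TopologicalSpace E] [Preorder E]
    (hE : NormallyPreordered E) (S : Set E)
    (hS : ∀ X Y : Set S, DHull X ∩ IHull Y = ∅ →
      DHull (Subtype.val '' X) ∩ IHull (Subtype.val '' Y) = ∅)
    (f : S → ℝ) (hfc : Continuous f) (hfm : Monotone f) (a b : ℝ) (hab : a < b) :
    ∃ u : E → ℝ, Continuous u ∧ Monotone u ∧ (∀ x, u x ∈ Set.Icc (0 : ℝ) 1) ∧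
      (∀ s : S, f s ≤ a → u s = 0) ∧ (∀ s : S, b ≤ f s → u s = 1) := by
  have h := hS {s | f s ≤ a} {s | b ≤ f s} (by
    rw [Set.eq_empty_iff_forall_notMem]
    rintro s ⟨h1, h2⟩
    have h1' : f s ≤ a := h1 {s | f s ≤ a}
      ⟨isClosed_le hfc continuous_const, fun x y hxy hx => (hfm hxy).trans hx, subset_rfl⟩
    have h2' : b ≤ f s := h2 {s | b ≤ f s}
      ⟨isClosed_le continuous_const hfc, fun x y hxy hx => le_trans hx (hfm hxy), subset_rfl⟩
    linarith)
  obtain ⟨u, h1, h2, h3, h4, h5⟩ := isotone_urysohn hE _ _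
    (isClosed_sInter fun C hC => hC.1) (isLowerSet_sInter fun C hC => hC.2.1)
    (isClosed_sInter fun C hC => hC.1) (isUpperSet_sInter fun C hC => hC.2.1) h
  exact ⟨u, h1, h2, h3, fun s hs => h4 s (fun C hC => hC.2.2 ⟨s, hs, rfl⟩),
    fun s hs => h5 s (fun C hC => hC.2.2 ⟨s, hs, rfl⟩)⟩

theorem isotone_approx {E : Type*} [TopologicalSpace E] [Preorder E]
    (hE : NormallyPreordered E) (S : Set E)
    (hS : ∀ X Y : Set S, DHull X ∩ IHull Y = ∅ →
      DHull (Subtype.val '' X) ∩ IHull (Subtype.val '' Y) = ∅)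
    (f : S → ℝ) (hf01 : ∀ s, f s ∈ Set.Icc (0 : ℝ) 1)
    (hfc : Continuous f) (hfm : Monotone f) (N : ℕ) (hN : 0 < N) :
    ∃ g : E → ℝ, Continuous g ∧ Monotone g ∧ ∀ s : S, |g s - f s| ≤ 1 / (N : ℝ) := by
  have hN' : (0 : ℝ) < N := by exact_mod_cast hN
  have hu := fun k : ℕ => isotone_level_sep hE S hS f hfc hfm ((k : ℝ) / N) (((k : ℝ) + 1) / N)
    (by gcongr; linarith)
  choose u h1 h2 h3 h4 h5 using hu
  have key : ∀ (s : S) (n : ℕ),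
      ((n : ℝ) ≤ N * f s → ∑ k ∈ Finset.range n, u k s = n) ∧
      (N * f s < n → |∑ k ∈ Finset.range n, u k s - N * f s| ≤ 1) := by
    intro s n
    have h0 : 0 ≤ N * f s := mul_nonneg hN'.le (hf01 s).1
    induction n with
    | zero =>
      refine ⟨fun _ => by simp, fun h => ?_⟩
      push_cast at h
      linarith
    | succ n ih =>
      rw [Finset.sum_range_succ]
      push_cast
      refine ⟨fun h => ?_, fun h => ?_⟩
      · rw [ih.1 (by linarith), h5 n s (by rw [div_le_iff₀ hN']; linarith)]
      · by_cases hn : (n : ℝ) ≤ N * f s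
        · rw [ih.1 hn, abs_le]
          have := h3 n s
          constructor <;> linarith [this.1, this.2]
        · rw [h4 n s (by rw [le_div_iff₀ hN']; linarith), add_zero]
          exact ih.2 (by linarith)
  refine ⟨fun x => (∑ k ∈ Finset.range N, u k x) / N, ?_, ?_, ?_⟩
  · exact (continuous_finsetSum _ fun k _ => h1 k).div_const _
  · intro x y hxy
    have : ∑ k ∈ Finset.range N, u k x ≤ ∑ k ∈ Finset.range N, u k y :=
      Finset.sum_le_sum fun k _ => h2 k hxy
    show _ / _ ≤ _ / _
    gcongr
  · intro s
    have : |∑ k ∈ Finset.range N, u k s - N * f s| ≤ 1 := by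
      by_cases h : (N : ℝ) ≤ N * f s
      · rw [(key s N).1 h]
        have : N * f s ≤ N := by nlinarith [(hf01 s).2]
        rw [abs_le]; constructor <;> linarith
      · exact (key s N).2 (by linarith)
    have e : (∑ k ∈ Finset.range N, u k s) / N - f s =
        (∑ k ∈ Finset.range N, u k s - N * f s) / N := by field_simp
    show |(∑ k ∈ Finset.range N, u k s) / N - f s| ≤ _
    rw [e, abs_div, abs_of_pos hN']
    gcongr

/-- If `S` is a subspace of a normally preordered space `E` such that disjointness of
the closed decreasing/increasing hulls computed in `S` implies disjointness of the
hulls computed in `E`, then every continuous isotone `f : S → [0,1]` extends to a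
continuous isotone `F : E → [0,1]`. -/
theorem extension_of_hull_compatible_subspace
    {E : Type*} [TopologicalSpace E] [Preorder E]
    (hE : NormallyPreordered E)
    (S : Set E)
    (hS : ∀ X Y : Set S, DHull X ∩ IHull Y = ∅ →
      DHull (Subtype.val '' X) ∩ IHull (Subtype.val '' Y) = ∅)
    (f : S → ℝ)
    (hf01 : ∀ s, f s ∈ Set.Icc (0 : ℝ) 1)
    (hfc : Continuous f) (hfm : Monotone f) :
    ∃ F : E → ℝ, Continuous F ∧ Monotone F ∧ (∀ x, F x ∈ Set.Icc (0 : ℝ) 1) ∧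
      ∀ s : S, F s = f s := by
  have ha := fun n : ℕ => isotone_approx hE S hS f hf01 hfc hfm (2 ^ n) (by positivity)
  choose a a1 a2 a3 using ha
  have hε : ∀ n : ℕ, 1 / ((2 ^ n : ℕ) : ℝ) = (1 / 2) ^ n := by intro n; simp
  simp only [hε] at a3
  let g : ℕ → E → ℝ := fun n => Nat.rec (a 0)
    (fun n h x => max (h x - (1 / 2) ^ n) (min (h x + (1 / 2) ^ n) (a (n + 1) x))) n
  have gs : ∀ n x, g (n + 1) x =
      max (g n x - (1 / 2) ^ n) (min (g n x + (1 / 2) ^ n) (a (n + 1) x)) := fun n x => rfl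
  have gc : ∀ n, Continuous (g n) := by
    intro n
    induction n with
    | zero => exact a1 0
    | succ n ih =>
      exact (ih.sub continuous_const).max ((ih.add continuous_const).min (a1 (n + 1)))
  have gm : ∀ n, Monotone (g n) := by
    intro n
    induction n with
    | zero => exact a2 0
    | succ n ih =>
      intro x y hxy
      rw [gs, gs]
      exact max_le_max (sub_le_sub_right (ih hxy) _)
        (min_le_min (add_le_add_left (ih hxy) _) (a2 _ hxy))
  have gf : ∀ n (s : S), |g n s - f s| ≤ (1 / 2) ^ n := by
    intro n s
    induction n with
    | zero => exact a3 0 s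
    | succ n ih =>
      rw [gs]
      have h := a3 (n + 1) s
      have hp : (0 : ℝ) < (1 / 2) ^ (n + 1) := by positivity
      rw [abs_le] at *
      obtain ⟨i1, i2⟩ := ih
      obtain ⟨j1, j2⟩ := h
      constructor
      · have : f s - (1 / 2) ^ (n + 1) ≤ max (g n s - (1 / 2) ^ n)
          (min (g n s + (1 / 2) ^ n) (a (n + 1) s)) :=
          le_max_of_le_right (le_min (by linarith) (by linarith))
        linarith
      · have : max (g n s - (1 / 2) ^ n)
          (min (g n s + (1 / 2) ^ n) (a (n + 1) s)) ≤ f s + (1 / 2) ^ (n + 1) :=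
          max_le (by linarith) (min_le_of_right_le (by linarith))
        linarith
  have gd : ∀ x n, dist (g n x) (g (n + 1) x) ≤ 1 * (1 / 2) ^ n := by
    intro x n
    have hp : (0 : ℝ) < (1 / 2) ^ n := by positivity
    rw [gs, dist_comm, Real.dist_eq, abs_le, one_mul]
    constructor
    · linarith [le_max_left (g n x - (1 / 2) ^ n) (min (g n x + (1 / 2) ^ n) (a (n + 1) x))]
    · have : max (g n x - (1 / 2) ^ n) (min (g n x + (1 / 2) ^ n) (a (n + 1) x)) ≤
        g n x + (1 / 2) ^ n := max_le (by linarith) (min_le_left _ _)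
      linarith
  have hlim : ∀ x, ∃ l, Filter.Tendsto (fun n => g n x) Filter.atTop (nhds l) := fun x =>
    cauchySeq_tendsto_of_complete
      (cauchySeq_of_le_geometric (1 / 2) 1 (by norm_num) (gd x))
  choose G hG using hlim
  have hgeo : Filter.Tendsto (fun n : ℕ => (1 / 2 : ℝ) ^ n) Filter.atTop (nhds 0) :=
    tendsto_pow_atTop_nhds_zero_of_lt_one (by norm_num) (by norm_num)
  have hunif : TendstoUniformly g G Filter.atTop := by
    rw [Metric.tendstoUniformly_iff]
    intro ε hεpos
    have h2 : Filter.Tendsto (fun n : ℕ => 1 * (1 / 2 : ℝ) ^ n / (1 - 1 / 2))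
        Filter.atTop (nhds 0) := by
      simpa using (hgeo.const_mul 1).div_const (1 - 1 / 2)
    filter_upwards [h2.eventually (gt_mem_nhds hεpos)] with n hn x
    rw [dist_comm]
    exact (dist_le_of_le_geometric_of_tendsto (1 / 2) 1 (by norm_num) (gd x) (hG x) n).trans_lt hn
  have Gc : Continuous G := hunif.continuous (Filter.Frequently.of_forall gc)
  have Gm : Monotone G := fun x y hxy =>
    le_of_tendsto_of_tendsto' (hG x) (hG y) fun n => gm n hxy
  have Gf : ∀ s : S, G s = f s := by
    intro s
    refine tendsto_nhds_unique (hG s) ?_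
    rw [tendsto_iff_dist_tendsto_zero]
    exact squeeze_zero (fun _ => dist_nonneg) (fun n => gf n s) hgeo
  refine ⟨fun x => max 0 (min 1 (G x)), continuous_const.max (continuous_const.min Gc), ?_, ?_, ?_⟩
  · intro x y hxy
    exact max_le_max le_rfl (min_le_min le_rfl (Gm hxy))
  · intro x
    exact ⟨le_max_left _ _, max_le zero_le_one (min_le_left _ _)⟩
  · intro s
    show max 0 (min 1 (G s)) = f s
    rw [Gf, min_eq_right (hf01 s).2, max_eq_right (hf01 s).1]
end

section
/- Let E be a normally preordered space and let S ⊆ E be a compact subspace (not necessarily closed). Then every continuous isotone function f : S → [0,1] can be extended to a continuous isotone function F : E → [0,1]. -/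
open Set Filter Topology in
theorem npUrysohn {E : Type*} [TopologicalSpace E] [Preorder E] (hE : NormallyPreordered E)
    {A B : Set E} (hA : IsClosed A) (hA' : IsLowerSet A) (hB : IsClosed B) (hB' : IsUpperSet B)
    (hAB : A ∩ B = ∅) :
    ∃ g : E → ℝ, Continuous g ∧ Monotone g ∧ (∀ x, g x ∈ Icc (0 : ℝ) 1) ∧
      (∀ x ∈ A, g x = 0) ∧ ∀ x ∈ B, g x = 1 := by
  let P : Set E → Set E → Prop := fun c u =>
    IsLowerSet u ∧ ∃ L, IsClosed L ∧ IsLowerSet L ∧ c ⊆ L ∧ L ⊆ u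
  let c : Urysohns.CU P :=
  { C := A
    U := Bᶜ
    P_C_U := ⟨hB'.compl, A, hA, hA', subset_rfl,
      fun x hx hx' => (hAB ▸ (⟨hx, hx'⟩ : x ∈ A ∩ B) : x ∈ (∅ : Set E))⟩
    closed_C := hA
    open_U := hB.isOpen_compl
    subset := fun x hx hx' => (hAB ▸ (⟨hx, hx'⟩ : x ∈ A ∩ B) : x ∈ (∅ : Set E))
    hP := by
      rintro c u hc ⟨hul, L, hL, hLl, hcL, hLu⟩ hu hcu
      obtain ⟨U, V, hU, hUl, hV, hVu, hLU, huV, hUV⟩ := hE.2 L uᶜ hL hLl hu.isClosed_compl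
        hul.compl (by
          ext x
          simp only [mem_inter_iff, mem_compl_iff, mem_empty_iff_false, iff_false, not_and, not_not]
          exact fun h => hLu h)
      have hVu' : Vᶜ ⊆ u := by
        intro x hx
        by_contra h
        exact hx (huV h)
      have hcl : closure U ⊆ Vᶜ := by
        refine closure_minimal ?_ hV.isClosed_compl
        intro x hx hx'
        exact (hUV ▸ (⟨hx, hx'⟩ : x ∈ U ∩ V) : x ∈ (∅ : Set E))
      exact ⟨U, hU, hcL.trans hLU, hcl.trans hVu', ⟨hUl, L, hL, hLl, hcL, hLU⟩,
        ⟨hul, Vᶜ, hV.isClosed_compl, hVu.compl, hcl, hVu'⟩⟩ }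
  have hmono : ∀ (n : ℕ) (c : Urysohns.CU P), Monotone (c.approx n) := by
    intro n
    induction n with
    | zero =>
      intro c x y hxy
      by_cases hy : y ∈ c.U
      · have hx : x ∈ c.U := c.P_C_U.1 hxy hy
        simp [Urysohns.CU.approx, hx, hy]
      · rw [c.approx_of_notMem_U 0 hy]
        exact c.approx_le_one 0 x
    | succ n ih =>
      intro c x y hxy
      simp only [Urysohns.CU.approx]
      exact midpoint_le_midpoint (ih _ hxy) (ih _ hxy)
  refine ⟨c.lim, c.continuous_lim, ?_, c.lim_mem_Icc, fun x hx => c.lim_of_mem_C x hx,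
    fun x hx => c.lim_of_notMem_U x (fun h => h hx)⟩
  intro x y hxy
  exact le_of_tendsto_of_tendsto' (c.tendsto_approx_atTop x) (c.tendsto_approx_atTop y)
    (fun n => hmono n c hxy)

open Set Filter Topology in
theorem npClosedLE {E : Type*} [TopologicalSpace E] [Preorder E] (hE : NormallyPreordered E) :
    IsClosed {p : E × E | p.1 ≤ p.2} := by
  rw [← isOpen_compl_iff, isOpen_iff_mem_nhds]
  rintro ⟨x, y⟩ hxy
  simp only [mem_compl_iff, mem_ofPred_eq] at hxy
  obtain ⟨U, V, hU, hUl, hV, hVu, hLU, huV, hUV⟩ := hE.2 (Iic y) (Ici x) (hE.1 y).2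
    (isLowerSet_Iic y) (hE.1 x).1 (isUpperSet_Ici x) (by
      ext z
      simp only [mem_inter_iff, mem_Iic, mem_Ici, mem_empty_iff_false, iff_false, not_and]
      exact fun h1 h2 => hxy (h2.trans h1))
  filter_upwards [prod_mem_nhds (hV.mem_nhds (huV (mem_Ici.2 le_rfl)))
    (hU.mem_nhds (hLU (mem_Iic.2 le_rfl)))]
  rintro ⟨a, b⟩ ⟨ha, hb⟩ hab
  exact (hUV ▸ (⟨hUl hab hb, ha⟩ : a ∈ U ∩ V) : a ∈ (∅ : Set E))

open Set Filter Topology in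
theorem npSep {E : Type*} [TopologicalSpace E] [Preorder E] (hE : NormallyPreordered E)
    (S : Set E) (hS : IsCompact S) (f : S → ℝ) (hfc : Continuous f) (hfm : Monotone f)
    {a b : ℝ} (hab : a < b) :
    ∃ g : E → ℝ, Continuous g ∧ Monotone g ∧ (∀ x, g x ∈ Icc (0 : ℝ) 1) ∧
      (∀ s : S, f s ≤ a → g s = 0) ∧ ∀ s : S, b ≤ f s → g s = 1 := by
  have hc := npClosedLE hE
  haveI : CompactSpace S := isCompact_iff_compactSpace.1 hS
  have h1 : IsClosed {x : E | ∃ s : S, f s ≤ a ∧ x ≤ s} := by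
    have : IsClosed {p : S × E | f p.1 ≤ a ∧ p.2 ≤ p.1} :=
      (isClosed_le (hfc.comp continuous_fst) continuous_const).inter
        (hc.preimage (continuous_snd.prodMk (continuous_subtype_val.comp continuous_fst)))
    convert isClosedMap_snd_of_compactSpace _ this
    ext x
    simp
  have h2 : IsClosed {x : E | ∃ s : S, b ≤ f s ∧ (s : E) ≤ x} := by
    have : IsClosed {p : S × E | b ≤ f p.1 ∧ (p.1 : E) ≤ p.2} :=
      (isClosed_le continuous_const (hfc.comp continuous_fst)).inter
        (hc.preimage ((continuous_subtype_val.comp continuous_fst).prodMk continuous_snd))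
    convert isClosedMap_snd_of_compactSpace _ this
    ext x
    simp
  obtain ⟨g, hg, hgm, hg01, hg0, hg1⟩ := npUrysohn hE h1
    (fun x y hyx ⟨s, hs, hx⟩ => ⟨s, hs, hyx.trans hx⟩) h2
    (fun x y hyx ⟨s, hs, hx⟩ => ⟨s, hs, hx.trans hyx⟩) (by
      ext x
      simp only [mem_inter_iff, mem_empty_iff_false, iff_false]
      rintro ⟨⟨s, hs, hxs⟩, ⟨t, ht, htx⟩⟩
      have : f t ≤ f s := hfm (show t ≤ s from htx.trans hxs)
      linarith)
  exact ⟨g, hg, hgm, hg01, fun s hs => hg0 _ ⟨s, hs, le_rfl⟩, fun s hs => hg1 _ ⟨s, hs, le_rfl⟩⟩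

open Set Filter Topology in
theorem npApprox {E : Type*} [TopologicalSpace E] [Preorder E] (hE : NormallyPreordered E)
    (S : Set E) (hS : IsCompact S) (f : S → ℝ) (hf01 : ∀ s, f s ∈ Set.Icc (0 : ℝ) 1)
    (hfc : Continuous f) (hfm : Monotone f) {e : ℝ} (he : 0 < e) :
    ∃ G : E → ℝ, Continuous G ∧ Monotone G ∧ ∀ s : S, |G s - f s| ≤ e := by
  have key : ∀ m : ℕ, ∃ G : E → ℝ, Continuous G ∧ Monotone G ∧
      ∀ s : S, (m * e ≤ f s → G s = m * e) ∧ (f s ≤ m * e → |G s - f s| ≤ e) := by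
    intro m
    induction m with
    | zero =>
      refine ⟨fun _ => 0, continuous_const, monotone_const, fun s => ⟨fun _ => by simp, ?_⟩⟩
      intro h
      have h0 := (hf01 s).1
      simp only [Nat.cast_zero, zero_mul] at h
      rw [le_antisymm h h0]
      simpa using he.le
    | succ m ih =>
      obtain ⟨G, hG, hGm, hGs⟩ := ih
      obtain ⟨g, hg, hgm, hg01, hg0, hg1⟩ := npSep hE S hS f hfc hfm
        (show (m : ℝ) * e < (m + 1 : ℝ) * e by nlinarith)
      refine ⟨fun x => G x + e * g x, by fun_prop, ?_, ?_⟩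
      · intro x y hxy
        exact add_le_add (hGm hxy) (mul_le_mul_of_nonneg_left (hgm hxy) he.le)
      · intro s
        obtain ⟨ha, hb⟩ := hGs s
        push_cast
        refine ⟨fun h => ?_, fun h => ?_⟩
        · rw [ha (by nlinarith), hg1 s h]
          ring
        · rcases le_total (f s) (m * e) with h' | h'
          · rw [hg0 s h']
            simpa using hb h'
          · rw [ha h', abs_le]
            obtain ⟨h0, h1⟩ := hg01 s
            constructor <;> nlinarith
  obtain ⟨m, hm⟩ := exists_nat_ge (1 / e)
  rw [div_le_iff₀ he] at hm
  obtain ⟨G, hG, hGm, hGs⟩ := key m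
  exact ⟨G, hG, hGm, fun s => (hGs s).2 ((hf01 s).2.trans hm)⟩

/-- Let `E` be a normally preordered space and `S ⊆ E` a compact subspace (not
necessarily closed).  Every continuous isotone `f : S → [0,1]` extends to a continuous
isotone `F : E → [0,1]`. -/
theorem extension_from_compact_subspace
    {E : Type*} [TopologicalSpace E] [Preorder E]
    (hE : NormallyPreordered E)
    (S : Set E) (hS : IsCompact S)
    (f : S → ℝ)
    (hf01 : ∀ s, f s ∈ Set.Icc (0 : ℝ) 1)
    (hfc : Continuous f) (hfm : Monotone f) :
    ∃ F : E → ℝ, Continuous F ∧ Monotone F ∧ (∀ x, F x ∈ Set.Icc (0 : ℝ) 1) ∧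
      ∀ s : S, F s = f s := by
  choose G hGc hGm hGs using fun n : ℕ => npApprox hE S hS f hf01 hfc hfm
    (show (0 : ℝ) < 1 / 2 / 2 ^ n by positivity)
  let F : ℕ → E → ℝ := fun n => Nat.rec (G 0)
    (fun n F x => max (min (G (n + 1) x) (F x + 1 / 2 / 2 ^ n)) (F x - 1 / 2 / 2 ^ n)) n
  have hFs : ∀ n x, F (n + 1) x =
    max (min (G (n + 1) x) (F n x + 1 / 2 / 2 ^ n)) (F n x - 1 / 2 / 2 ^ n) := fun _ _ => rfl
  have hFc : ∀ n, Continuous (F n) := by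
    intro n
    induction n with
    | zero => exact hGc 0
    | succ n ih =>
      rw [show F (n + 1) = _ from funext (hFs n)]
      have := hGc (n + 1)
      fun_prop
  have hFm : ∀ n, Monotone (F n) := by
    intro n
    induction n with
    | zero => exact hGm 0
    | succ n ih =>
      intro x y hxy
      rw [hFs, hFs]
      have h1 := hGm (n + 1) hxy
      have h2 := ih hxy
      gcongr
  have hFf : ∀ n (s : S), |F n s - f s| ≤ 1 / 2 / 2 ^ n := by
    intro n
    induction n with
    | zero => exact hGs 0
    | succ n ih =>
      intro s
      have h1 := abs_le.1 (hGs (n + 1) s)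
      have h2 := abs_le.1 (ih s)
      have h3 : (0 : ℝ) < 1 / 2 / 2 ^ (n + 1) := by positivity
      rw [hFs, abs_le]
      generalize (1 : ℝ) / 2 / 2 ^ (n + 1) = e at *
      generalize (1 : ℝ) / 2 / 2 ^ n = d at *
      constructor
      · have : f s - e ≤ min (G (n + 1) s) (F n s + d) := le_min (by linarith) (by linarith)
        have := this.trans (le_max_left _ (F n s - d))
        linarith
      · have : max (min (G (n + 1) s) (F n s + d)) (F n s - d) ≤ f s + e :=
          max_le ((min_le_left _ _).trans (by linarith)) (by linarith)
        linarith
  have hd : ∀ x n, dist (F n x) (F (n + 1) x) ≤ 1 / 2 / 2 ^ n := by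
    intro x n
    have h3 : (0 : ℝ) < 1 / 2 / 2 ^ n := by positivity
    rw [dist_comm, Real.dist_eq, hFs, abs_le]
    generalize (1 : ℝ) / 2 / 2 ^ n = d at *
    constructor
    · have := le_max_right (min (G (n + 1) x) (F n x + d)) (F n x - d)
      linarith
    · have : max (min (G (n + 1) x) (F n x + d)) (F n x - d) ≤ F n x + d :=
        max_le (min_le_right _ _) (by linarith)
      linarith
  choose L hL using fun x => cauchySeq_tendsto_of_complete (cauchySeq_of_le_geometric_two (hd x))
  have hz : Filter.Tendsto (fun n : ℕ => (1 : ℝ) / 2 ^ n) Filter.atTop (nhds 0) := by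
    simpa using tendsto_pow_atTop_nhds_zero_of_lt_one (r := (1 / 2 : ℝ)) (by norm_num) (by norm_num)
  have hu : TendstoUniformly F L Filter.atTop := by
    rw [Metric.tendstoUniformly_iff]
    intro e he
    filter_upwards [hz.eventually_lt_const he] with n hn x
    rw [dist_comm]
    exact (dist_le_of_le_geometric_two_of_tendsto (hd x) (hL x) n).trans_lt hn
  have hLc : Continuous L := hu.continuous (Filter.Frequently.of_forall hFc)
  have hLm : Monotone L := fun x y hxy =>
    le_of_tendsto_of_tendsto' (hL x) (hL y) (fun n => hFm n hxy)
  have hLf : ∀ s : S, L s = f s := by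
    intro s
    refine tendsto_nhds_unique (hL s) ?_
    rw [tendsto_iff_dist_tendsto_zero]
    refine squeeze_zero (fun _ => dist_nonneg) (fun n => ?_) hz
    rw [Real.dist_eq]
    refine (hFf n s).trans ?_
    gcongr
    norm_num
  refine ⟨fun x => max 0 (min 1 (L x)), by fun_prop, ?_, ?_, ?_⟩
  · intro x y hxy
    exact max_le_max le_rfl (min_le_min le_rfl (hLm hxy))
  · intro x
    exact ⟨le_max_left _ _, max_le zero_le_one (min_le_left _ _)⟩
  · intro s
    show max 0 (min 1 (L s)) = f s
    rw [hLf, min_eq_right (hf01 s).2, max_eq_right (hf01 s).1]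
end

section
/- Let E be a compact topological space equipped with a preorder whose graph is closed in E × E. Let K ⊆ E be a (possibly empty) compact subset, let A ⊆ E be a closed decreasing set and B ⊆ E a closed increasing set with A ∩ B = ∅, and let f : K → [0,1] be a continuous isotone function such that A ∩ K ⊆ f⁻¹(0) and B ∩ K ⊆ f⁻¹(1). Then there exists a continuous isotone function F : E → [0,1] extending f with A ⊆ F⁻¹(0) and B ⊆ F⁻¹(1). -/
section helpers

variable {E : Type*} [TopologicalSpace E] [Preorder E]

theorem aux_up_closed (hG : IsClosed {p : E × E | p.1 ≤ p.2}) {C : Set E} (hC : IsCompact C) :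
    IsClosed {y : E | ∃ x ∈ C, x ≤ y} := by
  have : CompactSpace C := isCompact_iff_compactSpace.1 hC
  have h1 : IsClosed {p : C × E | (p.1 : E) ≤ p.2} :=
    hG.preimage (f := fun p : C × E => ((p.1 : E), p.2)) (by fun_prop)
  have h2 := isClosedMap_snd_of_compactSpace _ h1
  convert h2 using 1
  ext y
  simp

theorem aux_down_closed (hG : IsClosed {p : E × E | p.1 ≤ p.2}) {C : Set E} (hC : IsCompact C) :
    IsClosed {y : E | ∃ x ∈ C, y ≤ x} := by
  have : CompactSpace C := isCompact_iff_compactSpace.1 hC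
  have h1 : IsClosed {p : C × E | p.2 ≤ (p.1 : E)} :=
    hG.preimage (f := fun p : C × E => (p.2, (p.1 : E))) (by fun_prop)
  have h2 := isClosedMap_snd_of_compactSpace _ h1
  convert h2 using 1
  ext y
  simp

theorem aux_normal [CompactSpace E] (hG : IsClosed {p : E × E | p.1 ≤ p.2}) {D U : Set E}
    (hD : IsClosed D) (hDl : IsLowerSet D) (hU : IsOpen U) (hUl : IsLowerSet U) (hDU : D ⊆ U) :
    ∃ v D' : Set E, IsOpen v ∧ IsLowerSet v ∧ IsClosed D' ∧ IsLowerSet D' ∧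
      D ⊆ v ∧ v ⊆ D' ∧ D' ⊆ U := by
  obtain ⟨u, w, hu, hw, hBu, hDw, huw⟩ := generalized_tube_lemma
    (hU.isClosed_compl.isCompact) hD.isCompact hG.isOpen_compl (by
      rintro ⟨b, a⟩ ⟨hb, ha⟩ hle
      exact hb (hUl hle (hDU ha)))
  have key : ∀ x ∈ u, ∀ y ∈ w, ¬ x ≤ y := fun x hx y hy h => huw (Set.mk_mem_prod hx hy) h
  refine ⟨{y | ∃ x ∈ wᶜ, x ≤ y}ᶜ, {y | ∃ x ∈ uᶜ, y ≤ x},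
    (aux_up_closed hG hw.isClosed_compl.isCompact).isOpen_compl, ?_,
    aux_down_closed hG hu.isClosed_compl.isCompact, ?_, ?_, ?_, ?_⟩
  · rintro a b hba ha ⟨x, hx, hxb⟩
    exact ha ⟨x, hx, hxb.trans hba⟩
  · rintro a b hba ⟨x, hx, hxb⟩
    exact ⟨x, hx, hba.trans hxb⟩
  · rintro a ha ⟨x, hx, hxa⟩
    exact hx (hDw (hDl hxa ha))
  · intro a ha
    have haw : a ∈ w := by
      by_contra h
      exact ha ⟨a, h, le_rfl⟩
    exact ⟨a, fun h => key a h a haw le_rfl, le_rfl⟩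
  · rintro a ⟨x, hx, hax⟩
    by_contra h
    exact hx (hBu (fun hxU => h (hUl hax hxU)))

/-- The invariant used in the monotone Urysohn construction. -/
def AuxP (c u : Set E) : Prop :=
  IsLowerSet u ∧ ∃ D : Set E, IsClosed D ∧ IsLowerSet D ∧ c ⊆ D ∧ D ⊆ u

theorem aux_approx_mono (n : ℕ) (c : Urysohns.CU (AuxP (E := E))) : Monotone (c.approx n) := by
  induction n generalizing c with
  | zero =>
    intro x y hxy
    by_cases hx : x ∈ c.U
    · rw [show c.approx 0 x = 0 by simp [Urysohns.CU.approx, hx]]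
      exact c.approx_nonneg 0 y
    · have hy : y ∉ c.U := fun h => hx (c.P_C_U.1 hxy h)
      rw [c.approx_of_notMem_U 0 hx, c.approx_of_notMem_U 0 hy]
  | succ n ih =>
    intro x y hxy
    simp only [Urysohns.CU.approx]
    exact midpoint_le_midpoint (ih _ hxy) (ih _ hxy)

theorem aux_urysohn [CompactSpace E] (hG : IsClosed {p : E × E | p.1 ≤ p.2}) {D V : Set E}
    (hD : IsClosed D) (hDl : IsLowerSet D) (hV : IsClosed V) (hVu : IsUpperSet V)
    (hDV : ∀ x ∈ D, x ∉ V) :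
    ∃ F : E → ℝ, Continuous F ∧ Monotone F ∧ (∀ x, F x ∈ Set.Icc (0 : ℝ) 1) ∧
      (∀ x ∈ D, F x = 0) ∧ (∀ x ∈ V, F x = 1) := by
  let c : Urysohns.CU (AuxP (E := E)) :=
    { C := D
      U := Vᶜ
      P_C_U := ⟨hVu.compl, D, hD, hDl, subset_rfl, hDV⟩
      closed_C := hD
      open_U := hV.isOpen_compl
      subset := hDV
      hP := by
        rintro c u hc ⟨hul, D, hD, hDl, hcD, hDu⟩ hu hcu
        obtain ⟨v, D', hv, hvl, hD', hDl', h1, h2, h3⟩ := aux_normal hG hD hDl hu hul hDu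
        have hcl : closure v ⊆ D' := closure_minimal h2 hD'
        exact ⟨v, hv, hcD.trans h1, hcl.trans h3, ⟨hvl, D, hD, hDl, hcD, h1⟩,
          ⟨hul, D', hD', hDl', hcl, h3⟩⟩ }
  refine ⟨c.lim, c.continuous_lim, ?_, c.lim_mem_Icc, fun x hx => c.lim_of_mem_C x hx,
    fun x hx => c.lim_of_notMem_U x (fun h => h hx)⟩
  intro x y hxy
  exact le_of_tendsto_of_tendsto' (c.tendsto_approx_atTop x) (c.tendsto_approx_atTop y)
    (fun n => aux_approx_mono n c hxy)

theorem aux_sum (F : ℕ → ℝ) (t : ℝ) (ht : 0 ≤ t) (h01 : ∀ j, F j ∈ Set.Icc (0 : ℝ) 1) (N : ℕ)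
    (h0 : ∀ j < N, t ≤ (j : ℝ) → F j = 0) (h1 : ∀ j < N, (j : ℝ) + 1 ≤ t → F j = 1) (m : ℕ)
    (hm : m ≤ N) :
    (∑ j ∈ Finset.range m, F j ≤ m ∧ ∑ j ∈ Finset.range m, F j ≤ t + 1) ∧
      min (m : ℝ) (t - 1) ≤ ∑ j ∈ Finset.range m, F j := by
  induction m with
  | zero => simp; linarith
  | succ m ih =>
    obtain ⟨⟨a, b⟩, d⟩ := ih (by omega)
    have hF := h01 m
    rw [Finset.sum_range_succ]
    push_cast
    refine ⟨⟨by linarith [hF.2], ?_⟩, ?_⟩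
    · rcases le_total t m with h | h
      · rw [h0 m (by omega) h]; linarith
      · linarith [hF.2]
    · rcases le_total ((m : ℝ) + 1) t with h | h
      · rw [min_eq_left (by linarith)] at d
        rw [h1 m (by omega) h]
        refine (min_le_left _ _).trans ?_
        linarith
      · rw [min_eq_right (by linarith)] at d
        exact (min_le_right _ _).trans (by linarith [hF.1])

theorem aux_level [CompactSpace E]
    (hG : IsClosed {p : E × E | p.1 ≤ p.2})
    (K : Set E) (hK : IsCompact K)
    (A B : Set E)
    (hA : IsClosed A) (hAl : IsLowerSet A)
    (hB : IsClosed B) (hBu : IsUpperSet B)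
    (hAB : A ∩ B = ∅)
    (f : K → ℝ)
    (hfc : Continuous f) (hfm : Monotone f)
    (hfA : ∀ x : K, (x : E) ∈ A → f x = 0)
    (hfB : ∀ x : K, (x : E) ∈ B → f x = 1) (s t : ℝ) (hs : 0 ≤ s) (hst : s < t) (ht : t ≤ 1) :
    ∃ F : E → ℝ, Continuous F ∧ Monotone F ∧ (∀ x, F x ∈ Set.Icc (0 : ℝ) 1) ∧
      (∀ x ∈ A, F x = 0) ∧ (∀ x ∈ B, F x = 1) ∧ (∀ x : K, f x ≤ s → F x = 0) ∧
      (∀ x : K, t ≤ f x → F x = 1) := by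
  have : CompactSpace K := isCompact_iff_compactSpace.1 hK
  have hS : IsCompact ((↑) '' {x : K | f x ≤ s} : Set E) :=
    (isClosed_le hfc continuous_const).isCompact.image continuous_subtype_val
  have hT : IsCompact ((↑) '' {x : K | t ≤ f x} : Set E) :=
    (isClosed_le continuous_const hfc).isCompact.image continuous_subtype_val
  obtain ⟨F, h1, h2, h3, h4, h5⟩ := aux_urysohn hG
    (hA.union (aux_down_closed hG hS))
    (hAl.union (by rintro a b hba ⟨x, hx, hxb⟩; exact ⟨x, hx, hba.trans hxb⟩))
    (hB.union (aux_up_closed hG hT))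
    (hBu.union (by rintro a b hba ⟨x, hx, hxb⟩; exact ⟨x, hx, hxb.trans hba⟩))
    (by
      rintro x (hx | ⟨_, ⟨y, hy, rfl⟩, hxy⟩) (hx' | ⟨_, ⟨z, hz, rfl⟩, hzx⟩)
      · exact (hAB ▸ (⟨hx, hx'⟩ : x ∈ A ∩ B) : x ∈ (∅ : Set E))
      · have := hfA z (hAl hzx hx)
        simp only [Set.mem_ofPred_eq] at hz
        linarith
      · have := hfB y (hBu hxy hx')
        simp only [Set.mem_ofPred_eq] at hy
        linarith
      · have := hfm (show z ≤ y from hzx.trans hxy)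
        simp only [Set.mem_ofPred_eq] at hy hz
        linarith)
  exact ⟨F, h1, h2, h3, fun x hx => h4 x (Or.inl hx), fun x hx => h5 x (Or.inl hx),
    fun x hx => h4 x (Or.inr ⟨x, ⟨x, hx, rfl⟩, le_rfl⟩),
    fun x hx => h5 x (Or.inr ⟨x, ⟨x, hx, rfl⟩, le_rfl⟩)⟩

/-- Continuous isotone `[0,1]`-valued functions separating `A` and `B`. -/
def AuxGood (A B : Set E) (F : C(E, ℝ)) : Prop :=
  Monotone F ∧ (∀ x, F x ∈ Set.Icc (0 : ℝ) 1) ∧ (∀ x ∈ A, F x = 0) ∧ (∀ x ∈ B, F x = 1)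

theorem aux_near [CompactSpace E]
    (hG : IsClosed {p : E × E | p.1 ≤ p.2})
    (K : Set E) (hK : IsCompact K)
    (A B : Set E)
    (hA : IsClosed A) (hAl : IsLowerSet A)
    (hB : IsClosed B) (hBu : IsUpperSet B)
    (hAB : A ∩ B = ∅)
    (f : K → ℝ)
    (hf01 : ∀ x, f x ∈ Set.Icc (0 : ℝ) 1)
    (hfc : Continuous f) (hfm : Monotone f)
    (hfA : ∀ x : K, (x : E) ∈ A → f x = 0)
    (hfB : ∀ x : K, (x : E) ∈ B → f x = 1) (ε : ℝ) (hε : 0 < ε) :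
    ∃ F : C(E, ℝ), AuxGood A B F ∧ ∀ x : K, |F x - f x| ≤ ε := by
  obtain ⟨M, hM⟩ := exists_nat_one_div_lt hε
  set N : ℕ := M + 1 with hN
  have hNpos : (0 : ℝ) < N := by positivity
  have hNε : 1 / (N : ℝ) < ε := by rw [hN]; push_cast; exact hM
  have hex : ∀ j : ℕ, ∃ F : E → ℝ, Continuous F ∧ Monotone F ∧ (∀ x, F x ∈ Set.Icc (0 : ℝ) 1) ∧
      (∀ x ∈ A, F x = 0) ∧ (∀ x ∈ B, F x = 1) ∧
      (j < N → (∀ x : K, f x ≤ j / N → F x = 0) ∧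
      (∀ x : K, ((j : ℝ) + 1) / N ≤ f x → F x = 1)) := by
    intro j
    by_cases hj : j < N
    · have hj' : (j : ℝ) + 1 ≤ N := by exact_mod_cast hj
      obtain ⟨F, h1, h2, h3, h4, h5, h6, h7⟩ := aux_level hG K hK A B hA hAl hB hBu hAB f hfc hfm
        hfA hfB (j / N) ((j + 1) / N) (by positivity) (by gcongr; linarith)
        ((div_le_one hNpos).2 hj')
      exact ⟨F, h1, h2, h3, h4, h5, fun _ => ⟨h6, h7⟩⟩
    · obtain ⟨F, h1, h2, h3, h4, h5, h6, h7⟩ := aux_level hG K hK A B hA hAl hB hBu hAB f hfc hfm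
        hfA hfB 0 1 le_rfl one_pos le_rfl
      exact ⟨F, h1, h2, h3, h4, h5, fun h => absurd h hj⟩
  choose F h1 h2 h3 h4 h5 h6 using hex
  have hFc : Continuous (fun x => (∑ j ∈ Finset.range N, F j x) / N) :=
    (continuous_finsetSum _ (fun j _ => h1 j)).div_const _
  refine ⟨⟨fun x => (∑ j ∈ Finset.range N, F j x) / N, hFc⟩, ⟨?_, ?_, ?_, ?_⟩, ?_⟩
  · intro x y hxy
    simp only [ContinuousMap.coe_mk]
    gcongr with j _
    exact h2 j hxy
  · intro x
    simp only [ContinuousMap.coe_mk]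
    refine ⟨div_nonneg (Finset.sum_nonneg fun j _ => (h3 j x).1) hNpos.le, ?_⟩
    rw [div_le_one hNpos]
    refine (Finset.sum_le_sum (fun j _ => (h3 j x).2)).trans ?_
    simp
  · intro x hx
    simp only [ContinuousMap.coe_mk]
    rw [Finset.sum_eq_zero (fun j _ => h4 j x hx), zero_div]
  · intro x hx
    simp only [ContinuousMap.coe_mk]
    rw [Finset.sum_congr rfl (fun j _ => h5 j x hx)]
    simp [hNpos.ne']
  · intro x
    simp only [ContinuousMap.coe_mk]
    have hfx := hf01 x
    obtain ⟨⟨_, b⟩, d⟩ := aux_sum (fun j => F j x) (f x * N) (mul_nonneg hfx.1 hNpos.le)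
      (fun j => h3 j x) N
      (fun j hj h => (h6 j hj).1 x ((le_div_iff₀ hNpos).2 h))
      (fun j hj h => (h6 j hj).2 x ((div_le_iff₀ hNpos).2 h)) N le_rfl
    rw [min_eq_right (by nlinarith [hfx.2])] at d
    refine le_trans ?_ hNε.le
    rw [abs_le]
    constructor
    · rw [neg_le_sub_iff_le_add, ← add_div, le_div_iff₀ hNpos]
      linarith
    · rw [sub_le_iff_le_add, div_le_iff₀ hNpos, add_mul, one_div, inv_mul_cancel₀ hNpos.ne']
      linarith

theorem aux_clamp (A B : Set E) (K : Set E) (f : K → ℝ) (ε δ : ℝ) (hε : 0 ≤ ε)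
    (g h : C(E, ℝ)) (hg : AuxGood A B g) (hh : AuxGood A B h)
    (hgf : ∀ x : K, |g x - f x| ≤ ε) (hhf : ∀ x : K, |h x - f x| ≤ δ) :
    ∃ g' : C(E, ℝ), AuxGood A B g' ∧ (∀ x : K, |g' x - f x| ≤ δ) ∧ ∀ x, |g x - g' x| ≤ ε := by
  refine ⟨⟨fun x => max (g x - ε) (min (g x + ε) (h x)), by fun_prop⟩, ⟨?_, ?_, ?_, ?_⟩, ?_, ?_⟩
  · intro x y hxy
    have := hg.1 hxy
    have := hh.1 hxy
    simp only [ContinuousMap.coe_mk]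
    gcongr
  · intro x
    have a := hg.2.1 x
    have b := hh.2.1 x
    simp only [ContinuousMap.coe_mk]
    exact ⟨le_max_of_le_right (le_min (by linarith [a.1]) b.1),
      max_le (by linarith [a.2]) ((min_le_right _ _).trans b.2)⟩
  · intro x hx
    simp only [ContinuousMap.coe_mk, hg.2.2.1 x hx, hh.2.2.1 x hx]
    simp [hε]
  · intro x hx
    simp only [ContinuousMap.coe_mk, hg.2.2.2 x hx, hh.2.2.2 x hx]
    simp [hε]
  · intro x
    have a := abs_le.1 (hgf x)
    have b := abs_le.1 (hhf x)
    simp only [ContinuousMap.coe_mk]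
    rw [abs_le]
    rcases max_choice (g x - ε) (min (g x + ε) (h x)) with e | e <;>
    rcases min_choice (g x + ε) (h x) with e' | e' <;> grind
  · intro x
    simp only [ContinuousMap.coe_mk]
    rw [abs_le]
    grind

end helpers

/-- Extension and separation lemma.  Let `E` be a compact space with a preorder whose
graph is closed in `E × E`, let `K` be a (possibly empty) compact subset, `A` a closed
decreasing set and `B` a closed increasing set with `A ∩ B = ∅`, and let
`f : K → [0,1]` be continuous and isotone with `A ∩ K ⊆ f⁻¹(0)` and `B ∩ K ⊆ f⁻¹(1)`.
Then `f` extends to a continuous isotone `F : E → [0,1]` with `A ⊆ F⁻¹(0)` and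
`B ⊆ F⁻¹(1)`. -/
theorem extension_separation_compact
    {E : Type*} [TopologicalSpace E] [Preorder E] [CompactSpace E]
    (hG : IsClosed {p : E × E | p.1 ≤ p.2})
    (K : Set E) (hK : IsCompact K)
    (A B : Set E)
    (hA : IsClosed A) (hAl : IsLowerSet A)
    (hB : IsClosed B) (hBu : IsUpperSet B)
    (hAB : A ∩ B = ∅)
    (f : K → ℝ)
    (hf01 : ∀ x, f x ∈ Set.Icc (0 : ℝ) 1)
    (hfc : Continuous f) (hfm : Monotone f)
    (hfA : ∀ x : K, (x : E) ∈ A → f x = 0)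
    (hfB : ∀ x : K, (x : E) ∈ B → f x = 1) :
    ∃ F : E → ℝ, Continuous F ∧ Monotone F ∧ (∀ x, F x ∈ Set.Icc (0 : ℝ) 1) ∧
      (∀ x : K, F x = f x) ∧ (∀ x ∈ A, F x = 0) ∧ (∀ x ∈ B, F x = 1) := by
  have near := aux_near hG K hK A B hA hAl hB hBu hAB f hf01 hfc hfm hfA hfB
  let T : ℕ → Type _ := fun n =>
    {g : C(E, ℝ) // AuxGood A B g ∧ ∀ x : K, |g x - f x| ≤ 2 / 2 / 2 ^ n}
  have step : ∀ n (g : T n), ∃ g' : T (n + 1), ∀ x, |g.1 x - g'.1 x| ≤ 2 / 2 / 2 ^ n := by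
    intro n g
    obtain ⟨h, hh, hhf⟩ := near (2 / 2 / 2 ^ (n + 1)) (by positivity)
    obtain ⟨g', a, b, c⟩ := aux_clamp A B K f (2 / 2 / 2 ^ n) _ (by positivity) g.1 h g.2.1 hh
      g.2.2 hhf
    exact ⟨⟨g', a, b⟩, c⟩
  choose S hS using step
  have h0 : Nonempty (T 0) := by
    obtain ⟨h, hh, hhf⟩ := near (2 / 2 / 2 ^ 0) (by positivity)
    exact ⟨⟨h, hh, hhf⟩⟩
  obtain ⟨g0⟩ := h0
  let G : ∀ n, T n := fun n => Nat.rec g0 (fun n g => S n g) n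
  have hGs : ∀ n x, |(G n).1 x - (G (n + 1)).1 x| ≤ 2 / 2 / 2 ^ n := fun n x => hS n (G n) x
  have hcau : CauchySeq (fun n => (G n).1) := by
    refine cauchySeq_of_le_geometric_two (C := 2) (fun n => ?_)
    rw [ContinuousMap.dist_le (by positivity)]
    exact hGs n
  obtain ⟨F, hF⟩ := cauchySeq_tendsto_of_complete hcau
  have hpt : ∀ x, Filter.Tendsto (fun n => (G n).1 x) Filter.atTop (nhds (F x)) := fun x =>
    ((continuous_eval_const (F := C(E, ℝ)) x).tendsto F).comp hF
  refine ⟨F, F.continuous, ?_, ?_, ?_, ?_, ?_⟩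
  · intro x y hxy
    exact le_of_tendsto_of_tendsto' (hpt x) (hpt y) (fun n => (G n).2.1.1 hxy)
  · intro x
    exact isClosed_Icc.mem_of_tendsto (hpt x)
      (Filter.Eventually.of_forall fun n => (G n).2.1.2.1 x)
  · intro x
    refine tendsto_nhds_unique (hpt x) ?_
    rw [tendsto_iff_dist_tendsto_zero]
    refine squeeze_zero (fun _ => dist_nonneg) (fun n => (G n).2.2 x) ?_
    have := (tendsto_pow_atTop_nhds_zero_of_lt_one (r := (1 / 2 : ℝ)) (by norm_num)
      (by norm_num))
    refine this.congr (fun n => ?_)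
    simp
  · intro x hx
    refine tendsto_nhds_unique (hpt x) ?_
    exact tendsto_const_nhds.congr (fun n => ((G n).2.1.2.2.1 x hx).symm)
  · intro x hx
    refine tendsto_nhds_unique (hpt x) ?_
    exact tendsto_const_nhds.congr (fun n => ((G n).2.1.2.2.2 x hx).symm)
end

section
/- Let E be a k_ω-space equipped with a preorder whose graph is closed in E × E. Let K ⊆ E be a (possibly empty) compact subset, let D ⊆ E be a closed decreasing set and I ⊆ E a closed increasing set with D ∩ I = ∅, and let f : K → [0,1] be a continuous isotone function such that D ∩ K ⊆ f⁻¹(0) and I ∩ K ⊆ f⁻¹(1). Then there exists a continuous isotone function F : E → [0,1] extending f with D ⊆ F⁻¹(0) and I ⊆ F⁻¹(1). -/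
open Set Filter Topology

lemma hull_closed_aux {X : Type*} [TopologicalSpace X] {G : Set (X × X)} (hG : IsClosed G)
    {S : Set X} (hS : IsCompact S) : IsClosed {x | ∃ y ∈ S, (y, x) ∈ G} := by
  rw [← isOpen_compl_iff, isOpen_iff_mem_nhds]
  intro x hx
  have hsub : S ×ˢ ({x} : Set X) ⊆ Gᶜ := by
    rintro ⟨a, b⟩ ⟨ha, hb⟩ hab
    simp only [mem_singleton_iff] at hb
    subst hb
    exact hx ⟨a, ha, hab⟩
  obtain ⟨u, v, -, hv, hSu, hxv, huv⟩ :=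
    generalized_tube_lemma hS isCompact_singleton hG.isOpen_compl hsub
  refine mem_of_superset (hv.mem_nhds (hxv rfl)) ?_
  rintro z hz ⟨y, hy, hyz⟩
  exact huv (mk_mem_prod (hSu hy) hz) hyz

lemma upper_hull_closed_aux {X : Type*} [TopologicalSpace X] [Preorder X]
    (hG : IsClosed {p : X × X | p.1 ≤ p.2})
    {S : Set X} (hS : IsCompact S) : IsClosed {x | ∃ y ∈ S, y ≤ x} :=
  hull_closed_aux hG hS

lemma lower_hull_closed_aux {X : Type*} [TopologicalSpace X] [Preorder X]
    (hG : IsClosed {p : X × X | p.1 ≤ p.2})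
    {S : Set X} (hS : IsCompact S) : IsClosed {x | ∃ y ∈ S, x ≤ y} :=
  hull_closed_aux (hG.preimage continuous_swap) hS

lemma normal_aux {X : Type*} [TopologicalSpace X] [Preorder X] [CompactSpace X]
    (hG : IsClosed {p : X × X | p.1 ≤ p.2}) {c u : Set X} (hc : IsClosed c)
    (hul : IsLowerSet u) (hu : IsOpen u) (hcu : c ⊆ u) :
    ∃ v, IsOpen v ∧ c ⊆ v ∧ closure v ⊆ u ∧ IsLowerSet v := by
  set D : Set X := {x | ∃ y ∈ c, x ≤ y} with hD
  have hDc : IsClosed D := lower_hull_closed_aux hG hc.isCompact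
  have hsub : uᶜ ×ˢ D ⊆ {p : X × X | p.1 ≤ p.2}ᶜ := by
    rintro ⟨a, b⟩ ⟨ha, y, hy, hby⟩ hab
    exact ha (hul (le_trans hab hby) (hcu hy))
  obtain ⟨U, V, hU, hV, huU, hDV, hUV⟩ :=
    generalized_tube_lemma hu.isClosed_compl.isCompact hDc.isCompact hG.isOpen_compl hsub
  refine ⟨{x | ∃ y ∈ Vᶜ, y ≤ x}ᶜ,
    (upper_hull_closed_aux hG hV.isClosed_compl.isCompact).isOpen_compl, ?_, ?_, ?_⟩
  · rintro x hx ⟨y, hy, hyx⟩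
    exact hy (hDV ⟨x, hx, hyx⟩)
  · have h1 : closure {x | ∃ y ∈ Vᶜ, y ≤ x}ᶜ ⊆ Uᶜ := by
      refine closure_minimal ?_ hU.isClosed_compl
      intro x hx hxU
      by_cases hxV : x ∈ V
      · exact hUV (mk_mem_prod hxU hxV) (le_refl x)
      · exact hx ⟨x, hxV, le_refl x⟩
    intro x hx
    by_contra hxu
    exact h1 hx (huU hxu)
  · rintro a b hba ha ⟨y, hy, hyb⟩
    exact ha ⟨y, hy, hyb.trans hba⟩

lemma approx_mono_aux {X : Type*} [TopologicalSpace X] [Preorder X]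
    (n : ℕ) (c : Urysohns.CU (fun _ u : Set X => IsLowerSet u)) :
    Monotone (c.approx n) := by
  induction n generalizing c with
  | zero =>
    intro x y hxy
    simp only [Urysohns.CU.approx]
    by_cases hy : y ∈ c.U
    · have hx : x ∈ c.U := c.P_C_U hxy hy
      simp [hx, hy]
    · rw [indicator_of_mem (show y ∈ c.Uᶜ from hy)]
      exact indicator_apply_le' (fun _ => le_rfl) fun _ => zero_le_one
  | succ n ih =>
    intro x y hxy
    simp only [Urysohns.CU.approx]
    exact midpoint_le_midpoint (ih _ hxy) (ih _ hxy)

lemma urysohn_aux {X : Type*} [TopologicalSpace X] [Preorder X] [CompactSpace X]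
    (hG : IsClosed {p : X × X | p.1 ≤ p.2}) {A B : Set X} (hA : IsClosed A)
    (hB : IsClosed B) (hBu : IsUpperSet B) (hAB : Disjoint A B) :
    ∃ h : X → ℝ, Continuous h ∧ Monotone h ∧ (∀ x, h x ∈ Icc (0 : ℝ) 1) ∧
      (∀ x ∈ A, h x = 0) ∧ (∀ x ∈ B, h x = 1) := by
  let c : Urysohns.CU (fun _ u : Set X => IsLowerSet u) :=
    { C := A
      U := Bᶜ
      P_C_U := hBu.compl
      closed_C := hA
      open_U := hB.isOpen_compl
      subset := hAB.subset_compl_right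
      hP := by
        intro c u hc hul hu hcu
        obtain ⟨v, h1, h2, h3, h4⟩ := normal_aux hG hc hul hu hcu
        exact ⟨v, h1, h2, h3, h4, hul⟩ }
  refine ⟨c.lim, c.continuous_lim, ?_, c.lim_mem_Icc, fun x hx => c.lim_of_mem_C x hx,
    fun x hx => c.lim_of_notMem_U x (fun h => h hx)⟩
  intro x y hxy
  exact le_of_tendsto_of_tendsto' (c.tendsto_approx_atTop x) (c.tendsto_approx_atTop y)
    (fun n => approx_mono_aux n c hxy)

lemma sum_aux (y : ℝ) (h : ℕ → ℝ) (h01 : ∀ k, h k ∈ Icc (0 : ℝ) 1)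
    (h1 : ∀ k : ℕ, (k : ℝ) + 1 ≤ y → h k = 1) (h0 : ∀ k : ℕ, y ≤ k → h k = 0) (hy : 0 ≤ y)
    (n : ℕ) :
    ((n : ℝ) ≤ y → ∑ k ∈ Finset.range n, h k = n) ∧
    (y ≤ n → |∑ k ∈ Finset.range n, h k - y| ≤ 1) := by
  induction n with
  | zero =>
    refine ⟨fun _ => by simp, fun h => ?_⟩
    have : y = 0 := le_antisymm (by simpa using h) hy
    simp [this]
  | succ n ih =>
    rw [Finset.sum_range_succ]
    push_cast
    constructor
    · intro hn
      rw [ih.1 (by linarith), h1 n hn]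
    · intro hn
      rcases le_total y n with hyn | hyn
      · rw [h0 n hyn, add_zero]
        exact ih.2 hyn
      · rw [ih.1 hyn, abs_le]
        have := h01 n
        constructor <;> linarith [this.1, this.2]

/-- Admissible data on a (compact) preordered space. -/
def GoodAux {X : Type*} [Preorder X] (A B : Set X) (g : X → ℝ) : Prop :=
  Monotone g ∧ (∀ x, g x ∈ Icc (0 : ℝ) 1) ∧ (∀ x ∈ A, g x = 0) ∧ (∀ x ∈ B, g x = 1)

lemma approx_ext_aux {X : Type*} [TopologicalSpace X] [Preorder X] [CompactSpace X]
    (hG : IsClosed {p : X × X | p.1 ≤ p.2})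
    (K : Set X) (hK : IsCompact K) (A B : Set X)
    (hA : IsClosed A) (hAl : IsLowerSet A) (hB : IsClosed B) (hBu : IsUpperSet B)
    (hAB : A ∩ B = ∅) (f : K → ℝ) (hf01 : ∀ x, f x ∈ Icc (0 : ℝ) 1)
    (hfc : Continuous f) (hfm : Monotone f)
    (hfA : ∀ x : K, (x : X) ∈ A → f x = 0) (hfB : ∀ x : K, (x : X) ∈ B → f x = 1)
    (n : ℕ) (hn : 0 < n) :
    ∃ g : X → ℝ, Continuous g ∧ GoodAux A B g ∧ ∀ x : K, |g x - f x| ≤ 1 / n := by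
  have hn' : (0 : ℝ) < n := by exact_mod_cast hn
  have : CompactSpace K := isCompact_iff_compactSpace.1 hK
  have key : ∀ k : ℕ, ∃ h : X → ℝ, k < n → (Continuous h ∧ GoodAux A B h ∧
      (∀ x : K, (k : ℝ) + 1 ≤ n * f x → h x = 1) ∧ (∀ x : K, n * f x ≤ k → h x = 0)) := by
    intro k
    by_cases hk : k < n
    swap
    · exact ⟨0, fun h => absurd h hk⟩
    have hk' : (k : ℝ) < n := by exact_mod_cast hk
    have hS : IsCompact (Subtype.val '' {x : K | n * f x ≤ k}) :=
      (isClosed_le (by fun_prop) (by fun_prop)).isCompact.image continuous_subtype_val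
    have hT : IsCompact (Subtype.val '' {x : K | (k : ℝ) + 1 ≤ n * f x}) :=
      (isClosed_le (by fun_prop) (by fun_prop)).isCompact.image continuous_subtype_val
    have hBu' : IsUpperSet (B ∪ {x | ∃ y ∈ Subtype.val '' {x : K | (k : ℝ) + 1 ≤ n * f x}, y ≤ x}) := by
      refine hBu.union ?_
      rintro a b hab ⟨y, hy, hya⟩
      exact ⟨y, hy, hya.trans hab⟩
    have hdis : Disjoint (A ∪ {x | ∃ y ∈ Subtype.val '' {x : K | n * f x ≤ k}, x ≤ y})
        (B ∪ {x | ∃ y ∈ Subtype.val '' {x : K | (k : ℝ) + 1 ≤ n * f x}, y ≤ x}) := by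
      rw [Set.disjoint_left]
      rintro x (hxA | ⟨_, ⟨y, hy, rfl⟩, hxy⟩) (hxB | ⟨_, ⟨z, hz, rfl⟩, hzx⟩)
      · exact (hAB ▸ (⟨hxA, hxB⟩ : x ∈ A ∩ B) : x ∈ (∅ : Set X))
      · have h0 := hfA z (hAl hzx hxA)
        simp only [mem_ofPred_eq, h0] at hz
        have : (0 : ℝ) ≤ k := k.cast_nonneg
        linarith
      · have h0 := hfB y (hBu hxy hxB)
        simp only [mem_ofPred_eq, h0] at hy
        linarith
      · have h0 : f z ≤ f y := hfm (show (z : X) ≤ y from hzx.trans hxy)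
        simp only [mem_ofPred_eq] at hy hz
        have := mul_le_mul_of_nonneg_left h0 hn'.le
        linarith
    obtain ⟨h, h1, h2, h3, h4, h5⟩ := urysohn_aux hG
      (hA.union (lower_hull_closed_aux hG hS)) (hB.union (upper_hull_closed_aux hG hT)) hBu' hdis
    refine ⟨h, fun _ => ⟨h1, ⟨h2, h3, fun x hx => h4 x (Or.inl hx), fun x hx => h5 x (Or.inl hx)⟩,
      fun x hx => h5 x (Or.inr ⟨x, ⟨x, hx, rfl⟩, le_rfl⟩),
      fun x hx => h4 x (Or.inr ⟨x, ⟨x, hx, rfl⟩, le_rfl⟩)⟩⟩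
  choose h hh using key
  have hsum0 : ∀ x, 0 ≤ ∑ k ∈ Finset.range n, h k x := fun x =>
    Finset.sum_nonneg fun k hk => ((hh k (Finset.mem_range.1 hk)).2.1.2.1 x).1
  have hsum1 : ∀ x, ∑ k ∈ Finset.range n, h k x ≤ n := fun x => by
    have := Finset.sum_le_sum (s := Finset.range n) (f := fun k => h k x) (g := fun _ => (1 : ℝ))
      fun k hk => ((hh k (Finset.mem_range.1 hk)).2.1.2.1 x).2
    simpa using this
  refine ⟨fun x => (∑ k ∈ Finset.range n, h k x) / n, ?_, ⟨?_, ?_, ?_, ?_⟩, ?_⟩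
  · exact (continuous_finsetSum _ fun k hk => (hh k (Finset.mem_range.1 hk)).1).div_const _
  · intro x y hxy
    have := Finset.sum_le_sum (s := Finset.range n) (f := fun k => h k x) (g := fun k => h k y)
      fun k hk => (hh k (Finset.mem_range.1 hk)).2.1.1 hxy
    exact div_le_div_of_nonneg_right this hn'.le
  · intro x
    exact ⟨div_nonneg (hsum0 x) hn'.le, (div_le_one hn').2 (hsum1 x)⟩
  · intro x hx
    show (∑ k ∈ Finset.range n, h k x) / n = 0
    rw [Finset.sum_eq_zero fun k hk => (hh k (Finset.mem_range.1 hk)).2.1.2.2.1 x hx, zero_div]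
  · intro x hx
    show (∑ k ∈ Finset.range n, h k x) / n = 1
    rw [Finset.sum_congr rfl fun k hk => (hh k (Finset.mem_range.1 hk)).2.1.2.2.2 x hx]
    simp [hn'.ne']
  · intro x
    have hfx := hf01 x
    have hle : n * f x ≤ n := by nlinarith [hfx.2]
    have := (sum_aux (n * f x) (fun k => if k < n then h k x else 0) ?_ ?_ ?_ ?_ n).2 hle
    · rw [Finset.sum_congr rfl (g := fun k => h k x)
        (fun k hk => if_pos (Finset.mem_range.1 hk))] at this
      have e : (∑ k ∈ Finset.range n, h k x) / n - f x
          = (∑ k ∈ Finset.range n, h k x - n * f x) / n := by field_simp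
      show |(∑ k ∈ Finset.range n, h k x) / n - f x| ≤ 1 / n
      rw [e, abs_div, abs_of_pos hn']
      exact div_le_div_of_nonneg_right this hn'.le
    · intro k
      by_cases hk : k < n
      · simpa only [if_pos hk] using (hh k hk).2.1.2.1 x
      · simp [hk]
    · intro k hk
      have hkn : k < n := by
        have : (k : ℝ) < n := by linarith
        exact_mod_cast this
      simpa only [if_pos hkn] using (hh k hkn).2.2.1 x hk
    · intro k hk
      by_cases hkn : k < n
      · simpa only [if_pos hkn] using (hh k hkn).2.2.2 x hk
      · simp [hkn]
    · exact mul_nonneg hn'.le hfx.1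

lemma clamp_aux {a b c d e : ℝ} (h1 : |a - c| ≤ d) (h2 : |b - c| ≤ e) :
    |max (a - 2 * d) (min b (a + 2 * d)) - c| ≤ e := by
  rw [abs_le] at *
  constructor
  · have : c - e ≤ max (a - 2 * d) (min b (a + 2 * d)) :=
      le_max_of_le_right (le_min (by linarith) (by linarith))
    linarith
  · have : max (a - 2 * d) (min b (a + 2 * d)) ≤ c + e :=
      max_le (by linarith) ((min_le_left _ _).trans (by linarith))
    linarith

lemma compact_ext_aux {X : Type*} [TopologicalSpace X] [Preorder X] [CompactSpace X]
    (hG : IsClosed {p : X × X | p.1 ≤ p.2})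
    (K : Set X) (hK : IsCompact K) (A B : Set X)
    (hA : IsClosed A) (hAl : IsLowerSet A) (hB : IsClosed B) (hBu : IsUpperSet B)
    (hAB : A ∩ B = ∅) (f : K → ℝ) (hf01 : ∀ x, f x ∈ Icc (0 : ℝ) 1)
    (hfc : Continuous f) (hfm : Monotone f)
    (hfA : ∀ x : K, (x : X) ∈ A → f x = 0) (hfB : ∀ x : K, (x : X) ∈ B → f x = 1) :
    ∃ g : X → ℝ, Continuous g ∧ GoodAux A B g ∧ ∀ x : K, g x = f x := by
  let P : ℕ → C(X, ℝ) → Prop := fun n g => GoodAux A B g ∧ ∀ x : K, |g x - f x| ≤ 1 / 2 ^ n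
  have happ : ∀ n, ∃ g, P n g := by
    intro n
    obtain ⟨g, h1, h2, h3⟩ := approx_ext_aux hG K hK A B hA hAl hB hBu hAB f hf01 hfc hfm hfA hfB
      (2 ^ n) (by positivity)
    refine ⟨⟨g, h1⟩, h2, ?_⟩
    simpa using h3
  have step : ∀ n (g : C(X, ℝ)), P n g → ∃ g', P (n + 1) g' ∧ dist g g' ≤ 4 / 2 / 2 ^ n := by
    rintro n g ⟨⟨m1, m2, m3, m4⟩, m5⟩
    obtain ⟨b, ⟨b1, b2, b3, b4⟩, b5⟩ := happ (n + 1)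
    have hd : (0 : ℝ) < 1 / 2 ^ n := by positivity
    refine ⟨⟨fun x => max (g x - 2 * (1 / 2 ^ n)) (min (b x) (g x + 2 * (1 / 2 ^ n))),
      by fun_prop⟩, ⟨⟨?_, ?_, ?_, ?_⟩, ?_⟩, ?_⟩
    · intro x y hxy
      have h1 := m1 hxy
      have h2 := b1 hxy
      exact max_le_max (by linarith) (min_le_min h2 (by linarith))
    · intro x
      have h1 := m2 x
      have h2 := b2 x
      exact ⟨le_max_of_le_right (le_min h2.1 (by linarith [h1.1])),
        max_le (by linarith [h1.2]) ((min_le_left _ _).trans h2.2)⟩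
    · intro x hx
      show max (g x - 2 * (1 / 2 ^ n)) (min (b x) (g x + 2 * (1 / 2 ^ n))) = 0
      rw [m3 x hx, b3 x hx, min_eq_left (by linarith), max_eq_right (by linarith)]
    · intro x hx
      show max (g x - 2 * (1 / 2 ^ n)) (min (b x) (g x + 2 * (1 / 2 ^ n))) = 1
      rw [m4 x hx, b4 x hx, min_eq_left (by linarith), max_eq_right (by linarith)]
    · intro x
      exact clamp_aux (m5 x) (b5 x)
    · rw [ContinuousMap.dist_le (by positivity)]
      intro x
      show |g x - max (g x - 2 * (1 / 2 ^ n)) (min (b x) (g x + 2 * (1 / 2 ^ n)))| ≤ 4 / 2 / 2 ^ n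
      have e : (4 : ℝ) / 2 / 2 ^ n = 2 * (1 / 2 ^ n) := by ring
      rw [e, abs_le]
      constructor
      · have : max (g x - 2 * (1 / 2 ^ n)) (min (b x) (g x + 2 * (1 / 2 ^ n)))
          ≤ g x + 2 * (1 / 2 ^ n) := max_le (by linarith) (min_le_right _ _)
        linarith
      · have : g x - 2 * (1 / 2 ^ n) ≤
          max (g x - 2 * (1 / 2 ^ n)) (min (b x) (g x + 2 * (1 / 2 ^ n))) := le_max_left _ _
        linarith
  choose! nxt hnxt1 hnxt2 using step
  obtain ⟨g0, hg0⟩ := happ 0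
  let G : ℕ → C(X, ℝ) := fun n => Nat.rec g0 (fun n g => nxt n g) n
  have hGP : ∀ n, P n (G n) := by
    intro n
    induction n with
    | zero => exact hg0
    | succ n ih => exact hnxt1 n _ ih
  have hGd : ∀ n, dist (G n) (G (n + 1)) ≤ 4 / 2 / 2 ^ n := fun n => hnxt2 n _ (hGP n)
  obtain ⟨g, hg⟩ := cauchySeq_tendsto_of_complete (cauchySeq_of_le_geometric_two hGd)
  have hpt : ∀ x, Tendsto (fun n => G n x) atTop (𝓝 (g x)) := fun x =>
    ((continuous_eval_const (F := C(X, ℝ)) x).tendsto g).comp hg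
  refine ⟨g, g.continuous, ⟨?_, ?_, ?_, ?_⟩, ?_⟩
  · intro x y hxy
    exact le_of_tendsto_of_tendsto' (hpt x) (hpt y) fun n => (hGP n).1.1 hxy
  · intro x
    exact isClosed_Icc.mem_of_tendsto (hpt x) (Eventually.of_forall fun n => (hGP n).1.2.1 x)
  · intro x hx
    refine tendsto_nhds_unique (hpt x) ?_
    simp only [(hGP _).1.2.2.1 x hx, tendsto_const_nhds]
  · intro x hx
    refine tendsto_nhds_unique (hpt x) ?_
    simp only [(hGP _).1.2.2.2 x hx, tendsto_const_nhds]
  · intro x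
    refine tendsto_nhds_unique (hpt x) ?_
    rw [tendsto_iff_dist_tendsto_zero]
    refine squeeze_zero (fun _ => dist_nonneg) (fun n => (hGP n).2 x) ?_
    have := tendsto_pow_atTop_nhds_zero_of_lt_one (r := (1 / 2 : ℝ)) (by norm_num) (by norm_num)
    simpa using this


/-- Improved extension and separation result.  Let `E` be a `k_ω`-space with a preorder
whose graph is closed in `E × E`, let `K` be a (possibly empty) compact subset, `A` a
closed decreasing set and `B` a closed increasing set with `A ∩ B = ∅`, and let
`f : K → [0,1]` be continuous and isotone with `A ∩ K ⊆ f⁻¹(0)` and `B ∩ K ⊆ f⁻¹(1)`.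
Then `f` extends to a continuous isotone `F : E → [0,1]` with `A ⊆ F⁻¹(0)` and
`B ⊆ F⁻¹(1)`. -/
theorem extension_separation_kOmega
    {E : Type*} [TopologicalSpace E] [Preorder E]
    (hkω : IsKOmegaSpace E)
    (hG : IsClosed {p : E × E | p.1 ≤ p.2})
    (K : Set E) (hK : IsCompact K)
    (A B : Set E)
    (hA : IsClosed A) (hAl : IsLowerSet A)
    (hB : IsClosed B) (hBu : IsUpperSet B)
    (hAB : A ∩ B = ∅)
    (f : K → ℝ)
    (hf01 : ∀ x, f x ∈ Set.Icc (0 : ℝ) 1)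
    (hfc : Continuous f) (hfm : Monotone f)
    (hfA : ∀ x : K, (x : E) ∈ A → f x = 0)
    (hfB : ∀ x : K, (x : E) ∈ B → f x = 1) :
    ∃ F : E → ℝ, Continuous F ∧ Monotone F ∧ (∀ x, F x ∈ Set.Icc (0 : ℝ) 1) ∧
      (∀ x : K, F x = f x) ∧ (∀ x ∈ A, F x = 0) ∧ (∀ x ∈ B, F x = 1) := by
  obtain ⟨C, hC, hCu, hCo⟩ := hkω
  let L : ℕ → Set E := fun n => Nat.rec K (fun n S => S ∪ C n) n
  have hL0 : L 0 = K := rfl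
  have hLs : ∀ n, L (n + 1) = L n ∪ C n := fun n => rfl
  have hLc : ∀ n, IsCompact (L n) := by
    intro n
    induction n with
    | zero => exact hK
    | succ n ih => exact ih.union (hC n)
  have hLm : Monotone L := monotone_nat_of_le_succ fun n => by
    rw [hLs]; exact subset_union_left
  let Q : ℕ → (E → ℝ) → Prop := fun n g => ContinuousOn g (L n) ∧ MonotoneOn g (L n) ∧
    (∀ x ∈ L n, g x ∈ Icc (0 : ℝ) 1) ∧ (∀ x ∈ L n, x ∈ A → g x = 0) ∧
    (∀ x ∈ L n, x ∈ B → g x = 1)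
  classical
  have step : ∀ n g, Q n g → ∃ g', Q (n + 1) g' ∧ ∀ x ∈ L n, g' x = g x := by
    rintro n g ⟨q1, q2, q3, q4, q5⟩
    have : CompactSpace (L (n + 1)) := isCompact_iff_compactSpace.1 (hLc (n + 1))
    have hsub : L n ⊆ L (n + 1) := hLm n.le_succ
    have hK' : IsCompact (Subtype.val ⁻¹' L n : Set (L (n + 1))) := by
      rw [IsInducing.subtypeVal.isCompact_iff, Subtype.image_preimage_coe,
        inter_eq_right.2 hsub]
      exact hLc n
    have hG' : IsClosed {p : L (n + 1) × L (n + 1) | p.1 ≤ p.2} :=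
      IsClosed.preimage (continuous_subtype_val.prodMap continuous_subtype_val) hG
    obtain ⟨F, F1, ⟨F2, F3, F4, F5⟩, F6⟩ := compact_ext_aux (X := L (n + 1)) hG'
      (Subtype.val ⁻¹' L n) hK' (Subtype.val ⁻¹' A) (Subtype.val ⁻¹' B)
      (hA.preimage continuous_subtype_val) (fun a b hab ha => hAl hab ha)
      (hB.preimage continuous_subtype_val) (fun a b hab ha => hBu hab ha)
      (by rw [← preimage_inter, hAB, preimage_empty])
      (fun x => g x.1.1) (fun x => q3 _ x.2)
      (q1.comp_continuous
        (f := fun x : (Subtype.val ⁻¹' L n : Set (L (n + 1))) => (x.1.1 : E))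
        (by fun_prop) (fun x => x.2))
      (fun a b hab => q2 a.2 b.2 hab)
      (fun x hx => q4 _ x.2 hx) (fun x hx => q5 _ x.2 hx)
    let F' : E → ℝ := Function.extend Subtype.val F 0
    have hF' : ∀ x (h : x ∈ L (n + 1)), F' x = F ⟨x, h⟩ := fun x h =>
      Subtype.val_injective.extend_apply F 0 ⟨x, h⟩
    refine ⟨F', ⟨?_, ?_, ?_, ?_, ?_⟩, ?_⟩
    · rw [continuousOn_iff_continuous_domRestrict]
      have : (L (n + 1)).domRestrict F' = F := by
        funext x
        exact hF' x.1 x.2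
      rw [this]
      exact F1
    · intro x hx y hy hxy
      rw [hF' x hx, hF' y hy]
      exact F2 (show (⟨x, hx⟩ : L (n + 1)) ≤ ⟨y, hy⟩ from hxy)
    · intro x hx
      rw [hF' x hx]
      exact F3 _
    · intro x hx hxA
      rw [hF' x hx]
      exact F4 _ hxA
    · intro x hx hxB
      rw [hF' x hx]
      exact F5 _ hxB
    · intro x hx
      rw [hF' x (hsub hx)]
      exact F6 ⟨⟨x, hsub hx⟩, hx⟩
  choose! nxt hn1 hn2 using step
  let g0 : E → ℝ := fun x => if h : x ∈ K then f ⟨x, h⟩ else 0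
  have hg0 : ∀ x (h : x ∈ K), g0 x = f ⟨x, h⟩ := fun x h => dif_pos h
  have hQ0 : Q 0 g0 := by
    refine ⟨?_, ?_, ?_, ?_, ?_⟩
    · rw [continuousOn_iff_continuous_domRestrict]
      have : K.domRestrict g0 = f := by
        funext x
        exact hg0 x.1 x.2
      show Continuous (K.domRestrict g0)
      rw [this]
      exact hfc
    · intro x hx y hy hxy
      rw [hg0 x hx, hg0 y hy]
      exact hfm (show (⟨x, hx⟩ : K) ≤ ⟨y, hy⟩ from hxy)
    · intro x hx
      rw [hg0 x hx]
      exact hf01 _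
    · intro x hx hxA
      rw [hg0 x hx]
      exact hfA _ hxA
    · intro x hx hxB
      rw [hg0 x hx]
      exact hfB _ hxB
  let G : ℕ → E → ℝ := fun n => Nat.rec g0 (fun n g => nxt n g) n
  have hGQ : ∀ n, Q n (G n) := by
    intro n
    induction n with
    | zero => exact hQ0
    | succ n ih => exact hn1 n _ ih
  have hGs : ∀ n, ∀ x ∈ L n, G (n + 1) x = G n x := fun n => hn2 n _ (hGQ n)
  have hGle : ∀ m n, m ≤ n → ∀ x ∈ L m, G n x = G m x := by
    intro m n hmn
    induction n, hmn using Nat.le_induction with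
    | base => exact fun _ _ => rfl
    | succ n hmn ih => exact fun x hx => (hGs n x (hLm hmn hx)).trans (ih x hx)
  have hcov : ∀ x, ∃ n, x ∈ L n := by
    intro x
    have : x ∈ ⋃ n, C n := hCu ▸ mem_univ x
    obtain ⟨n, hn⟩ := mem_iUnion.1 this
    exact ⟨n + 1, Or.inr hn⟩
  choose N hN using hcov
  let F : E → ℝ := fun x => G (N x) x
  have hF : ∀ n, ∀ x ∈ L n, F x = G n x := by
    intro n x hx
    rcases le_total n (N x) with h | h
    · exact hGle n (N x) h x hx
    · exact (hGle (N x) n h x (hN x)).symm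
  refine ⟨F, ?_, ?_, ?_, ?_, ?_, ?_⟩
  · refine ⟨fun O hO => ?_⟩
    rw [hCo]
    intro n
    have hCL : C n ⊆ L (n + 1) := subset_union_right
    have hc : Continuous ((C n).domRestrict F) := by
      have : (C n).domRestrict F = (C n).domRestrict (G (n + 1)) := by
        funext x
        exact hF (n + 1) x.1 (hCL x.2)
      rw [this, ← continuousOn_iff_continuous_domRestrict]
      exact (hGQ (n + 1)).1.mono hCL
    exact hO.preimage hc
  · intro x y hxy
    have hx : x ∈ L (max (N x) (N y)) := hLm (le_max_left _ _) (hN x)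
    have hy : y ∈ L (max (N x) (N y)) := hLm (le_max_right _ _) (hN y)
    rw [hF _ x hx, hF _ y hy]
    exact (hGQ _).2.1 hx hy hxy
  · exact fun x => (hGQ _).2.2.1 x (hN x)
  · intro x
    rw [hF 0 x x.2]
    exact hg0 x.1 x.2
  · exact fun x hx => (hGQ _).2.2.2.1 x (hN x) hx
  · exact fun x hx => (hGQ _).2.2.2.2 x (hN x) hx
end

section
/- Let E be a topological space with preorder ≤, let ∼ be the equivalence relation 'x ≤ y and y ≤ x', and let E/∼ carry the quotient topology and the induced order [x] ≲ [y] iff x ≤ y. If E is compact and the graph of ≤ is closed in E × E, then E/∼ is compact and the graph of ≲ is closed in (E/∼) × (E/∼) (and ≲ is a partial order). If E is a k_ω-space and the graph of ≤ is closed, then E/∼ is a k_ω-space and the graph of ≲ is closed. -/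
/-- The quotient `E/∼` of a preordered space by the equivalence `x ∼ y ↔ x ≤ y ∧ y ≤ x`,
carrying the quotient topology. -/
def OrderQuotient (E : Type*) [Preorder E] : Type _ :=
  Quotient (AntisymmRel.setoid E (· ≤ ·))

instance (E : Type*) [Preorder E] [TopologicalSpace E] : TopologicalSpace (OrderQuotient E) :=
  instTopologicalSpaceQuotient

/-- The induced order on the quotient: `[x] ≲ [y]` iff `x ≤ y` for some representatives. -/
def quotLE {E : Type*} [Preorder E] (a b : OrderQuotient E) : Prop :=
  ∃ x y : E, a = Quotient.mk (AntisymmRel.setoid E (· ≤ ·)) x ∧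
    b = Quotient.mk (AntisymmRel.setoid E (· ≤ ·)) y ∧ x ≤ y

section Helpers

variable {E : Type*} [TopologicalSpace E] [Preorder E]

theorem isClosed_upHull (hG : IsClosed {p : E × E | p.1 ≤ p.2}) {A : Set E} (hA : IsCompact A) :
    IsClosed {z : E | ∃ a ∈ A, a ≤ z} := by
  rw [← isOpen_compl_iff, isOpen_iff_forall_mem_open]
  intro z hz
  obtain ⟨U, V, _, hV, hAU, hzV, hUV⟩ := generalized_tube_lemma hA (isCompact_singleton (x := z))
    hG.isOpen_compl (by
      rintro ⟨a, b⟩ ⟨ha, hb⟩ hab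
      obtain rfl : b = z := hb
      exact hz ⟨a, ha, hab⟩)
  refine ⟨V, ?_, hV, hzV rfl⟩
  rintro v hv ⟨a, ha, hav⟩
  exact hUV (Set.mk_mem_prod (hAU ha) hv) hav

theorem isClosed_downHull (hG : IsClosed {p : E × E | p.1 ≤ p.2}) {A : Set E} (hA : IsCompact A) :
    IsClosed {z : E | ∃ a ∈ A, z ≤ a} := by
  rw [← isOpen_compl_iff, isOpen_iff_forall_mem_open]
  intro z hz
  obtain ⟨U, V, hU, _, hzU, hAV, hUV⟩ := generalized_tube_lemma (isCompact_singleton (x := z)) hA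
    hG.isOpen_compl (by
      rintro ⟨b, a⟩ ⟨hb, ha⟩ hab
      obtain rfl : b = z := hb
      exact hz ⟨a, ha, hab⟩)
  refine ⟨U, ?_, hU, hzU rfl⟩
  rintro v hv ⟨a, ha, hav⟩
  exact hUV (Set.mk_mem_prod hv (hAV ha)) hav

/-- Separation inside a compact set by open upper and lower sets. -/
theorem sep_compact (hG : IsClosed {p : E × E | p.1 ≤ p.2}) {K A B : Set E}
    (hK : IsCompact K) (hA : IsCompact A) (hB : IsCompact B)
    (hAB : ∀ a ∈ A, ∀ b ∈ B, ¬ a ≤ b) :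
    ∃ U V : Set E, IsOpen U ∧ IsOpen V ∧ IsUpperSet U ∧ IsLowerSet V ∧ A ⊆ U ∧ B ⊆ V ∧
      ∀ z ∈ K, z ∈ U → z ∈ V → False := by
  have hP := hK.inter_right (isClosed_upHull hG hA)
  have hQ := hK.inter_right (isClosed_downHull hG hB)
  obtain ⟨U, V, hU, hV, hPU, hQV, hUV⟩ := generalized_tube_lemma hP hQ
    hG.isOpen_compl (by
      rintro ⟨p, q⟩ ⟨⟨_, a, ha, hap⟩, ⟨_, b, hb, hqb⟩⟩ hpq
      exact hAB a ha b hb (hap.trans (le_trans hpq hqb)))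
  refine ⟨{z | ∃ c ∈ K \ U, z ≤ c}ᶜ, {z | ∃ c ∈ K \ V, c ≤ z}ᶜ,
    (isClosed_downHull hG (hK.diff hU)).isOpen_compl,
    (isClosed_upHull hG (hK.diff hV)).isOpen_compl, ?_, ?_, ?_, ?_, ?_⟩
  · rintro s t hst hs ⟨c, hc, htc⟩
    exact hs ⟨c, hc, hst.trans htc⟩
  · rintro s t hst hs ⟨c, hc, htc⟩
    exact hs ⟨c, hc, htc.trans hst⟩
  · rintro a ha ⟨c, hc, hac⟩
    exact hc.2 (hPU ⟨hc.1, a, ha, hac⟩)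
  · rintro b hb ⟨c, hc, hac⟩
    exact hc.2 (hQV ⟨hc.1, b, hb, hac⟩)
  · intro z hz h1 h2
    have hzU : z ∈ U := by
      by_contra h
      exact h1 ⟨z, ⟨hz, h⟩, le_rfl⟩
    have hzV : z ∈ V := by
      by_contra h
      exact h2 ⟨z, ⟨hz, h⟩, le_rfl⟩
    exact hUV (Set.mk_mem_prod hzU hzV) (le_refl z)

theorem step_compact (hG : IsClosed {p : E × E | p.1 ≤ p.2}) {K A B : Set E}
    (hK : IsCompact K) (hA : IsCompact A) (hB : IsCompact B)
    (hAB : ∀ a ∈ A, ∀ b ∈ B, ¬ a ≤ b) :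
    ∃ A' B' : Set E, IsCompact A' ∧ IsCompact B' ∧ (∀ a ∈ A', ∀ b ∈ B', ¬ a ≤ b) ∧
      A' ⊆ K ∧ B' ⊆ K ∧
      (∃ U, IsOpen U ∧ IsUpperSet U ∧ A ⊆ U ∧ U ∩ K ⊆ A') ∧
      (∃ V, IsOpen V ∧ IsLowerSet V ∧ B ⊆ V ∧ V ∩ K ⊆ B') := by
  obtain ⟨U1, V1, hU1, hV1, uU1, lV1, hAU1, hBV1, h1⟩ := sep_compact hG hK hA hB hAB
  obtain ⟨U2, V2, hU2, hV2, uU2, lV2, hAU2, hBV2, h2⟩ := sep_compact hG hK hA (hK.diff hU1)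
    (fun a ha c hc hac => hc.2 (uU1 hac (hAU1 ha)))
  have hA' : IsCompact (K \ V2) := hK.diff hV2
  have hA'B : ∀ a ∈ K \ V2, ∀ b ∈ B, ¬ a ≤ b := by
    intro a ha b hb hab
    have : a ∈ U1 := by
      by_contra h
      exact ha.2 (hBV2 ⟨ha.1, h⟩)
    exact h1 a ha.1 this (lV1 hab (hBV1 hb))
  obtain ⟨U3, V3, hU3, hV3, uU3, lV3, hAU3, hBV3, h3⟩ := sep_compact hG hK hA' hB hA'B
  obtain ⟨U4, V4, hU4, hV4, uU4, lV4, hAU4, hBV4, h4⟩ := sep_compact hG hK (hK.diff hV3) hB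
    (fun c hc b hb hcb => hc.2 (lV3 hcb (hBV3 hb)))
  refine ⟨K \ V2, K \ U4, hA', hK.diff hU4, ?_, Set.sdiff_subset, Set.sdiff_subset,
    ⟨U2, hU2, uU2, hAU2, fun z hz => ⟨hz.2, fun h => h2 z hz.2 hz.1 h⟩⟩,
    ⟨V4, hV4, lV4, hBV4, fun z hz => ⟨hz.2, fun h => h4 z hz.2 h hz.1⟩⟩⟩
  intro a ha b hb hab
  have : b ∈ V3 := by
    by_contra h
    exact hb.2 (hAU4 ⟨hb.1, h⟩)
  exact h3 b hb.1 (uU3 hab (hAU3 ha)) this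

theorem isOpen_of_admissible {K C : ℕ → Set E} (hK : IsAdmissibleSeq K) (hKC : ∀ n, K n ⊆ C n)
    {O : Set E} (hO : ∀ n, ∀ p ∈ O, p ∈ C n → ∃ W, IsOpen W ∧ p ∈ W ∧ W ∩ C n ⊆ O) :
    IsOpen O := by
  rw [hK.2.2]
  intro n
  rw [isOpen_iff_forall_mem_open]
  rintro ⟨p, hp⟩ hpO
  obtain ⟨W, hW, hpW, hWO⟩ := hO n p hpO (hKC n hp)
  exact ⟨Subtype.val ⁻¹' W, fun q hq => hWO ⟨hq, hKC n q.2⟩, hW.preimage continuous_subtype_val,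
    hpW⟩

theorem sep_points (hG : IsClosed {p : E × E | p.1 ≤ p.2}) (hE : IsKOmegaSpace E) {x y : E}
    (hxy : ¬ x ≤ y) :
    ∃ U V : Set E, IsOpen U ∧ IsOpen V ∧ IsUpperSet U ∧ IsLowerSet V ∧ x ∈ U ∧ y ∈ V ∧
      ∀ u ∈ U, ∀ v ∈ V, ¬ u ≤ v := by
  obtain ⟨K, hK⟩ := hE
  let C : ℕ → Set E := fun n => {x, y} ∪ ⋃ i ∈ Set.Iic n, K i
  have hC : ∀ n, IsCompact (C n) := fun n =>
    ((Set.toFinite {x, y}).isCompact).union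
      ((Set.finite_Iic n).isCompact_biUnion fun i _ => hK.1 i)
  have hKC : ∀ n, K n ⊆ C n := fun n z hz =>
    Or.inr (Set.mem_biUnion (Set.mem_Iic.2 le_rfl) hz)
  have hCm : Monotone C := fun m n hmn =>
    Set.union_subset_union_right _ (Set.biUnion_subset_biUnion_left (Set.Iic_subset_Iic.2 hmn))
  have hcov : ∀ z, ∃ n, z ∈ C n := fun z => by
    have : z ∈ ⋃ n, K n := hK.2.1 ▸ Set.mem_univ z
    obtain ⟨n, hn⟩ := Set.mem_iUnion.1 this
    exact ⟨n, hKC n hn⟩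
  let S := {p : Set E × Set E // IsCompact p.1 ∧ IsCompact p.2 ∧ ∀ a ∈ p.1, ∀ b ∈ p.2, ¬ a ≤ b}
  have hstep : ∀ (n : ℕ) (s : S), ∃ t : S, t.1.1 ⊆ C n ∧ t.1.2 ⊆ C n ∧
      (∃ U, IsOpen U ∧ IsUpperSet U ∧ s.1.1 ⊆ U ∧ U ∩ C n ⊆ t.1.1) ∧
      (∃ V, IsOpen V ∧ IsLowerSet V ∧ s.1.2 ⊆ V ∧ V ∩ C n ⊆ t.1.2) := by
    rintro n ⟨⟨A, B⟩, hA, hB, hAB⟩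
    obtain ⟨A', B', hA', hB', hAB', h1, h2, h3, h4⟩ := step_compact hG (hC n) hA hB hAB
    exact ⟨⟨⟨A', B'⟩, hA', hB', hAB'⟩, h1, h2, h3, h4⟩
  choose f hfA hfB hfU hfV using hstep
  let s0 : S := ⟨({x}, {y}), isCompact_singleton, isCompact_singleton, by
    rintro a rfl b rfl
    exact hxy⟩
  let s : ℕ → S := fun n => Nat.rec s0 (fun n t => f n t) n
  have hs : ∀ n, s (n + 1) = f n (s n) := fun n => rfl
  have hxC : ∀ n, x ∈ C n := fun n => Or.inl (Or.inl rfl)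
  have hyC : ∀ n, y ∈ C n := fun n => Or.inl (Or.inr rfl)
  have hAC : ∀ n, (s n).1.1 ⊆ C n := by
    rintro (_ | n)
    · intro z hz
      rw [show z = x from hz]
      exact hxC 0
    · exact (hfA n (s n)).trans (hCm n.le_succ)
  have hBC : ∀ n, (s n).1.2 ⊆ C n := by
    rintro (_ | n)
    · intro z hz
      rw [show z = y from hz]
      exact hyC 0
    · exact (hfB n (s n)).trans (hCm n.le_succ)
  have hAm : Monotone fun n => (s n).1.1 := monotone_nat_of_le_succ fun n z hz => by
    obtain ⟨U, _, _, h1, h2⟩ := hfU n (s n)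
    exact h2 ⟨h1 hz, hAC n hz⟩
  have hBm : Monotone fun n => (s n).1.2 := monotone_nat_of_le_succ fun n z hz => by
    obtain ⟨U, _, _, h1, h2⟩ := hfV n (s n)
    exact h2 ⟨h1 hz, hBC n hz⟩
  refine ⟨⋃ n, (s n).1.1, ⋃ n, (s n).1.2, ?_, ?_, ?_, ?_, ?_, ?_, ?_⟩
  · refine isOpen_of_admissible hK hKC fun n p hp _ => ?_
    obtain ⟨m, hm⟩ := Set.mem_iUnion.1 hp
    obtain ⟨U, hU, _, h1, h2⟩ := hfU (max m n) (s (max m n))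
    exact ⟨U, hU, h1 (hAm (le_max_left m n) hm), fun z hz =>
      Set.mem_iUnion.2 ⟨max m n + 1, h2 ⟨hz.1, hCm (le_max_right m n) hz.2⟩⟩⟩
  · refine isOpen_of_admissible hK hKC fun n p hp _ => ?_
    obtain ⟨m, hm⟩ := Set.mem_iUnion.1 hp
    obtain ⟨U, hU, _, h1, h2⟩ := hfV (max m n) (s (max m n))
    exact ⟨U, hU, h1 (hBm (le_max_left m n) hm), fun z hz =>
      Set.mem_iUnion.2 ⟨max m n + 1, h2 ⟨hz.1, hCm (le_max_right m n) hz.2⟩⟩⟩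
  · intro p q hpq hp
    obtain ⟨m, hm⟩ := Set.mem_iUnion.1 hp
    obtain ⟨n, hn⟩ := hcov q
    obtain ⟨U, _, hU, h1, h2⟩ := hfU (max m n) (s (max m n))
    exact Set.mem_iUnion.2 ⟨max m n + 1,
      h2 ⟨hU hpq (h1 (hAm (le_max_left m n) hm)), hCm (le_max_right m n) hn⟩⟩
  · intro p q hpq hp
    obtain ⟨m, hm⟩ := Set.mem_iUnion.1 hp
    obtain ⟨n, hn⟩ := hcov q
    obtain ⟨U, _, hU, h1, h2⟩ := hfV (max m n) (s (max m n))
    exact Set.mem_iUnion.2 ⟨max m n + 1,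
      h2 ⟨hU hpq (h1 (hBm (le_max_left m n) hm)), hCm (le_max_right m n) hn⟩⟩
  · exact Set.mem_iUnion.2 ⟨0, rfl⟩
  · exact Set.mem_iUnion.2 ⟨0, rfl⟩
  · intro u hu v hv
    obtain ⟨m, hm⟩ := Set.mem_iUnion.1 hu
    obtain ⟨n, hn⟩ := Set.mem_iUnion.1 hv
    exact (s (max m n)).2.2.2 u (hAm (le_max_left m n) hm) v (hBm (le_max_right m n) hn)

/-- The projection to the order quotient. -/
def oqMk (x : E) : OrderQuotient E := Quotient.mk (AntisymmRel.setoid E (· ≤ ·)) x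

theorem oqMk_surj : Function.Surjective (oqMk : E → OrderQuotient E) := Quotient.mk_surjective

theorem oqMk_eq {x y : E} : oqMk x = oqMk y ↔ x ≤ y ∧ y ≤ x := Quotient.eq

theorem oqMk_quot : Topology.IsQuotientMap (oqMk : E → OrderQuotient E) :=
  isQuotientMap_quotient_mk'

theorem quotLE_mk {x y : E} : quotLE (oqMk x) (oqMk y) ↔ x ≤ y := by
  constructor
  · rintro ⟨a, b, ha, hb, hab⟩
    exact ((oqMk_eq.1 ha).1.trans hab).trans (oqMk_eq.1 hb).2
  · intro h
    exact ⟨x, y, rfl, rfl, h⟩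

theorem quot_order : (∀ a : OrderQuotient E, quotLE a a) ∧
      (∀ a b c : OrderQuotient E, quotLE a b → quotLE b c → quotLE a c) ∧
      (∀ a b : OrderQuotient E, quotLE a b → quotLE b a → a = b) := by
  refine ⟨fun a => ?_, fun a b c => ?_, fun a b => ?_⟩
  · obtain ⟨x, rfl⟩ := oqMk_surj a
    exact quotLE_mk.2 le_rfl
  · obtain ⟨x, rfl⟩ := oqMk_surj a
    obtain ⟨y, rfl⟩ := oqMk_surj b
    obtain ⟨z, rfl⟩ := oqMk_surj c
    simp only [quotLE_mk]
    exact le_trans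
  · obtain ⟨x, rfl⟩ := oqMk_surj a
    obtain ⟨y, rfl⟩ := oqMk_surj b
    simp only [quotLE_mk]
    exact fun h1 h2 => oqMk_eq.2 ⟨h1, h2⟩

theorem quot_closed (hG : IsClosed {p : E × E | p.1 ≤ p.2}) (hE : IsKOmegaSpace E) :
    IsClosed {p : OrderQuotient E × OrderQuotient E | quotLE p.1 p.2} := by
  rw [← isOpen_compl_iff, isOpen_iff_forall_mem_open]
  rintro ⟨a, b⟩ hab
  obtain ⟨x, rfl⟩ := oqMk_surj a
  obtain ⟨y, rfl⟩ := oqMk_surj b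
  have hxy : ¬ x ≤ y := fun h => hab (quotLE_mk.2 h)
  obtain ⟨U, V, hU, hV, uU, lV, hxU, hyV, hUV⟩ := sep_points hG hE hxy
  refine ⟨(oqMk '' U) ×ˢ (oqMk '' V), ?_, IsOpen.prod ?_ ?_, ⟨x, hxU, rfl⟩, ⟨y, hyV, rfl⟩⟩
  · rintro ⟨_, _⟩ ⟨⟨u, hu, rfl⟩, ⟨v, hv, rfl⟩⟩ h
    exact hUV u hu v hv (quotLE_mk.1 h)
  · rw [← oqMk_quot.isOpen_preimage]
    convert hU using 1
    ext z
    exact ⟨fun ⟨u, hu, h⟩ => uU (oqMk_eq.1 h).1 hu, fun h => ⟨z, h, rfl⟩⟩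
  · rw [← oqMk_quot.isOpen_preimage]
    convert hV using 1
    ext z
    exact ⟨fun ⟨u, hu, h⟩ => lV (oqMk_eq.1 h).2 hu, fun h => ⟨z, h, rfl⟩⟩

theorem quot_kOmega (hE : IsKOmegaSpace E) : IsKOmegaSpace (OrderQuotient E) := by
  obtain ⟨K, hK⟩ := hE
  refine ⟨fun n => oqMk '' K n, fun n => (hK.1 n).image oqMk_quot.continuous, ?_, fun O =>
    ⟨fun h n => h.preimage continuous_subtype_val, fun h => ?_⟩⟩
  · rw [← Set.image_iUnion, hK.2.1, Set.image_univ, oqMk_surj.range_eq]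
  · rw [← oqMk_quot.isOpen_preimage, hK.2.2]
    intro n
    have hc : Continuous (fun z : K n => (⟨oqMk z.1, z.1, z.2, rfl⟩ : oqMk '' K n)) :=
      (oqMk_quot.continuous.comp continuous_subtype_val).subtype_mk _
    exact (h n).preimage hc

theorem kOmega_of_compact [CompactSpace E] : IsKOmegaSpace E := by
  refine ⟨fun _ => Set.univ, fun _ => isCompact_univ, Set.iUnion_const _, fun O =>
    ⟨fun h n => h.preimage continuous_subtype_val, fun h => ?_⟩⟩
  have hc : Continuous (fun z : E => (⟨z, trivial⟩ : (Set.univ : Set E))) :=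
    continuous_id.subtype_mk _
  exact (h 0).preimage hc

end Helpers

/-- Let `E` be a topological preordered space with closed graph and let `E/∼` carry the
quotient topology and the induced order `≲`.  If `E` is compact then `E/∼` is compact,
the graph of `≲` is closed, and `≲` is a partial order.  If `E` is a `k_ω`-space then
`E/∼` is a `k_ω`-space and the graph of `≲` is closed. -/
theorem orderQuotient_closed_ordered
    (E : Type*) [TopologicalSpace E] [Preorder E]
    (hG : IsClosed {p : E × E | p.1 ≤ p.2}) :
    (CompactSpace E →
      CompactSpace (OrderQuotient E) ∧
      IsClosed {p : OrderQuotient E × OrderQuotient E | quotLE p.1 p.2} ∧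
      (∀ a : OrderQuotient E, quotLE a a) ∧
      (∀ a b c : OrderQuotient E, quotLE a b → quotLE b c → quotLE a c) ∧
      (∀ a b : OrderQuotient E, quotLE a b → quotLE b a → a = b)) ∧
    (IsKOmegaSpace E →
      IsKOmegaSpace (OrderQuotient E) ∧
      IsClosed {p : OrderQuotient E × OrderQuotient E | quotLE p.1 p.2} ∧
      (∀ a : OrderQuotient E, quotLE a a) ∧
      (∀ a b c : OrderQuotient E, quotLE a b → quotLE b c → quotLE a c) ∧
      (∀ a b : OrderQuotient E, quotLE a b → quotLE b a → a = b)) := by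
  refine ⟨fun hc => ⟨?_, quot_closed hG kOmega_of_compact, quot_order⟩,
    fun hk => ⟨quot_kOmega hk, quot_closed hG hk, quot_order⟩⟩
  exact oqMk_surj.compactSpace oqMk_quot.continuous
end

section
/- Let E be a topological preordered space, let A be a closed decreasing set and B a closed increasing set with A ∩ B = ∅. If there exist continuous isotone functions g, h : E → [0,1] with A = g⁻¹(0) and B = h⁻¹(1), then there exists a continuous isotone function f : E → [0,1] with A = f⁻¹(0) and B = f⁻¹(1) simultaneously. -/
/-- If `A` is a closed decreasing set and `B` a closed increasing set with
`A ∩ B = ∅`, and `A = g⁻¹(0)`, `B = h⁻¹(1)` for continuous isotone functions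
`g, h : E → [0,1]`, then there is a single continuous isotone `f : E → [0,1]` with
`A = f⁻¹(0)` and `B = f⁻¹(1)`. -/
theorem functionally_preordered_closed_pair
    {E : Type*} [TopologicalSpace E] [Preorder E]
    (A B : Set E)
    (hA : IsClosed A) (hAl : IsLowerSet A)
    (hB : IsClosed B) (hBu : IsUpperSet B)
    (hAB : A ∩ B = ∅)
    (g h : E → ℝ)
    (hg01 : ∀ x, g x ∈ Set.Icc (0 : ℝ) 1) (hgc : Continuous g) (hgm : Monotone g)
    (hh01 : ∀ x, h x ∈ Set.Icc (0 : ℝ) 1) (hhc : Continuous h) (hhm : Monotone h)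
    (hgA : A = g ⁻¹' {0}) (hhB : B = h ⁻¹' {1}) :
    ∃ f : E → ℝ, Continuous f ∧ Monotone f ∧ (∀ x, f x ∈ Set.Icc (0 : ℝ) 1) ∧
      A = f ⁻¹' {0} ∧ B = f ⁻¹' {1} := by
  have hpos : ∀ x, 0 < g x + (1 - h x) := by
    intro x
    have h1 := (hg01 x).1
    have h2 := (hh01 x).2
    by_contra hc
    have hg0 : g x = 0 := by linarith
    have hh1 : h x = 1 := by linarith
    have hx : x ∈ A ∩ B := ⟨by rw [hgA]; exact hg0, by rw [hhB]; exact hh1⟩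
    rw [hAB] at hx
    exact hx
  refine ⟨fun x => g x / (g x + (1 - h x)), ?_, ?_, ?_, ?_, ?_⟩
  · exact hgc.div (hgc.add (continuous_const.sub hhc)) (fun x => (hpos x).ne')
  · intro x y hxy
    show g x / (g x + (1 - h x)) ≤ g y / (g y + (1 - h y))
    rw [div_le_div_iff₀ (hpos x) (hpos y)]
    have h1 : g x * (1 - h y) ≤ g y * (1 - h x) :=
      mul_le_mul (hgm hxy) (by linarith [hhm hxy]) (by linarith [(hh01 y).2]) (hg01 y).1
    linarith
  · intro x
    refine ⟨div_nonneg (hg01 x).1 (hpos x).le, ?_⟩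
    rw [div_le_one (hpos x)]
    linarith [(hh01 x).2]
  · rw [hgA]
    ext x
    simp only [Set.mem_preimage, Set.mem_singleton_iff, div_eq_zero_iff, (hpos x).ne', or_false]
  · rw [hhB]
    ext x
    simp only [Set.mem_preimage, Set.mem_singleton_iff]
    rw [div_eq_one_iff_eq (hpos x).ne']
    constructor <;> intro hx <;> linarith
end

section
/- Every regularly preordered topological space whose underlying topological space is Lindelöf is a normally preordered space. -/
/-- A topological preordered space is *regularly preordered* if `Ici x` and `Iic x` are
closed for every `x`, every point outside a closed increasing set `B` can be separated
from `B` by disjoint open decreasing/increasing sets, and dually for closed decreasing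
sets. -/
def RegularlyPreordered (E : Type*) [TopologicalSpace E] [Preorder E] : Prop :=
  (∀ x : E, IsClosed (Set.Ici x) ∧ IsClosed (Set.Iic x)) ∧
  (∀ B : Set E, IsClosed B → IsUpperSet B → ∀ x ∉ B,
    ∃ U V : Set E, IsOpen U ∧ IsLowerSet U ∧ IsOpen V ∧ IsUpperSet V ∧
      x ∈ U ∧ B ⊆ V ∧ U ∩ V = ∅) ∧
  (∀ A : Set E, IsClosed A → IsLowerSet A → ∀ y ∉ A,
    ∃ U V : Set E, IsOpen U ∧ IsLowerSet U ∧ IsOpen V ∧ IsUpperSet V ∧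
      y ∈ V ∧ A ⊆ U ∧ U ∩ V = ∅)

theorem lindelof_sequence_aux {E : Type*} [TopologicalSpace E] [LindelofSpace E]
    (P : Set E × Set E → Prop) (p₀ : Set E × Set E) (h₀ : P p₀)
    (hP : ∀ p, P p → IsOpen p.1) (A : Set E) (hA : IsClosed A)
    (h : ∀ x ∈ A, ∃ p, P p ∧ x ∈ p.1) :
    ∃ f : ℕ → Set E × Set E, (∀ n, P (f n)) ∧ A ⊆ ⋃ n, (f n).1 := by
  obtain ⟨r, hr, hAr⟩ := hA.isLindelof.elim_countable_subcover
    (fun p : {p // P p} => p.1.1) (fun p => hP _ p.2) (by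
      intro x hx
      obtain ⟨p, hp, hxp⟩ := h x hx
      exact Set.mem_iUnion.2 ⟨⟨p, hp⟩, hxp⟩)
  obtain ⟨f, hf⟩ := (hr.insert ⟨p₀, h₀⟩).exists_eq_range (Set.insert_nonempty _ _)
  refine ⟨fun n => (f n).1, fun n => (f n).2, fun x hx => ?_⟩
  obtain ⟨p, hp, hxp⟩ := Set.mem_iUnion₂.1 (hAr hx)
  have : p ∈ Set.range f := hf ▸ Set.mem_insert_of_mem _ hp
  obtain ⟨n, rfl⟩ := this
  exact Set.mem_iUnion.2 ⟨n, hxp⟩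

/-- Every regularly preordered Lindelöf space is a normally preordered space. -/
theorem regularlyPreordered_lindelof_normallyPreordered
    (E : Type*) [TopologicalSpace E] [Preorder E] [LindelofSpace E]
    (hreg : RegularlyPreordered E) :
    NormallyPreordered E := by
  obtain ⟨hsc, h1, h2⟩ := hreg
  refine ⟨hsc, fun A B hA hAl hB hBu hAB => ?_⟩
  have hdis : ∀ x, x ∈ A → x ∉ B := fun x ha hb => by
    have : x ∈ A ∩ B := ⟨ha, hb⟩
    simp [hAB] at this
  obtain ⟨f, hf, hfA⟩ := lindelof_sequence_aux
    (fun p => IsOpen p.1 ∧ IsLowerSet p.1 ∧ IsOpen p.2 ∧ IsUpperSet p.2 ∧ B ⊆ p.2 ∧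
      p.1 ∩ p.2 = ∅) (∅, Set.univ)
    ⟨isOpen_empty, isLowerSet_empty, isOpen_univ, isUpperSet_univ, Set.subset_univ _, by simp⟩
    (fun p hp => hp.1) A hA (fun x hx => by
      obtain ⟨U, V, a, b, c, d, e, g, i⟩ := h1 B hB hBu x (hdis x hx)
      exact ⟨(U, V), ⟨a, b, c, d, g, i⟩, e⟩)
  obtain ⟨g, hg, hgB⟩ := lindelof_sequence_aux
    (fun p => IsOpen p.1 ∧ IsUpperSet p.1 ∧ IsOpen p.2 ∧ IsLowerSet p.2 ∧ A ⊆ p.2 ∧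
      p.1 ∩ p.2 = ∅) (∅, Set.univ)
    ⟨isOpen_empty, isUpperSet_empty, isOpen_univ, isLowerSet_univ, Set.subset_univ _, by simp⟩
    (fun p hp => hp.1) B hB (fun x hx => by
      obtain ⟨U, V, a, b, c, d, e, g, i⟩ := h2 A hA hAl x (fun h => hdis x h hx)
      exact ⟨(V, U), ⟨c, d, a, b, g, by rw [Set.inter_comm]; exact i⟩, e⟩)
  refine ⟨⋃ n, ((f n).1 ∩ ⋂ k ∈ Set.Iic n, (g k).2), ⋃ n, ((g n).1 ∩ ⋂ k ∈ Set.Iic n, (f k).2),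
    ?_, ?_, ?_, ?_, ?_, ?_, ?_⟩
  · exact isOpen_iUnion fun n => (hf n).1.inter
      ((Set.finite_Iic n).isOpen_biInter fun k _ => (hg k).2.2.1)
  · exact isLowerSet_iUnion fun n => (hf n).2.1.inter
      (isLowerSet_iInter₂ fun k _ => (hg k).2.2.2.1)
  · exact isOpen_iUnion fun n => (hg n).1.inter
      ((Set.finite_Iic n).isOpen_biInter fun k _ => (hf k).2.2.1)
  · exact isUpperSet_iUnion fun n => (hg n).2.1.inter
      (isUpperSet_iInter₂ fun k _ => (hf k).2.2.2.1)
  · intro x hx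
    obtain ⟨n, hn⟩ := Set.mem_iUnion.1 (hfA hx)
    exact Set.mem_iUnion.2 ⟨n, hn, Set.mem_iInter₂.2 fun k _ => (hg k).2.2.2.2.1 hx⟩
  · intro x hx
    obtain ⟨n, hn⟩ := Set.mem_iUnion.1 (hgB hx)
    exact Set.mem_iUnion.2 ⟨n, hn, Set.mem_iInter₂.2 fun k _ => (hf k).2.2.2.2.1 hx⟩
  · rw [Set.eq_empty_iff_forall_notMem]
    rintro x ⟨hxU, hxV⟩
    obtain ⟨n, hn, hn'⟩ := Set.mem_iUnion.1 hxU
    obtain ⟨m, hm, hm'⟩ := Set.mem_iUnion.1 hxV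
    rcases le_total m n with h | h
    · exact Set.eq_empty_iff_forall_notMem.1 (hg m).2.2.2.2.2 x
        ⟨hm, Set.mem_iInter₂.1 hn' m h⟩
    · exact Set.eq_empty_iff_forall_notMem.1 (hf n).2.2.2.2.2 x
        ⟨hn, Set.mem_iInter₂.1 hm' n h⟩
end

section
/- Every second countable regularly preordered topological space E is perfectly normally preordered: for every closed decreasing set A and closed increasing set B with A ∩ B = ∅ there exists a continuous isotone function f : E → [0,1] with A = f⁻¹(0) and B = f⁻¹(1). -/
theorem exists_nat_cover_aux {E : Type*} [TopologicalSpace E] [SecondCountableTopology E]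
    (S : Set E) (Q : Set E → Set E → Prop) (h0 : Q ∅ ∅)
    (h : ∀ x ∈ S, ∃ U C : Set E, IsOpen U ∧ x ∈ U ∧ Q U C) :
    ∃ U C : ℕ → Set E, (∀ n, IsOpen (U n) ∧ Q (U n) (C n)) ∧ ∀ x ∈ S, ∃ n, x ∈ U n := by
  rcases S.eq_empty_or_nonempty with rfl | ⟨x0, hx0⟩
  · exact ⟨fun _ => ∅, fun _ => ∅, fun _ => ⟨isOpen_empty, h0⟩, by simp⟩
  choose! U C hU hx hQ using h
  obtain ⟨T, hTS, hT, hcov⟩ := TopologicalSpace.isOpen_biUnion_countable S U hU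
  have hTne : T.Nonempty := by
    have : x0 ∈ ⋃ i ∈ T, U i := by
      rw [hcov]; exact Set.mem_biUnion hx0 (hx x0 hx0)
    simp only [Set.mem_iUnion] at this
    obtain ⟨i, hi, _⟩ := this
    exact ⟨i, hi⟩
  obtain ⟨e, he⟩ := hT.exists_eq_range hTne
  have heS : ∀ n, e n ∈ S := fun n => hTS (he ▸ Set.mem_range_self n)
  refine ⟨fun n => U (e n), fun n => C (e n), fun n => ⟨hU _ (heS n), hQ _ (heS n)⟩, ?_⟩
  intro x hxS
  have : x ∈ ⋃ i ∈ T, U i := by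
    rw [hcov]; exact Set.mem_biUnion hxS (hx x hxS)
  rw [he] at this
  simpa using this

theorem lower_cover_aux {E : Type*} [TopologicalSpace E] [Preorder E]
    [SecondCountableTopology E] (hreg : RegularlyPreordered E)
    (B : Set E) (hB : IsClosed B) (hBu : IsUpperSet B) :
    ∃ U C : ℕ → Set E, (∀ n, IsOpen (U n) ∧ IsLowerSet (U n) ∧ IsClosed (C n) ∧
      IsLowerSet (C n) ∧ U n ⊆ C n ∧ ∀ x ∈ C n, x ∉ B) ∧ ∀ x, x ∉ B → ∃ n, x ∈ U n := by
  refine exists_nat_cover_aux Bᶜ (fun U C => IsLowerSet U ∧ IsClosed C ∧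
      IsLowerSet C ∧ U ⊆ C ∧ ∀ x ∈ C, x ∉ B)
      ⟨isLowerSet_empty, isClosed_empty, isLowerSet_empty, subset_rfl, by simp⟩ ?_
  intro x hx
  obtain ⟨U, V, hU, hUl, hV, hVu, hxU, hBV, hUV⟩ := hreg.2.1 B hB hBu x hx
  exact ⟨U, Vᶜ, hU, hxU, hUl, hV.isClosed_compl, hVu.compl,
    fun y hy hyV => (hUV ▸ (⟨hy, hyV⟩ : y ∈ U ∩ V) : y ∈ (∅ : Set E)), fun y hy hyB => hy (hBV hyB)⟩

theorem upper_cover_aux {E : Type*} [TopologicalSpace E] [Preorder E]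
    [SecondCountableTopology E] (hreg : RegularlyPreordered E)
    (A : Set E) (hA : IsClosed A) (hAl : IsLowerSet A) :
    ∃ U C : ℕ → Set E, (∀ n, IsOpen (U n) ∧ IsUpperSet (U n) ∧ IsClosed (C n) ∧
      IsUpperSet (C n) ∧ U n ⊆ C n ∧ ∀ x ∈ C n, x ∉ A) ∧ ∀ x, x ∉ A → ∃ n, x ∈ U n := by
  refine exists_nat_cover_aux Aᶜ (fun U C => IsUpperSet U ∧ IsClosed C ∧
      IsUpperSet C ∧ U ⊆ C ∧ ∀ x ∈ C, x ∉ A)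
      ⟨isUpperSet_empty, isClosed_empty, isUpperSet_empty, subset_rfl, by simp⟩ ?_
  intro x hx
  obtain ⟨U, V, hU, hUl, hV, hVu, hxV, hAU, hUV⟩ := hreg.2.2 A hA hAl x hx
  exact ⟨V, Uᶜ, hV, hxV, hVu, hU.isClosed_compl, hUl.compl,
    fun y hy hyU => (hUV ▸ (⟨hyU, hy⟩ : y ∈ U ∩ V) : y ∈ (∅ : Set E)), fun y hy hyA => hy (hAU hyA)⟩

theorem normally_preordered_aux {E : Type*} [TopologicalSpace E] [Preorder E]
    [SecondCountableTopology E] (hreg : RegularlyPreordered E)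
    (A B : Set E) (hA : IsClosed A) (hAl : IsLowerSet A)
    (hB : IsClosed B) (hBu : IsUpperSet B) (hAB : ∀ x ∈ A, x ∉ B) :
    ∃ U V : Set E, IsOpen U ∧ IsLowerSet U ∧ IsOpen V ∧ IsUpperSet V ∧
      A ⊆ U ∧ B ⊆ V ∧ ∀ x ∈ U, x ∉ V := by
  obtain ⟨U, C, hUC, hcU⟩ := lower_cover_aux hreg B hB hBu
  obtain ⟨W, F, hWF, hcW⟩ := upper_cover_aux hreg A hA hAl
  refine ⟨⋃ n, (U n ∩ ⋂ k ∈ Set.Iic n, (F k)ᶜ), ⋃ n, (W n ∩ ⋂ k ∈ Set.Iic n, (C k)ᶜ),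
    ?_, ?_, ?_, ?_, ?_, ?_, ?_⟩
  · exact isOpen_iUnion fun n => (hUC n).1.inter
      ((Set.finite_Iic n).isOpen_biInter fun k _ => (hWF k).2.2.1.isOpen_compl)
  · exact isLowerSet_iUnion fun n => (hUC n).2.1.inter
      (isLowerSet_iInter₂ fun k _ => (hWF k).2.2.2.1.compl)
  · exact isOpen_iUnion fun n => (hWF n).1.inter
      ((Set.finite_Iic n).isOpen_biInter fun k _ => (hUC k).2.2.1.isOpen_compl)
  · exact isUpperSet_iUnion fun n => (hWF n).2.1.inter
      (isUpperSet_iInter₂ fun k _ => (hUC k).2.2.2.1.compl)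
  · intro x hx
    obtain ⟨n, hn⟩ := hcU x (hAB x hx)
    exact Set.mem_iUnion.2 ⟨n, hn, Set.mem_iInter₂.2 fun k _ hk => (hWF k).2.2.2.2.2 x hk hx⟩
  · intro x hx
    obtain ⟨n, hn⟩ := hcW x (fun h => hAB x h hx)
    exact Set.mem_iUnion.2 ⟨n, hn, Set.mem_iInter₂.2 fun k _ hk => (hUC k).2.2.2.2.2 x hk hx⟩
  · intro x hx hx'
    obtain ⟨n, hn, hn'⟩ := Set.mem_iUnion.1 hx
    obtain ⟨m, hm, hm'⟩ := Set.mem_iUnion.1 hx'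
    rw [Set.mem_iInter₂] at hn' hm'
    rcases le_total n m with h | h
    · exact hm' n h ((hUC n).2.2.2.2.1 hn)
    · exact hn' m h ((hWF m).2.2.2.2.1 hm)

theorem approx_monotone_aux {E : Type*} [TopologicalSpace E] [Preorder E]
    {P : Set E → Set E → Prop} (hP : ∀ c u, P c u → IsLowerSet u) (n : ℕ) :
    ∀ c : Urysohns.CU P, Monotone (c.approx n) := by
  induction n with
  | zero =>
    intro c x y hxy
    simp only [Urysohns.CU.approx]
    have := hP _ _ c.P_C_U
    by_cases hx : x ∈ c.U
    · rw [Set.indicator_of_notMem (by simpa using hx)]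
      exact Set.indicator_nonneg (fun _ _ => zero_le_one) _
    · have hy : y ∉ c.U := fun h => hx (this hxy h)
      rw [Set.indicator_of_mem (by simpa using hx), Set.indicator_of_mem (by simpa using hy)]
      simp
  | succ n ih =>
    intro c x y hxy
    simp only [Urysohns.CU.approx]
    exact midpoint_le_midpoint (ih _ hxy) (ih _ hxy)

theorem monotone_urysohn_aux {E : Type*} [TopologicalSpace E] [Preorder E]
    [SecondCountableTopology E] (hreg : RegularlyPreordered E)
    (A B : Set E) (hA : IsClosed A) (hAl : IsLowerSet A)
    (hB : IsClosed B) (hBu : IsUpperSet B) (hAB : ∀ x ∈ A, x ∉ B) :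
    ∃ f : E → ℝ, Continuous f ∧ Monotone f ∧ (∀ x, f x ∈ Set.Icc (0 : ℝ) 1) ∧
      (∀ x ∈ A, f x = 0) ∧ (∀ x ∈ B, f x = 1) := by
  let P : Set E → Set E → Prop := fun c u =>
    IsLowerSet u ∧ ∃ d, IsClosed d ∧ IsLowerSet d ∧ c ⊆ d ∧ d ⊆ u
  let c : Urysohns.CU P :=
  { C := A
    U := Bᶜ
    P_C_U := ⟨hBu.compl, A, hA, hAl, subset_rfl, hAB⟩
    closed_C := hA
    open_U := hB.isOpen_compl
    subset := hAB
    hP := by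
      rintro c u - ⟨hul, d, hd, hdl, hcd, hdu⟩ hu -
      obtain ⟨U, V, hU, hUl, hV, hVu, hdU, huV, hUV⟩ :=
        normally_preordered_aux hreg d uᶜ hd hdl hu.isClosed_compl hul.compl
          (fun x hx h => h (hdu hx))
      have hVu' : Vᶜ ⊆ u := Set.compl_subset_comm.1 huV
      have hcl : closure U ⊆ Vᶜ := closure_minimal hUV hV.isClosed_compl
      exact ⟨U, hU, hcd.trans hdU, hcl.trans hVu', ⟨hUl, d, hd, hdl, hcd, hdU⟩,
        hul, Vᶜ, hV.isClosed_compl, hVu.compl, hcl, hVu'⟩ }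
  refine ⟨c.lim, c.continuous_lim, ?_, c.lim_mem_Icc, fun x hx => c.lim_of_mem_C x hx,
    fun x hx => c.lim_of_notMem_U x fun h => h hx⟩
  intro x y hxy
  exact le_of_tendsto_of_tendsto' (c.tendsto_approx_atTop x) (c.tendsto_approx_atTop y)
    fun n => approx_monotone_aux (fun _ _ h => h.1) n c hxy

/-- Every second countable regularly preordered space is perfectly normally
preordered: disjoint closed decreasing/increasing sets `A`, `B` are the exact zero-set
and one-set of a continuous isotone function `f : E → [0,1]`. -/
theorem secondCountable_regularlyPreordered_perfectlyNormallyPreordered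
    (E : Type*) [TopologicalSpace E] [Preorder E]
    [SecondCountableTopology E]
    (hreg : RegularlyPreordered E)
    (A B : Set E)
    (hA : IsClosed A) (hAl : IsLowerSet A)
    (hB : IsClosed B) (hBu : IsUpperSet B)
    (hAB : A ∩ B = ∅) :
    ∃ f : E → ℝ, Continuous f ∧ Monotone f ∧ (∀ x, f x ∈ Set.Icc (0 : ℝ) 1) ∧
      A = f ⁻¹' {0} ∧ B = f ⁻¹' {1} := by
  have hAB' : ∀ x ∈ A, x ∉ B := fun x hx hx' => (hAB ▸ (⟨hx, hx'⟩ : x ∈ A ∩ B) : x ∈ (∅ : Set E))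
  obtain ⟨U, C, hUC, hcU⟩ := lower_cover_aux hreg B hB hBu
  obtain ⟨W, F, hWF, hcW⟩ := upper_cover_aux hreg A hA hAl
  have h1 : ∀ n, ∃ f : E → ℝ, Continuous f ∧ Monotone f ∧ (∀ x, f x ∈ Set.Icc (0 : ℝ) 1) ∧
      (∀ x ∈ A ∪ C n, f x = 0) ∧ (∀ x ∈ B, f x = 1) := fun n =>
    monotone_urysohn_aux hreg _ _ (hA.union (hUC n).2.2.1) (hAl.union (hUC n).2.2.2.1) hB hBu
      (fun x hx => hx.elim (hAB' x) ((hUC n).2.2.2.2.2 x))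
  have h2 : ∀ n, ∃ f : E → ℝ, Continuous f ∧ Monotone f ∧ (∀ x, f x ∈ Set.Icc (0 : ℝ) 1) ∧
      (∀ x ∈ A, f x = 0) ∧ (∀ x ∈ B ∪ F n, f x = 1) := fun n =>
    monotone_urysohn_aux hreg _ _ hA hAl (hB.union (hWF n).2.2.1) (hBu.union (hWF n).2.2.2.1)
      (fun x hx h => h.elim (hAB' x hx) (fun h => (hWF n).2.2.2.2.2 x h hx))
  choose p hpc hpm hpI hp0 hp1 using h1
  choose q hqc hqm hqI hq0 hq1 using h2
  let w : ℕ → ℝ := fun n => (1 / 2) / 2 ^ n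
  have hw : HasSum w 1 := hasSum_geometric_two' 1
  have hwpos : ∀ n, 0 < w n := fun n => by positivity
  let h : ℕ → E → ℝ := fun n x => (p n x + q n x) / 2
  have hh0 : ∀ n x, 0 ≤ h n x := fun n x => by
    have := (hpI n x).1; have := (hqI n x).1; simp only [h]; linarith
  have hh1 : ∀ n x, h n x ≤ 1 := fun n x => by
    have := (hpI n x).2; have := (hqI n x).2; simp only [h]; linarith
  have hle : ∀ n x, w n * h n x ≤ w n := fun n x =>
    mul_le_of_le_one_right (hwpos n).le (hh1 n x)
  have hnn : ∀ n x, 0 ≤ w n * h n x := fun n x => mul_nonneg (hwpos n).le (hh0 n x)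
  have hs : ∀ x, Summable fun n => w n * h n x := fun x =>
    Summable.of_nonneg_of_le (fun n => hnn n x) (fun n => hle n x) hw.summable
  refine ⟨fun x => ∑' n, w n * h n x, ?_, ?_, ?_, ?_, ?_⟩
  · refine continuous_tsum (u := w) ?_ hw.summable ?_
    · intro n
      have := hpc n
      have := hqc n
      simp only [h]
      fun_prop
    · intro n x
      rw [Real.norm_of_nonneg (hnn n x)]
      exact hle n x
  · intro x y hxy
    refine (hs x).tsum_le_tsum (fun n => ?_) (hs y)
    refine mul_le_mul_of_nonneg_left ?_ (hwpos n).le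
    have := hpm n hxy; have := hqm n hxy; simp only [h]; linarith
  · intro x
    refine ⟨tsum_nonneg fun n => hnn n x, ?_⟩
    rw [← hw.tsum_eq]
    exact (hs x).tsum_le_tsum (fun n => hle n x) hw.summable
  · ext x
    simp only [Set.mem_preimage, Set.mem_singleton_iff]
    constructor
    · intro hx
      have : ∀ n, w n * h n x = 0 := fun n => by
        simp only [h]; rw [hp0 n x (Or.inl hx), hq0 n x hx]; simp
      simp [this]
    · intro hx
      by_contra hxA
      obtain ⟨n, hn⟩ := hcW x hxA
      have hpos : 0 < w n * h n x := by
        refine mul_pos (hwpos n) ?_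
        have := hq1 n x (Or.inr ((hWF n).2.2.2.2.1 hn))
        have := (hpI n x).1
        simp only [h]; linarith
      exact ((hs x).tsum_pos (fun n => hnn n x) n hpos).ne' hx
  · ext x
    simp only [Set.mem_preimage, Set.mem_singleton_iff]
    constructor
    · intro hx
      have : ∀ n, w n * h n x = w n := fun n => by
        simp only [h]; rw [hp1 n x hx, hq1 n x (Or.inl hx)]; norm_num
      simp only [this]
      exact hw.tsum_eq
    · intro hx
      by_contra hxB
      obtain ⟨n, hn⟩ := hcU x hxB
      have hlt : w n * h n x < w n := by
        refine mul_lt_of_lt_one_right (hwpos n) ?_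
        have := hp0 n x (Or.inr ((hUC n).2.2.2.2.1 hn))
        have := (hqI n x).2
        simp only [h]; linarith
      have := Summable.tsum_lt_tsum (fun n => hle n x) hlt (hs x) hw.summable
      rw [hw.tsum_eq] at this
      exact this.ne hx
end

section
/- Let E be a topological preordered space. If there is a countable family of continuous isotone functions g_k : E → [0,1], k ≥ 1, representing the preorder (i.e. x ≤ y if and only if g_k(x) ≤ g_k(y) for all k), then there is a countable family of continuous utility functions f_k : E → [0,1], k ≥ 1, representing the preorder (i.e. x ≤ y if and only if f_k(x) ≤ f_k(y) for all k). -/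
/-- A *utility* on a preordered space is an isotone function `f` such that
`x ∼ y` implies `f x = f y` and `x < y` (i.e. `x ≤ y` and `¬ y ≤ x`) implies
`f x < f y`. -/
def IsUtility {E : Type*} [Preorder E] (f : E → ℝ) : Prop :=
  Monotone f ∧ (∀ x y : E, x ≤ y → y ≤ x → f x = f y) ∧
    (∀ x y : E, x ≤ y → ¬ y ≤ x → f x < f y)

/-- If a topological preordered space admits a countable representation of its preorder
by continuous isotone functions with values in `[0,1]`, then it admits a countable
representation by continuous utility functions with values in `[0,1]`. -/
theorem countable_utility_representation_of_isotone_representation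
    {E : Type*} [TopologicalSpace E] [Preorder E]
    (g : ℕ → E → ℝ)
    (hgc : ∀ k, Continuous (g k))
    (hgm : ∀ k, Monotone (g k))
    (hg01 : ∀ k x, g k x ∈ Set.Icc (0 : ℝ) 1)
    (hgrep : ∀ x y : E, x ≤ y ↔ ∀ k, g k x ≤ g k y) :
    ∃ f : ℕ → E → ℝ,
      (∀ k, Continuous (f k)) ∧ (∀ k, IsUtility (f k)) ∧
      (∀ k x, f k x ∈ Set.Icc (0 : ℝ) 1) ∧
      (∀ x y : E, x ≤ y ↔ ∀ k, f k x ≤ f k y) := by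
  have hs0 : Summable (fun k : ℕ => (1 : ℝ) / 2 / 2 ^ k) := summable_geometric_two' 1
  have ht0 : ∑' k : ℕ, (1 : ℝ) / 2 / 2 ^ k = 1 := tsum_geometric_two' 1
  have hpos : ∀ k : ℕ, (0 : ℝ) < 1 / 2 / 2 ^ k := fun k => by positivity
  have hle : ∀ (k : ℕ) (x : E), (1 : ℝ) / 2 / 2 ^ k * g k x ≤ 1 / 2 / 2 ^ k := fun k x =>
    mul_le_of_le_one_right (hpos k).le (hg01 k x).2
  have hnn : ∀ (k : ℕ) (x : E), (0 : ℝ) ≤ 1 / 2 / 2 ^ k * g k x := fun k x =>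
    mul_nonneg (hpos k).le (hg01 k x).1
  have hs : ∀ x : E, Summable (fun k : ℕ => (1 : ℝ) / 2 / 2 ^ k * g k x) := fun x =>
    Summable.of_nonneg_of_le (fun k => hnn k x) (fun k => hle k x) hs0
  obtain ⟨u, hu⟩ : ∃ u : E → ℝ, u = fun x => ∑' k : ℕ, (1 : ℝ) / 2 / 2 ^ k * g k x := ⟨_, rfl⟩
  have huc : Continuous u := by
    rw [hu]
    refine continuous_tsum (fun k => continuous_const.mul (hgc k)) hs0 (fun k x => ?_)
    rw [Real.norm_of_nonneg (hnn k x)]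
    exact hle k x
  have hum : Monotone u := by
    intro x y hxy
    rw [hu]
    exact (hs x).tsum_le_tsum (fun k => mul_le_mul_of_nonneg_left (hgm k hxy) (hpos k).le) (hs y)
  have hus : ∀ x y : E, x ≤ y → ¬ y ≤ x → u x < u y := by
    intro x y hxy hyx
    rw [hgrep y x] at hyx
    push Not at hyx
    obtain ⟨k, hk⟩ := hyx
    rw [hu]
    exact Summable.tsum_lt_tsum (i := k)
      (fun k => mul_le_mul_of_nonneg_left (hgm k hxy) (hpos k).le)
      (mul_lt_mul_of_pos_left hk (hpos k)) (hs x) (hs y)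
  have hu0 : ∀ x, 0 ≤ u x := fun x => by rw [hu]; exact tsum_nonneg (fun k => hnn k x)
  have hu1 : ∀ x, u x ≤ 1 := fun x => by
    rw [hu]; exact ((hs x).tsum_le_tsum (fun k => hle k x) hs0).trans_eq ht0
  have he0 : ∀ n : ℕ, (0 : ℝ) < 1 / ((n : ℝ) + 1) := fun n => by positivity
  have he1 : ∀ n : ℕ, (0 : ℝ) ≤ 1 - 1 / ((n : ℝ) + 1) := fun n => by
    rw [sub_nonneg, div_le_one (by positivity)]
    have : (0 : ℝ) ≤ n := n.cast_nonneg
    linarith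
  obtain ⟨F, hF⟩ : ∃ F : ℕ → ℕ → E → ℝ, F = fun (k n : ℕ) (x : E) =>
    (1 - 1 / ((n : ℝ) + 1)) * g k x + 1 / ((n : ℝ) + 1) * u x := ⟨_, rfl⟩
  have hFm : ∀ k n, Monotone (F k n) := by
    intro k n x y hxy
    rw [hF]
    exact add_le_add (mul_le_mul_of_nonneg_left (hgm k hxy) (he1 n))
      (mul_le_mul_of_nonneg_left (hum hxy) (he0 n).le)
  have hlim : ∀ k x, Filter.Tendsto (fun n => F k n x) Filter.atTop (nhds (g k x)) := by
    intro k x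
    have h := tendsto_one_div_add_atTop_nhds_zero_nat (𝕜 := ℝ)
    have h2 := ((h.const_sub 1).mul_const (g k x)).add (h.mul_const (u x))
    rw [hF]
    simpa using h2
  refine ⟨fun m => F m.unpair.1 m.unpair.2, fun m => ?_, fun m => ⟨hFm _ _, ?_, ?_⟩,
    fun m x => ?_, fun x y => ⟨fun h m => hFm _ _ h, fun h => ?_⟩⟩
  · rw [hF]
    exact (continuous_const.mul (hgc _)).add (continuous_const.mul huc)
  · exact fun x y h h' => le_antisymm (hFm _ _ h) (hFm _ _ h')
  · intro x y h h'
    rw [hF]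
    exact add_lt_add_of_le_of_lt (mul_le_mul_of_nonneg_left (hgm _ h) (he1 _))
      (mul_lt_mul_of_pos_left (hus x y h h') (he0 _))
  · rw [hF]
    refine ⟨add_nonneg (mul_nonneg (he1 _) (hg01 _ x).1) (mul_nonneg (he0 _).le (hu0 x)), ?_⟩
    have h1 := mul_le_of_le_one_right (he1 m.unpair.2) (hg01 m.unpair.1 x).2
    have h2 := mul_le_of_le_one_right (he0 m.unpair.2).le (hu1 x)
    show _ + _ ≤ (1 : ℝ)
    linarith
  · rw [hgrep]
    intro k
    refine le_of_tendsto_of_tendsto' (hlim k x) (hlim k y) (fun n => ?_)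
    simpa using h (Nat.pair k n)
end

section
/- Every second countable regularly preordered topological space E admits a countable continuous utility representation: there exists a countable family of continuous utility functions f_k : E → [0,1], k ≥ 1, such that x ≤ y if and only if f_k(x) ≤ f_k(y) for all k ≥ 1. -/
namespace RegPre

open Set TopologicalSpace

theorem seq_cover {E : Type*} [TopologicalSpace E] [SecondCountableTopology E] {A : Set E}
    (Q : Set E → Set E → Prop) (hQ0 : Q ∅ ∅) (hQ : ∀ U D, Q U D → IsOpen U)
    (h : ∀ x ∈ A, ∃ U D, Q U D ∧ x ∈ U) :
    ∃ U D : ℕ → Set E, (∀ n, Q (U n) (D n)) ∧ ∀ x ∈ A, ∃ n, x ∈ U n := by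
  let ι := {p : Set E × Set E // Q p.1 p.2}
  obtain ⟨T, hTc, hT⟩ := isOpen_iUnion_countable (fun i : ι => i.1.1)
    (fun i => hQ _ _ i.2)
  obtain ⟨e, he⟩ := (hTc.insert (⟨(∅, ∅), hQ0⟩ : ι)).exists_eq_range (insert_nonempty _ _)
  refine ⟨fun n => (e n).1.1, fun n => (e n).1.2, fun n => (e n).2, fun x hx => ?_⟩
  obtain ⟨U, D, hUD, hxU⟩ := h x hx
  have : x ∈ ⋃ i ∈ T, i.1.1 := by
    rw [hT]
    exact mem_iUnion.2 ⟨⟨(U, D), hUD⟩, hxU⟩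
  obtain ⟨i, hi, hxi⟩ := mem_iUnion₂.1 this
  have : i ∈ range e := he ▸ mem_insert_of_mem _ hi
  obtain ⟨n, rfl⟩ := this
  exact ⟨n, hxi⟩

variable {E : Type*} [TopologicalSpace E] [Preorder E]

/-- Regularly preordered and second countable implies normally preordered. -/
theorem normal [SecondCountableTopology E] (hreg : RegularlyPreordered E) {A B : Set E}
    (hA : IsClosed A) (hAl : IsLowerSet A) (hB : IsClosed B) (hBu : IsUpperSet B)
    (hAB : Disjoint A B) :
    ∃ U V : Set E, IsOpen U ∧ IsLowerSet U ∧ IsOpen V ∧ IsUpperSet V ∧ A ⊆ U ∧ B ⊆ V ∧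
      Disjoint U V := by
  obtain ⟨-, h1, h2⟩ := hreg
  obtain ⟨U, D, hUD, hAU⟩ := seq_cover (A := A)
    (fun U D => IsOpen U ∧ IsLowerSet U ∧ IsClosed D ∧ IsLowerSet D ∧ U ⊆ D ∧ Disjoint D B)
    ⟨isOpen_empty, isLowerSet_empty, isClosed_empty, isLowerSet_empty, subset_rfl, by simp⟩
    (fun U D h => h.1) (by
      intro x hx
      obtain ⟨U, V, hU, hUl, hV, hVu, hxU, hBV, hUV⟩ :=
        h1 B hB hBu x (disjoint_left.1 hAB hx)
      exact ⟨U, Vᶜ, ⟨hU, hUl, hV.isClosed_compl, hVu.compl,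
        subset_compl_iff_disjoint_right.2 (disjoint_iff_inter_eq_empty.2 hUV),
        disjoint_compl_left_iff_subset.2 hBV⟩, hxU⟩)
  obtain ⟨V, C, hVC, hBV⟩ := seq_cover (A := B)
    (fun V C => IsOpen V ∧ IsUpperSet V ∧ IsClosed C ∧ IsUpperSet C ∧ V ⊆ C ∧ Disjoint C A)
    ⟨isOpen_empty, isUpperSet_empty, isClosed_empty, isUpperSet_empty, subset_rfl, by simp⟩
    (fun U D h => h.1) (by
      intro x hx
      obtain ⟨U, V, hU, hUl, hV, hVu, hxV, hAU, hUV⟩ :=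
        h2 A hA hAl x (disjoint_right.1 hAB hx)
      exact ⟨V, Uᶜ, ⟨hV, hVu, hU.isClosed_compl, hUl.compl,
        subset_compl_iff_disjoint_left.2 (disjoint_iff_inter_eq_empty.2 hUV),
        disjoint_compl_left_iff_subset.2 hAU⟩, hxV⟩)
  refine ⟨⋃ n, U n ∩ (⋃ m ∈ Iic n, C m)ᶜ, ⋃ m, V m ∩ (⋃ n ∈ Iic m, D n)ᶜ, ?_, ?_, ?_, ?_,
    ?_, ?_, ?_⟩
  · exact isOpen_iUnion fun n => (hUD n).1.inter
      ((finite_Iic n).isClosed_biUnion fun m _ => (hVC m).2.2.1).isOpen_compl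
  · exact isLowerSet_iUnion fun n => (hUD n).2.1.inter
      (isUpperSet_iUnion₂ fun m _ => (hVC m).2.2.2.1).compl
  · exact isOpen_iUnion fun n => (hVC n).1.inter
      ((finite_Iic n).isClosed_biUnion fun m _ => (hUD m).2.2.1).isOpen_compl
  · exact isUpperSet_iUnion fun n => (hVC n).2.1.inter
      (isLowerSet_iUnion₂ fun m _ => (hUD m).2.2.2.1).compl
  · intro x hx
    obtain ⟨n, hn⟩ := hAU x hx
    refine mem_iUnion.2 ⟨n, hn, fun h => ?_⟩
    obtain ⟨m, -, hm⟩ := mem_iUnion₂.1 h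
    exact disjoint_left.1 (hVC m).2.2.2.2.2 hm hx
  · intro x hx
    obtain ⟨n, hn⟩ := hBV x hx
    refine mem_iUnion.2 ⟨n, hn, fun h => ?_⟩
    obtain ⟨m, -, hm⟩ := mem_iUnion₂.1 h
    exact disjoint_left.1 (hUD m).2.2.2.2.2 hm hx
  · rw [disjoint_left]
    intro x hx hy
    obtain ⟨n, hn, hn'⟩ := mem_iUnion.1 hx
    obtain ⟨m, hm, hm'⟩ := mem_iUnion.1 hy
    rcases le_total n m with h | h
    · exact hm' (mem_iUnion₂.2 ⟨n, h, (hUD n).2.2.2.2.1 hn⟩)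
    · exact hn' (mem_iUnion₂.2 ⟨m, h, (hVC m).2.2.2.2.1 hm⟩)

/-- The predicate on pairs used in the monotone Urysohn lemma. -/
def PP (c u : Set E) : Prop := IsLowerSet u ∧ ∃ K, IsClosed K ∧ IsLowerSet K ∧ c ⊆ K ∧ K ⊆ u

theorem approx_monotone (n : ℕ) (c : Urysohns.CU (PP (E := E))) : Monotone (c.approx n) := by
  induction n generalizing c with
  | zero =>
    intro x y hxy
    simp only [Urysohns.CU.approx]
    by_cases hx : x ∈ c.U
    · rw [indicator_of_notMem (by simpa using hx)]
      exact indicator_nonneg (fun _ _ => zero_le_one) _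
    · have hy : y ∉ c.U := fun hy => hx (c.P_C_U.1 hxy hy)
      rw [indicator_of_mem (by simpa using hx), indicator_of_mem (by simpa using hy)]
      simp
  | succ n ih =>
    intro x y hxy
    simp only [Urysohns.CU.approx]
    exact midpoint_le_midpoint (ih _ hxy) (ih _ hxy)

theorem lim_monotone (c : Urysohns.CU (PP (E := E))) : Monotone c.lim := fun x y hxy =>
  le_of_tendsto_of_tendsto' (c.tendsto_approx_atTop x) (c.tendsto_approx_atTop y)
    fun n => approx_monotone n c hxy

theorem urysohn [SecondCountableTopology E] (hreg : RegularlyPreordered E) {x y : E}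
    (hxy : ¬ x ≤ y) :
    ∃ f : E → ℝ, Continuous f ∧ Monotone f ∧ (∀ z, f z ∈ Icc (0 : ℝ) 1) ∧ f y < f x := by
  have hsub : Iic y ⊆ (Ici x)ᶜ := fun z hz hz' => hxy (le_trans hz' hz)
  let c : Urysohns.CU (PP (E := E)) :=
    { C := Iic y
      U := (Ici x)ᶜ
      P_C_U := ⟨(isUpperSet_Ici x).compl, Iic y, (hreg.1 y).2, isLowerSet_Iic y, subset_rfl, hsub⟩
      closed_C := (hreg.1 y).2
      open_U := (hreg.1 x).1.isOpen_compl
      subset := hsub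
      hP := by
        rintro c u - ⟨hu, K, hK, hKl, hcK, hKu⟩ huo -
        obtain ⟨U, V, hU, hUl, hV, hVu, hKU, huV, hUV⟩ := normal hreg hK hKl
          huo.isClosed_compl hu.compl (disjoint_compl_right_iff_subset.2 hKu)
        have hVc : closure U ⊆ Vᶜ := closure_minimal (subset_compl_iff_disjoint_right.2 hUV)
          hV.isClosed_compl
        have hVu' : Vᶜ ⊆ u := compl_subset_comm.1 huV
        exact ⟨U, hU, hcK.trans hKU, hVc.trans hVu', ⟨hUl, K, hK, hKl, hcK, hKU⟩,
          hu, Vᶜ, hV.isClosed_compl, hVu.compl, hVc, hVu'⟩ }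
  refine ⟨c.lim, c.continuous_lim, lim_monotone c, c.lim_mem_Icc, ?_⟩
  rw [c.lim_of_mem_C y (le_refl y), c.lim_of_notMem_U x (fun h => h (le_refl x))]
  exact zero_lt_one

/-- Countably many continuous isotone functions representing the preorder. -/
theorem countable_rep [SecondCountableTopology E] (hreg : RegularlyPreordered E) :
    ∃ g : ℕ → E → ℝ, (∀ k, Continuous (g k)) ∧ (∀ k, Monotone (g k)) ∧
      (∀ k x, g k x ∈ Icc (0 : ℝ) 1) ∧ ∀ x y, ¬ x ≤ y → ∃ k, g k y < g k x := by
  let ι := {f : E → ℝ // Continuous f ∧ Monotone f ∧ ∀ z, f z ∈ Icc (0 : ℝ) 1}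
  obtain ⟨T, hTc, hT⟩ := isOpen_iUnion_countable
    (fun i : ι => {p : E × E | i.1 p.2 < i.1 p.1})
    (fun i => isOpen_lt (i.2.1.comp continuous_snd) (i.2.1.comp continuous_fst))
  let i0 : ι := ⟨fun _ => 0, continuous_const, monotone_const, fun _ => by simp⟩
  obtain ⟨e, he⟩ := (hTc.insert i0).exists_eq_range (insert_nonempty _ _)
  refine ⟨fun n => (e n).1, fun n => (e n).2.1, fun n => (e n).2.2.1, fun n => (e n).2.2.2,
    fun x y hxy => ?_⟩
  obtain ⟨f, hf, hfm, hfI, hlt⟩ := urysohn hreg hxy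
  have : (x, y) ∈ ⋃ i ∈ T, {p : E × E | i.1 p.2 < i.1 p.1} := by
    rw [hT]
    exact mem_iUnion.2 ⟨⟨f, hf, hfm, hfI⟩, hlt⟩
  obtain ⟨i, hi, hxi⟩ := mem_iUnion₂.1 this
  have : i ∈ range e := he ▸ mem_insert_of_mem _ hi
  obtain ⟨n, rfl⟩ := this
  exact ⟨n, hxi⟩

/-- There is a continuous utility. -/
theorem exists_utility {g : ℕ → E → ℝ} (hc : ∀ k, Continuous (g k)) (hm : ∀ k, Monotone (g k))
    (hI : ∀ k x, g k x ∈ Icc (0 : ℝ) 1) (hr : ∀ x y, ¬ x ≤ y → ∃ k, g k y < g k x) :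
    ∃ f : E → ℝ, Continuous f ∧ Monotone f ∧ (∀ x, f x ∈ Icc (0 : ℝ) 1) ∧
      ∀ x y, x ≤ y → ¬ y ≤ x → f x < f y := by
  have hw : HasSum (fun n : ℕ => (1 / 2 : ℝ) ^ (n + 1)) 1 := by
    have := hasSum_geometric_two.mul_left (1 / 2 : ℝ)
    simpa [pow_succ'] using this
  have hle : ∀ n x, (1 / 2 : ℝ) ^ (n + 1) * g n x ≤ (1 / 2 : ℝ) ^ (n + 1) := fun n x =>
    mul_le_of_le_one_right (by positivity) (hI n x).2
  have h0 : ∀ n x, 0 ≤ (1 / 2 : ℝ) ^ (n + 1) * g n x := fun n x =>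
    mul_nonneg (by positivity) (hI n x).1
  have hs : ∀ x, Summable fun n : ℕ => (1 / 2 : ℝ) ^ (n + 1) * g n x := fun x =>
    Summable.of_nonneg_of_le (fun n => h0 n x) (fun n => hle n x) hw.summable
  have hmm : ∀ n x y, x ≤ y → (1 / 2 : ℝ) ^ (n + 1) * g n x ≤ (1 / 2 : ℝ) ^ (n + 1) * g n y :=
    fun n x y hxy => mul_le_mul_of_nonneg_left (hm n hxy) (by positivity)
  refine ⟨fun x => ∑' n, (1 / 2 : ℝ) ^ (n + 1) * g n x, ?_, ?_, ?_, ?_⟩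
  · refine continuous_tsum (fun n => continuous_const.mul (hc n)) hw.summable fun n x => ?_
    rw [Real.norm_of_nonneg (h0 n x)]
    exact hle n x
  · intro x y hxy
    exact (hs x).tsum_le_tsum (fun n => hmm n x y hxy) (hs y)
  · intro x
    refine ⟨tsum_nonneg fun n => h0 n x, ?_⟩
    exact ((hs x).tsum_le_tsum (fun n => hle n x) hw.summable).trans hw.tsum_eq.le
  · intro x y hxy hyx
    obtain ⟨k, hk⟩ := hr y x hyx
    exact Summable.tsum_lt_tsum (i := k) (fun n => hmm n x y hxy)
      (mul_lt_mul_of_pos_left hk (by positivity)) (hs x) (hs y)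

end RegPre

/-- Every second countable regularly preordered space admits a countable continuous
utility representation: there are continuous utility functions `f k : E → [0,1]` with
`x ≤ y ↔ ∀ k, f k x ≤ f k y`. -/
theorem secondCountable_regularlyPreordered_countable_utility_representation
    (E : Type*) [TopologicalSpace E] [Preorder E]
    [SecondCountableTopology E]
    (hreg : RegularlyPreordered E) :
    ∃ f : ℕ → E → ℝ,
      (∀ k, Continuous (f k)) ∧ (∀ k, IsUtility (f k)) ∧
      (∀ k x, f k x ∈ Set.Icc (0 : ℝ) 1) ∧
      (∀ x y : E, x ≤ y ↔ ∀ k, f k x ≤ f k y) := by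
  obtain ⟨g, hc, hm, hI, hr⟩ := RegPre.countable_rep hreg
  obtain ⟨f, fc, fm, fI, fr⟩ := RegPre.exists_utility hc hm hI hr
  have ht : ∀ n : ℕ, 0 < 1 / ((n : ℝ) + 1) ∧ 1 / ((n : ℝ) + 1) ≤ 1 := fun n =>
    ⟨Nat.one_div_pos_of_nat, by
      rw [div_le_one (by positivity)]
      have : (0 : ℝ) ≤ n := Nat.cast_nonneg n
      linarith⟩
  have key : ∀ k n : ℕ, ∀ x y, x ≤ y →
      (1 - 1 / ((n : ℝ) + 1)) * g k x ≤ (1 - 1 / ((n : ℝ) + 1)) * g k y := fun k n x y hxy =>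
    mul_le_mul_of_nonneg_left (hm k hxy) (by linarith [(ht n).2])
  let F : ℕ → ℕ → E → ℝ := fun k n x =>
    (1 - 1 / ((n : ℝ) + 1)) * g k x + 1 / ((n : ℝ) + 1) * f x
  have hF : ∀ k n, Monotone (F k n) := fun k n x y hxy =>
    add_le_add (key k n x y hxy) (mul_le_mul_of_nonneg_left (fm hxy) (ht n).1.le)
  refine ⟨fun j => F j.unpair.1 j.unpair.2, fun j => ?_, fun j => ⟨hF _ _, ?_, ?_⟩, ?_, ?_⟩
  · exact (continuous_const.mul (hc _)).add (continuous_const.mul fc)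
  · exact fun x y hxy hyx => le_antisymm (hF _ _ hxy) (hF _ _ hyx)
  · exact fun x y hxy hyx => add_lt_add_of_le_of_lt (key _ _ x y hxy)
      (mul_lt_mul_of_pos_left (fr x y hxy hyx) (ht _).1)
  · intro j x
    exact (convex_Icc (0 : ℝ) 1) (hI _ x) (fI x) (by linarith [(ht j.unpair.2).2])
      (ht _).1.le (by ring)
  · refine fun x y => ⟨fun hxy j => hF _ _ hxy, fun h => ?_⟩
    by_contra hxy
    obtain ⟨k, hk⟩ := hr x y hxy
    have hlim : ∀ z, Filter.Tendsto (fun n => F k n z) Filter.atTop (nhds (g k z)) := by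
      intro z
      have h1 := tendsto_one_div_add_atTop_nhds_zero_nat (𝕜 := ℝ)
      have := ((h1.const_sub 1).mul_const (g k z)).add (h1.mul_const (f z))
      simpa [F] using this
    refine absurd (le_of_tendsto_of_tendsto' (hlim x) (hlim y) fun n => ?_) (not_le.2 hk)
    have := h (Nat.pair k n)
    simpa only [Nat.unpair_pair] using this
end
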